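/- If an integer c admits at least two representations of the form c = P_m − F_n with integers m > 3 and n > 1 (i.e., there exist pairs (m, n) ≠ (m₁, n₁) with m, m₁ > 3, n, n₁ > 1 and P_m − F_n = P_{m₁} − F_{n₁} = c), then c belongs to the set {−226, −82, −52, −30, −27, −18, −9, −6, −5, −4, −3, −1, 0, 1, 2, 3, 4, 6, 7, 8, 10, 11, 13, 15, 16, 20, 25, 31, 32, 36, 44, 52, 62, 111, 262}. -/

import Mathlib

/-- The Padovan sequence: P 0 = P 1 = P 2 = 1 and P (k+3) = P (k+1) + P k. -/
def padovan : ℕ → ℕ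
  | 0 => 1
  | 1 => 1
  | 2 => 1
  | k + 3 => padovan (k + 1) + padovan k

section PartP1
lemma weight_sum {ι : Type*} [Fintype ι] [DecidableEq ι] (g : ι → ℕ)
    (hg : ∀ c, g c ≤ Fintype.card ι)
    (hinj : ∀ c c', g c < Fintype.card ι → g c = g c' → c = c') :
    ∑ i ∈ Finset.range (Fintype.card ι), i ≤ ∑ c, g c := by
  classical
  set T := Fintype.card ι with hT
  set S := Finset.univ.filter (fun c => g c < T) with hS
  have himg : S.image g ⊆ Finset.range T := by
    intro p hp
    obtain ⟨c, hc, rfl⟩ := Finset.mem_image.1 hp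
    exact Finset.mem_range.2 (Finset.mem_filter.1 hc).2
  have hcard : (S.image g).card = S.card := by
    apply Finset.card_image_of_injOn
    intro c hc c' _ h
    exact hinj c c' (Finset.mem_filter.1 hc).2 h
  have hsum1 : ∑ p ∈ S.image g, p = ∑ c ∈ S, g c := by
    rw [Finset.sum_image]
    intro c hc c' _ h
    exact hinj c c' (Finset.mem_filter.1 hc).2 h
  have hcompl : ∑ c ∈ Sᶜ, g c = Sᶜ.card * T := by
    rw [Finset.sum_const_nat]
    intro c hc
    have h1 : ¬ g c < T := by
      intro h
      exact (Finset.mem_compl.1 hc) (Finset.mem_filter.2 ⟨Finset.mem_univ _, h⟩)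
    have := hg c
    omega
  have hmiss : ∑ p ∈ Finset.range T \ S.image g, p ≤ (Finset.range T \ S.image g).card * T := by
    apply Finset.sum_le_card_nsmul
    intro p hp
    have := Finset.mem_range.1 (Finset.mem_sdiff.1 hp).1
    omega
  have hmc : (Finset.range T \ S.image g).card = Sᶜ.card := by
    rw [Finset.card_sdiff_of_subset himg, hcard, Finset.card_compl, Finset.card_range]
  rw [← Finset.sum_sdiff himg, ← Finset.sum_add_sum_compl S g, hsum1, hcompl, ← hmc]
  omega

lemma abs_det_le_prod {ι : Type*} [Fintype ι] [DecidableEq ι] (M : Matrix ι ι ℝ) (b : ι → ℝ)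
    (h : ∀ c i, |M c i| ≤ b c) : |M.det| ≤ (Fintype.card ι).factorial * ∏ c, b c := by
  rw [Matrix.det_apply]
  refine (Finset.abs_sum_le_sum_abs _ _).trans ?_
  have : ∀ σ ∈ (Finset.univ : Finset (Equiv.Perm ι)),
      |Equiv.Perm.sign σ • ∏ i, M (σ i) i| ≤ ∏ c, b c := by
    intro σ _
    have h1 : |Equiv.Perm.sign σ • ∏ i, M (σ i) i| = |∏ i, M (σ i) i| := by
      rcases Int.units_eq_one_or (Equiv.Perm.sign σ) with h | h <;> simp [h]
    rw [h1, Finset.abs_prod, ← Equiv.prod_comp σ b]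
    exact Finset.prod_le_prod (fun _ _ => abs_nonneg _) (fun i _ => h _ _)
  refine (Finset.sum_le_card_nsmul _ _ _ this).trans ?_
  simp [Finset.card_univ, Fintype.card_perm]

/-- the upper bound for an approximately low rank determinant -/
lemma det_bound {ι : Type*} [Fintype ι] [DecidableEq ι] (V : ι → ℕ → ℝ) (W : ℕ → ι → ℝ)
    (E M : ι → ι → ℝ) (C θ : ℝ) (hθ0 : 0 ≤ θ) (hθ1 : θ ≤ 1) (hC : 0 ≤ C)
    (hV : ∀ i p, |V i p| ≤ 1) (hW : ∀ p c, |W p c| ≤ C * θ ^ p)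
    (hE : ∀ i c, |E i c| ≤ C * θ ^ (Fintype.card ι))
    (hM : ∀ i c, M i c = ∑ p ∈ Finset.range (Fintype.card ι), V i p * W p c + E i c) :
    |(Matrix.of M).det| ≤ ((Fintype.card ι : ℝ) + 1) ^ (Fintype.card ι) *
      ((Fintype.card ι).factorial * (C ^ (Fintype.card ι) *
        θ ^ (∑ i ∈ Finset.range (Fintype.card ι), i))) := by
  classical
  set T := Fintype.card ι with hT
  let s : ι → ℕ → ℝ := fun c p => if p < T then W p c else 1
  let v : ι → ℕ → ι → ℝ := fun c p i => if p < T then V i p else E i c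
  have hMt : (Matrix.of M).transpose = Matrix.of (fun c => ∑ p : Fin (T+1), s c p • v c p) := by
    ext c i
    simp only [Matrix.transpose_apply, Matrix.of_apply, Finset.sum_apply, Pi.smul_apply, smul_eq_mul]
    rw [hM, Fin.sum_univ_castSucc]
    simp only [Fin.val_castSucc, Fin.val_last, s, v, lt_irrefl, if_false, one_mul]
    congr 1
    rw [← Fin.sum_univ_eq_sum_range (fun p => V i p * W p c)]
    refine Finset.sum_congr rfl fun p _ => ?_
    simp [p.2, mul_comm]
  rw [← Matrix.det_transpose, hMt]
  have hexp := (Matrix.detRowAlternating (n := ι) (R := ℝ)).toMultilinearMap.map_sum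
    (fun c (p : Fin (T+1)) => s c p • v c p)
  have hexp' : (Matrix.of (fun c => ∑ p : Fin (T+1), s c p • v c p)).det =
      ∑ g : ι → Fin (T+1), (Matrix.of (fun c => s c (g c) • v c (g c))).det := hexp
  rw [hexp']
  refine (Finset.abs_sum_le_sum_abs _ _).trans ?_
  have key : ∀ g ∈ (Finset.univ : Finset (ι → Fin (T+1))),
      |(Matrix.of (fun c => s c (g c) • v c (g c))).det| ≤
      (T.factorial * (C ^ T * θ ^ (∑ i ∈ Finset.range T, i))) := by
    intro g _
    by_cases hinj : ∀ c c', (g c : ℕ) < T → (g c : ℕ) = g c' → c = c'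
    · have hw := weight_sum (fun c => (g c : ℕ)) (fun c => by have := (g c).2; omega) hinj
      refine (abs_det_le_prod _ (fun c => C * θ ^ (g c : ℕ)) ?_).trans ?_
      · intro c i
        simp only [Matrix.of_apply, Pi.smul_apply, smul_eq_mul, s, v]
        split_ifs with h
        · rw [abs_mul]
          calc |W (g c) c| * |V i (g c)| ≤ (C * θ ^ (g c : ℕ)) * 1 :=
                mul_le_mul (hW _ _) (hV _ _) (abs_nonneg _) (by positivity)
            _ = _ := mul_one _
        · have : (g c : ℕ) = T := by have := (g c).2; omega
          rw [one_mul, this]; exact hE i c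
      · rw [Finset.prod_mul_distrib, Finset.prod_const, Finset.prod_pow_eq_pow_sum, Finset.card_univ]
        have := pow_le_pow_of_le_one hθ0 hθ1 hw
        gcongr
    · push Not at hinj
      obtain ⟨c, c', h1, h2, h3⟩ := hinj
      have hz : (Matrix.of (fun c => s c (g c) • v c (g c))).det = 0 := by
        have := (Matrix.detRowAlternating (n := ι) (R := ℝ)).toMultilinearMap.map_smul_univ
          (fun c => s c (g c)) (fun c => v c (g c))
        have h4 : (Matrix.of (fun c => s c (g c) • v c (g c))).det =
          (∏ c, s c (g c)) • (Matrix.of (fun c => v c (g c))).det := this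
        rw [h4, Matrix.det_zero_of_row_eq h3, smul_zero]
        funext i
        simp only [Matrix.of_apply, v, ← h2, h1, if_true]
      rw [hz, abs_zero]
      positivity
  refine (Finset.sum_le_card_nsmul _ _ _ key).trans ?_
  rw [Finset.card_univ, Fintype.card_fun, Fintype.card_fin, nsmul_eq_mul]
  push_cast
  exact le_of_eq rfl

end PartP1

section PartP2
/-- `f` has a power series on `[-1,1]` whose weighted `ℓ¹` norm with radius `R` is at most `C`. -/
def PSb (R C : ℝ) (f : ℝ → ℝ) : Prop :=
  ∃ W : ℕ → ℝ, Summable (fun p => |W p| * R ^ p) ∧ ∑' p, |W p| * R ^ p ≤ C ∧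
    ∀ t, |t| ≤ 1 → HasSum (fun p => W p * t ^ p) (f t)

lemma PSb.mul {R C C' : ℝ} {f g : ℝ → ℝ} (hR : 1 ≤ R) (hf : PSb R C f) (hg : PSb R C' g) :
    PSb R (C * C') (fun t => f t * g t) := by
  obtain ⟨W, hW, hWC, hWf⟩ := hf
  obtain ⟨W', hW', hWC', hWf'⟩ := hg
  have hR0 : 0 ≤ R := by linarith
  have hn : Summable (fun p => ‖W p * R ^ p‖) := by
    simpa [abs_mul, abs_pow, abs_of_nonneg hR0] using hW
  have hn' : Summable (fun p => ‖W' p * R ^ p‖) := by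
    simpa [abs_mul, abs_pow, abs_of_nonneg hR0] using hW'
  have ha : Summable (fun p => ‖|W p| * R ^ p‖) := by
    simpa [abs_mul, abs_pow, abs_of_nonneg hR0] using hW
  have ha' : Summable (fun p => ‖|W' p| * R ^ p‖) := by
    simpa [abs_mul, abs_pow, abs_of_nonneg hR0] using hW'
  have hprod := summable_norm_sum_mul_antidiagonal_of_summable_norm ha ha'
  have hprodeq := tsum_mul_tsum_eq_tsum_sum_antidiagonal_of_summable_norm ha ha'
  have hprod2 : Summable (fun n => ∑ kl ∈ Finset.HasAntidiagonal.antidiagonal n,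
      |W kl.1| * R ^ kl.1 * (|W' kl.2| * R ^ kl.2)) := hprod.of_norm
  have hle : ∀ n, |∑ kl ∈ Finset.HasAntidiagonal.antidiagonal n, W kl.1 * W' kl.2| * R ^ n ≤
      ∑ kl ∈ Finset.HasAntidiagonal.antidiagonal n, |W kl.1| * R ^ kl.1 * (|W' kl.2| * R ^ kl.2) := by
    intro n
    have h1 := Finset.abs_sum_le_sum_abs (fun kl : ℕ × ℕ => W kl.1 * W' kl.2)
      (Finset.HasAntidiagonal.antidiagonal n)
    refine (mul_le_mul_of_nonneg_right h1 (by positivity)).trans ?_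
    rw [Finset.sum_mul]
    refine Finset.sum_le_sum fun kl hkl => le_of_eq ?_
    rw [← Finset.HasAntidiagonal.mem_antidiagonal.1 hkl, abs_mul, pow_add]; ring
  refine ⟨fun n => ∑ kl ∈ Finset.HasAntidiagonal.antidiagonal n, W kl.1 * W' kl.2, ?_, ?_, ?_⟩
  · exact Summable.of_nonneg_of_le (fun n => by positivity) hle hprod2
  · refine (Summable.tsum_le_tsum hle
      (Summable.of_nonneg_of_le (fun n => by positivity) hle hprod2) hprod2).trans ?_
    rw [← hprodeq]
    exact mul_le_mul hWC hWC' (tsum_nonneg fun p => by positivity)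
      ((tsum_nonneg fun p => by positivity).trans hWC)
  · intro t ht
    have hs : ∀ {V : ℕ → ℝ}, Summable (fun p => |V p| * R ^ p) →
        Summable (fun p => ‖V p * t ^ p‖) := by
      intro V hV
      refine Summable.of_nonneg_of_le (fun n => norm_nonneg _) (fun n => ?_) hV
      rw [norm_mul, norm_pow, Real.norm_eq_abs, Real.norm_eq_abs]
      gcongr
      exact ht.trans hR
    have e1 := tsum_mul_tsum_eq_tsum_sum_antidiagonal_of_summable_norm (hs hW) (hs hW')
    have s1 := (summable_norm_sum_mul_antidiagonal_of_summable_norm (hs hW) (hs hW')).of_norm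
    rw [(hWf t ht).tsum_eq, (hWf' t ht).tsum_eq] at e1
    beta_reduce
    rw [e1]
    suffices hfe : (fun n => (∑ kl ∈ Finset.HasAntidiagonal.antidiagonal n, W kl.1 * W' kl.2) * t ^ n) =
      fun n => ∑ kl ∈ Finset.HasAntidiagonal.antidiagonal n,
        W kl.1 * t ^ kl.1 * (W' kl.2 * t ^ kl.2) by
      rw [hfe]; exact s1.hasSum
    funext n
    rw [Finset.sum_mul]
    refine Finset.sum_congr rfl fun kl hkl => ?_
    rw [← Finset.HasAntidiagonal.mem_antidiagonal.1 hkl, pow_add]; ring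

lemma PSb.mono {R C C' : ℝ} {f : ℝ → ℝ} (hf : PSb R C f) (h : C ≤ C') : PSb R C' f := by
  obtain ⟨W, hW, hWC, hWf⟩ := hf
  exact ⟨W, hW, hWC.trans h, hWf⟩

lemma PSb.lin {R : ℝ} (hR : 0 ≤ R) (a b : ℝ) : PSb R (|a| + |b| * R) (fun t => a + b * t) := by
  refine ⟨fun p => if p = 0 then a else if p = 1 then b else 0, ?_, ?_, ?_⟩
  · refine (hasSum_sum_of_ne_finset_zero (s := Finset.range 2) (L := .unconditional ℕ) ?_).summable
    intro p hp
    have : p ≠ 0 ∧ p ≠ 1 := by simp at hp; omega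
    simp [this]
  · rw [tsum_eq_sum (s := Finset.range 2)]
    · simp [Finset.sum_range_succ]
    · intro p hp
      have : p ≠ 0 ∧ p ≠ 1 := by simp at hp; omega
      simp [this]
  · intro t _
    have := hasSum_sum_of_ne_finset_zero (L := .unconditional ℕ) (f := fun p : ℕ => (if p = 0 then a else if p = 1 then b else 0) * t ^ p)
      (s := Finset.range 2) (by
        intro p hp
        have : p ≠ 0 ∧ p ≠ 1 := by simp at hp; omega
        simp [this])
    simpa [Finset.sum_range_succ] using this

lemma PSb.exp {R : ℝ} (hR : 0 ≤ R) (a : ℝ) : PSb R (Real.exp (|a| * R)) (fun t => Real.exp (a * t)) := by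
  have hx : ∀ x : ℝ, HasSum (fun n : ℕ => x ^ n / (n.factorial : ℝ)) (Real.exp x) := by
    intro x
    rw [Real.exp_eq_exp_ℝ]
    exact NormedSpace.expSeries_div_hasSum_exp x
  have h1 : (fun p : ℕ => |a ^ p / (p.factorial : ℝ)| * R ^ p) =
      fun p : ℕ => (|a| * R) ^ p / (p.factorial : ℝ) := by
    funext p
    rw [abs_div, abs_pow, Nat.abs_cast, mul_pow]; ring
  refine ⟨fun p => a ^ p / (p.factorial : ℝ), ?_, ?_, ?_⟩
  · rw [h1]; exact (hx _).summable
  · rw [h1, (hx _).tsum_eq]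
  · intro t _
    convert hx (a * t) using 2 with p
    rw [mul_pow]; ring

lemma PSb.choose {R X : ℝ} (hR : 1 ≤ R) (hX : 0 ≤ X) (k : ℕ) :
    PSb R (∏ i ∈ Finset.range k, ((i + X * R) / (i + 1)))
      (fun t => ∏ i ∈ Finset.range k, ((X * t - i) / (i + 1))) := by
  induction k with
  | zero =>
    have := PSb.lin (R := R) (by linarith) 1 0
    simpa using this
  | succ k ih =>
    have h2 := PSb.lin (R := R) (by linarith) (-(k : ℝ) / (k + 1)) (X / (k + 1))
    have h3 := ih.mul hR h2
    have hk : (0 : ℝ) < k + 1 := by positivity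
    simp only [Finset.prod_range_succ]
    convert h3 using 1
    · rw [abs_div, abs_div, abs_neg, abs_of_nonneg hX, abs_of_pos hk, Nat.abs_cast]
      ring
    · funext t; ring

/-- consequences used for the determinant -/
lemma PSb.bounds {R C : ℝ} {f : ℝ → ℝ} (hR : 1 ≤ R) (hf : PSb R C f) :
    ∃ W : ℕ → ℝ, (∀ p, |W p| ≤ C * (R⁻¹) ^ p) ∧
      ∀ t, |t| ≤ 1 → ∀ T, |f t - ∑ p ∈ Finset.range T, t ^ p * W p| ≤ C * (R⁻¹) ^ T := by
  obtain ⟨W, hW, hWC, hWf⟩ := hf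
  have hR0 : 0 < R := by linarith
  refine ⟨W, ?_, ?_⟩
  · intro p
    have h1 : |W p| * R ^ p ≤ C :=
      (hW.le_tsum p (fun q _ => by positivity)).trans hWC
    rw [inv_pow, ← div_eq_mul_inv, le_div_iff₀ (by positivity)]
    exact h1
  · intro t ht T
    have hs := hWf t ht
    have h2 := hs.summable.sum_add_tsum_nat_add T
    rw [hs.tsum_eq] at h2
    have h3 : f t - ∑ p ∈ Finset.range T, t ^ p * W p = ∑' p, W (p + T) * t ^ (p + T) := by
      rw [← h2]
      simp only [mul_comm (t ^ _)]
      ring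
    rw [h3]
    have hW2 : Summable (fun p => |W (p + T)| * R ^ (p + T)) := (summable_nat_add_iff T).2 hW
    have h4 : ∀ p, ‖W (p + T) * t ^ (p + T)‖ ≤ (|W (p + T)| * R ^ (p + T)) * (R⁻¹) ^ T := by
      intro p
      rw [norm_mul, norm_pow, Real.norm_eq_abs, Real.norm_eq_abs, mul_assoc]
      gcongr
      rw [pow_add R, mul_assoc, ← mul_pow, mul_inv_cancel₀ hR0.ne', one_pow, mul_one]
      calc |t| ^ (p + T) ≤ 1 := pow_le_one₀ (abs_nonneg _) ht
        _ ≤ R ^ p := one_le_pow₀ hR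
    have h5 := tsum_of_norm_bounded (hW2.mul_right _).hasSum h4
    rw [Real.norm_eq_abs] at h5
    refine h5.trans ?_
    rw [tsum_mul_right]
    gcongr
    refine le_trans ?_ hWC
    rw [← hW.sum_add_tsum_nat_add T]
    have : 0 ≤ ∑ i ∈ Finset.range T, |W i| * R ^ i := Finset.sum_nonneg fun i _ => by positivity
    linarith

lemma prod_choose_bound {R X : ℝ} (hR : 1 ≤ R) (hX : 0 < X) (K : ℕ) (hK : 0 < K) (hKX : (K : ℝ) ≤ X)
    (k : ℕ) (hk : k ≤ K) :
    ∏ i ∈ Finset.range k, ((i + X * R) / ((i : ℝ) + 1)) ≤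
      Real.exp (K * (1 + Real.log (2 * R * X / K))) := by
  have hK0 : (0 : ℝ) < K := by exact_mod_cast hK
  set Y := 2 * R * X with hY
  have hYpos : 0 < Y := by positivity
  have hYK : (K : ℝ) ≤ Y := by nlinarith
  have h1 : ∏ i ∈ Finset.range k, ((i + X * R) / ((i : ℝ) + 1)) ≤ Y ^ k / k.factorial := by
    rw [← Finset.prod_range_add_one_eq_factorial, Nat.cast_prod,
      Finset.prod_div_distrib]
    push_cast
    gcongr
    calc ∏ i ∈ Finset.range k, ((i : ℝ) + X * R) ≤ ∏ i ∈ Finset.range k, Y := by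
          refine Finset.prod_le_prod (fun i _ => by positivity) fun i hi => ?_
          have h2 : (i : ℝ) ≤ K := by
            have := Finset.mem_range.1 hi
            exact_mod_cast (by omega : i ≤ K)
          nlinarith
      _ = Y ^ k := by simp
  refine h1.trans ?_
  have h2 : (K : ℝ) ^ k / k.factorial ≤ Real.exp K := Real.pow_div_factorial_le_exp _ hK0.le k
  have h3 : Y ^ k / k.factorial = (Y / K) ^ k * ((K : ℝ) ^ k / k.factorial) := by
    rw [div_pow]; field_simp
  rw [h3, mul_add, mul_one, Real.exp_add, mul_comm]
  have h4 : (Y / K) ^ k ≤ Real.exp (K * Real.log (Y / K)) := by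
    rw [mul_comm, Real.exp_mul, Real.exp_log (by positivity), Real.rpow_natCast]
    exact pow_le_pow_right₀ ((one_le_div hK0).2 hYK) hk
  gcongr

end PartP2

section PartP3
/-- choose rows with nonzero determinant -/
lemma exists_rows {F : Type*} [Field F] {m ι : Type*} [Fintype m] [Fintype ι] [DecidableEq ι]
    (A : Matrix m ι F) (h : ∀ p : ι → F, A.mulVec p = 0 → p = 0) :
    ∃ f : ι → m, (A.submatrix f id).det ≠ 0 := by
  classical
  have hcol : LinearIndependent F A.transpose.row := by
    have : LinearIndependent F A.col := by
      rw [← Matrix.mulVec_injective_iff]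
      exact (injective_iff_map_eq_zero A.mulVecLin).2 h
    exact this
  have hrank : A.rank = Fintype.card ι := by
    rw [← Matrix.rank_transpose]; exact hcol.rank_matrix
  rw [Matrix.rank_eq_finrank_span_row] at hrank
  obtain ⟨f, hf1, hf2, hf3⟩ := Submodule.exists_fun_fin_finrank_span_eq F (Set.range A.row)
  choose g hg using hf1
  let e : ι ≃ Fin (Module.finrank F (Submodule.span F (Set.range A.row))) :=
    (Fintype.equivFin ι).trans (finCongr hrank.symm)
  refine ⟨fun i => g (e i), ?_⟩
  have hli : LinearIndependent F (A.submatrix (fun i => g (e i)) id).row := by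
    have : (A.submatrix (fun i => g (e i)) id).row = f ∘ e := by
      funext i
      exact hg (e i)
    rw [this]
    exact hf3.comp _ e.injective
  rw [Matrix.linearIndependent_rows_iff_isUnit, Matrix.isUnit_iff_isUnit_det] at hli
  exact hli.ne_zero

open Polynomial in
lemma zero_estimate {F : Type*} [Field F] [CharZero F] (η v : F) (hη : η ≠ 0) (hv : v ≠ 0)
    (hinj : ∀ a b : ℕ, η ^ a = η ^ b → a = b) (K L' N L r : ℕ) (hK : 0 < K)
    (hKL : K * L' ≤ N * L) (hNr : N ≤ r)
    (p : Fin K × Fin L' → F)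
    (hp : ∀ j < N + L', ∀ l < L, ∑ c : Fin K × Fin L',
      ((j + r * l).choose c.1 : F) * (η ^ j * v ^ l) ^ (c.2 : ℕ) * p c = 0) : p = 0 := by
  classical
  by_contra hpne
  let Q : Fin L' → F[X] := fun lam => ∑ k : Fin K,
    C (p (k, lam) / ((k : ℕ).factorial : F)) * descPochhammer F k
  have hQeval : ∀ lam (x : ℕ), (Q lam).eval (x : F) = ∑ k : Fin K, (x.choose k : F) * p (k, lam) := by
    intro lam x
    simp only [Q, eval_finsetSum, eval_mul, eval_C, descPochhammer_eval_eq_descFactorial]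
    refine Finset.sum_congr rfl fun k _ => ?_
    rw [Nat.descFactorial_eq_factorial_mul_choose]
    have : (((k : ℕ).factorial : ℕ) : F) ≠ 0 := by exact_mod_cast (Nat.factorial_pos _).ne'
    push_cast
    field_simp
  have hQdeg : ∀ lam, (Q lam).natDegree ≤ K - 1 := by
    intro lam
    refine natDegree_sum_le_of_forall_le _ _ fun k _ => ?_
    refine (natDegree_C_mul_le _ _).trans ?_
    rw [descPochhammer_natDegree]
    have := k.2
    omega
  have hQ0 : ∀ lam, Q lam = 0 → ∀ k, p (k, lam) = 0 := by
    intro lam h0 k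
    obtain ⟨k, hk⟩ := k
    induction k using Nat.strong_induction_on with
    | _ k ih =>
      have h1 := hQeval lam k
      rw [h0, eval_zero, Finset.sum_eq_single ⟨k, hk⟩] at h1
      · simpa using h1.symm
      · intro b _ hb
        rcases lt_trichotomy (b : ℕ) k with h | h | h
        · have := ih b h b.2
          simp only [Fin.eta] at this
          rw [this, mul_zero]
        · exact absurd (Fin.ext h) hb
        · rw [Nat.choose_eq_zero_of_lt h]; simp
      · simp
  let S := {lam : Fin L' // Q lam ≠ 0}
  let n := Fintype.card S
  have hnL : n ≤ L' := by
    have := Fintype.card_subtype_le (fun lam : Fin L' => Q lam ≠ 0)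
    simpa [n, S] using this
  let e : Fin n ≃ S := (Fintype.equivFin S).symm
  have hn : 0 < n := by
    rw [Fintype.card_pos_iff]
    by_contra hne
    apply hpne
    funext ⟨k, lam⟩
    by_contra hh
    exact hne ⟨⟨lam, fun h => hh (hQ0 lam h k)⟩⟩
  let Dm : Matrix (Fin n) (Fin n) F[X] := Matrix.of fun a b =>
    C (η ^ ((a : ℕ) * (e b).1)) * taylor (a : F) (Q (e b).1)
  let d := ∑ b : Fin n, (Q (e b).1).natDegree
  have hterm : ∀ σ : Equiv.Perm (Fin n), (∏ b, Dm (σ b) b).natDegree = d ∧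
      (∏ b, Dm (σ b) b).coeff d = (∏ b, η ^ ((σ b : ℕ) * (e b).1)) *
        ∏ b, (Q (e b).1).leadingCoeff := by
    intro σ
    have hne : ∀ b, Dm (σ b) b ≠ 0 := by
      intro b
      simp only [Dm, Matrix.of_apply]
      refine mul_ne_zero (C_ne_zero.2 (pow_ne_zero _ hη)) ?_
      rw [Ne, taylor_eq_zero]
      exact (e b).2
    have h1 : (∏ b, Dm (σ b) b).natDegree = d := by
      rw [natDegree_prod _ _ (fun b _ => hne b)]
      refine Finset.sum_congr rfl fun b _ => ?_
      simp only [Dm, Matrix.of_apply]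
      rw [natDegree_C_mul (pow_ne_zero _ hη), natDegree_taylor]
    refine ⟨h1, ?_⟩
    rw [← h1, coeff_natDegree, leadingCoeff_prod, ← Finset.prod_mul_distrib]
    refine Finset.prod_congr rfl fun b _ => ?_
    simp only [Dm, Matrix.of_apply]
    rw [leadingCoeff_mul, leadingCoeff_C, leadingCoeff_taylor]
  have hcoeff : Dm.det.coeff d = (Matrix.vandermonde (fun b => η ^ ((e b).1 : ℕ))).det *
      ∏ b, (Q (e b).1).leadingCoeff := by
    rw [← Matrix.det_transpose (Matrix.vandermonde _), Matrix.det_apply, Matrix.det_apply,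
      finsetSum_coeff, Finset.sum_mul]
    refine Finset.sum_congr rfl fun σ _ => ?_
    have h2 : (∏ b, (Matrix.vandermonde (fun b => η ^ ((e b).1 : ℕ))).transpose (σ b) b) =
        ∏ b, η ^ ((σ b : ℕ) * (e b).1) := by
      refine Finset.prod_congr rfl fun b _ => ?_
      rw [Matrix.transpose_apply, Matrix.vandermonde_apply, ← pow_mul, mul_comm]
    rw [h2, smul_mul_assoc, ← (hterm σ).2]
    rcases Int.units_eq_one_or (Equiv.Perm.sign σ) with h | h <;> simp [h]
  have hDne : Dm.det ≠ 0 := by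
    intro h0
    rw [h0, coeff_zero] at hcoeff
    have h3 : (Matrix.vandermonde (fun b => η ^ ((e b).1 : ℕ))).det ≠ 0 := by
      rw [Matrix.det_vandermonde_ne_zero_iff]
      intro b b' hb
      exact e.injective (Subtype.ext (Fin.ext (hinj _ _ hb)))
    have h4 : ∏ b, (Q (e b).1).leadingCoeff ≠ 0 :=
      Finset.prod_ne_zero_iff.2 fun b _ => leadingCoeff_ne_zero.2 (e b).2
    exact mul_ne_zero h3 h4 hcoeff.symm
  have hDdeg : Dm.det.natDegree ≤ n * (K - 1) := by
    have hd : d ≤ n * (K - 1) := by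
      have := Finset.sum_le_card_nsmul (Finset.univ : Finset (Fin n))
        (fun b => (Q (e b).1).natDegree) (K - 1) (fun b _ => hQdeg _)
      simpa using this
    refine le_trans ?_ hd
    rw [Matrix.det_apply]
    refine natDegree_sum_le_of_forall_le _ _ fun σ _ => ?_
    rcases Int.units_eq_one_or (Equiv.Perm.sign σ) with h | h <;> simp [h, (hterm σ).1]
  apply hDne
  let pt : Fin N × Fin L → F := fun q => ((q.1 + r * q.2 : ℕ) : F)
  have hptinj : Function.Injective pt := by
    rintro ⟨j, l⟩ ⟨j', l'⟩ h
    have h' : (j : ℕ) + r * l = j' + r * l' := Nat.cast_injective (R := F) h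
    have hj : (j : ℕ) < r := lt_of_lt_of_le j.2 hNr
    have hj' : (j' : ℕ) < r := lt_of_lt_of_le j'.2 hNr
    have hl : (l : ℕ) = l' := by
      have h5 := congrArg (· / r) h'
      simp only [Nat.add_mul_div_left _ _ (by omega : 0 < r), Nat.div_eq_of_lt hj,
        Nat.div_eq_of_lt hj', zero_add] at h5
      exact h5
    have hj2 : (j : ℕ) = j' := by rw [hl] at h'; omega
    exact Prod.ext (Fin.ext hj2) (Fin.ext hl)
  refine eq_zero_of_natDegree_lt_card_of_eval_eq_zero _ hptinj ?_ ?_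
  · rintro ⟨j, l⟩
    have hev : Dm.det.eval (pt (j, l)) = (Dm.map (evalRingHom (pt (j, l)))).det := by
      rw [← coe_evalRingHom, RingHom.map_det]; rfl
    rw [hev, ← Matrix.exists_mulVec_eq_zero_iff]
    refine ⟨fun b => (η ^ (j : ℕ) * v ^ (l : ℕ)) ^ ((e b).1 : ℕ), ?_, ?_⟩
    · intro h
      have := congrFun h ⟨0, hn⟩
      simp only [Pi.zero_apply] at this
      exact pow_ne_zero _ (mul_ne_zero (pow_ne_zero _ hη) (pow_ne_zero _ hv)) this
    · funext a
      have ha : (j : ℕ) + a < N + L' := by have := j.2; have := a.2; omega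
      have h6 := hp (j + a) ha l l.2
      rw [Fintype.sum_prod_type_right] at h6
      simp only [Matrix.mulVec, dotProduct, Matrix.map_apply, Dm, Matrix.of_apply,
        coe_evalRingHom, eval_mul, eval_C, taylor_eval, Pi.zero_apply]
      have h7 : ∀ lam : Fin L', ∑ k : Fin K, (((j : ℕ) + a + r * l).choose k : F) *
          (η ^ ((j : ℕ) + a) * v ^ (l : ℕ)) ^ (lam : ℕ) * p (k, lam) =
          η ^ ((a : ℕ) * lam) * (Q lam).eval (pt (j, l) + (a : F)) *
            (η ^ (j : ℕ) * v ^ (l : ℕ)) ^ (lam : ℕ) := by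
        intro lam
        have h8 : pt (j, l) + (a : F) = (((j : ℕ) + a + r * l : ℕ) : F) := by
          simp only [pt]; push_cast; ring
        rw [h8, hQeval, Finset.mul_sum, Finset.sum_mul]
        refine Finset.sum_congr rfl fun k _ => ?_
        rw [pow_add, pow_mul]
        ring
      rw [Finset.sum_congr rfl (fun lam _ => h7 lam)] at h6
      rw [Equiv.sum_comp e (fun b : S => η ^ ((a : ℕ) * b.1) * (Q b.1).eval (pt (j, l) + (a : F)) *
            (η ^ (j : ℕ) * v ^ (l : ℕ)) ^ (b.1 : ℕ))]
      rw [← h6]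
      let G : Fin L' → F := fun lam => η ^ ((a : ℕ) * (lam : ℕ)) *
        (Q lam).eval (pt (j, l) + (a : F)) * (η ^ (j : ℕ) * v ^ (l : ℕ)) ^ (lam : ℕ)
      have h9 : ∑ lam ∈ (Finset.univ : Finset (Fin L')).filter (fun lam => Q lam ≠ 0), G lam =
          ∑ b : S, G b.1 := Finset.sum_subtype _ (by simp) G
      have h10 : ∑ lam ∈ (Finset.univ : Finset (Fin L')).filter (fun lam => Q lam ≠ 0), G lam =
          ∑ lam, G lam := by
        refine Finset.sum_subset (Finset.filter_subset _ _) fun lam _ h => ?_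
        have h11 : Q lam = 0 := by simpa using h
        simp only [G]
        rw [h11]; simp
      exact h9.symm.trans h10
  · rw [Fintype.card_prod, Fintype.card_fin, Fintype.card_fin]
    refine lt_of_le_of_lt hDdeg (lt_of_lt_of_le ?_ hKL)
    calc n * (K - 1) < n * K := Nat.mul_lt_mul_of_pos_left (by omega) hn
      _ ≤ L' * K := Nat.mul_le_mul_right _ hnL
      _ = K * L' := mul_comm _ _

end PartP3

section PartP4
lemma liouville {K : Type*} [Field K] [NumberField K] (hd : Module.finrank ℚ K ≤ 6) (σ₀ : K →+* ℂ)
    (x : K) (hx : IsIntegral ℤ x) (hx0 : x ≠ 0) (H : ℝ) (hH1 : 1 ≤ H) (hH : ∀ σ : K →+* ℂ, ‖σ x‖ ≤ H) :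
    1 ≤ ‖σ₀ x‖ * H ^ 5 := by
  have h1 := Algebra.norm_eq_prod_embeddings ℚ ℂ x
  have h2 : IsIntegral ℤ (Algebra.norm ℚ x) := Algebra.isIntegral_norm ℚ hx
  obtain ⟨z, hz⟩ := IsIntegrallyClosed.isIntegral_iff.1 h2
  have hz0 : z ≠ 0 := by
    rintro rfl
    simp only [map_zero] at hz
    exact hx0 (Algebra.norm_eq_zero_iff.1 hz.symm)
  have h3 : (1 : ℝ) ≤ ‖(algebraMap ℚ ℂ) (Algebra.norm ℚ x)‖ := by
    rw [← hz]
    have : (1 : ℝ) ≤ |(z : ℝ)| := by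
      exact_mod_cast Int.one_le_abs hz0
    simpa using this
  rw [h1, norm_prod] at h3
  classical
  let τ : K →ₐ[ℚ] ℂ := σ₀.toRatAlgHom
  rw [← Finset.mul_prod_erase _ _ (Finset.mem_univ τ)] at h3
  refine h3.trans ?_
  have h4 : ∏ σ ∈ Finset.univ.erase τ, ‖σ x‖ ≤ H ^ 5 := by
    calc _ ≤ ∏ σ ∈ Finset.univ.erase τ, H :=
          Finset.prod_le_prod (fun _ _ => norm_nonneg _) (fun σ _ => hH (σ : K →+* ℂ))
      _ = H ^ (Finset.univ.erase τ).card := by simp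
      _ ≤ H ^ 5 := by
          apply pow_le_pow_right₀ hH1
          rw [Finset.card_erase_of_mem (Finset.mem_univ τ), Finset.card_univ, AlgHom.card]
          omega
  have h5 : ‖τ x‖ = ‖σ₀ x‖ := rfl
  rw [h5]
  exact mul_le_mul_of_nonneg_left h4 (norm_nonneg _)

lemma det_norm_le {ι : Type*} [Fintype ι] [DecidableEq ι] (A : Matrix ι ι ℂ) (b : ℝ)
    (h : ∀ i j, ‖A i j‖ ≤ b) : ‖A.det‖ ≤ (Fintype.card ι).factorial * b ^ Fintype.card ι := by
  have := Matrix.det_le (abv := NormedField.toAbsoluteValue ℂ) (A := A) (x := b) (fun i j => h i j)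
  rw [nsmul_eq_mul] at this
  exact this

end PartP4

section PartP5
lemma choose_prod_cast (x k : ℕ) : ((x.choose k : ℕ) : ℝ) = ∏ i ∈ Finset.range k, (((x : ℝ) - i) / ((i : ℝ) + 1)) := by
  induction k with
  | zero => simp
  | succ k ih =>
    rw [Finset.prod_range_succ, ← ih, mul_div_assoc', eq_div_iff (by positivity)]
    have h := Nat.choose_succ_right_eq x k
    rcases le_or_gt k x with hk | hk
    · have : ((x.choose (k+1) * (k+1) : ℕ) : ℝ) = ((x.choose k * (x - k) : ℕ) : ℝ) := by rw [h]
      push_cast [Nat.cast_sub hk] at this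
      exact this
    · rw [Nat.choose_eq_zero_of_lt hk, Nat.choose_eq_zero_of_lt (by omega)]; simp

lemma core_upper (K L' L r : ℕ) (x l : Fin K × Fin L' → ℕ) (ε Λ : ℝ) (hε : 0 ≤ ε)
    (hK : 0 < K) (hKX : K ≤ r * L) (hx : ∀ i, x i ≤ r * L) (hl : ∀ i, l i ≤ L)
    (hΛ : 2 * (L * L') * |Λ| ≤ (Real.exp 3)⁻¹ ^ (K * L')) :
    |(Matrix.of (fun i c : Fin K × Fin L' => ((x i).choose c.1 : ℝ) * Real.exp ((c.2 : ℕ) * ε * x i)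
        * Real.exp (-((c.2 : ℕ) * l i * Λ)))).det| ≤
      ((K * L' : ℕ) + 1 : ℝ) ^ (K * L') * ((K * L').factorial *
       ((2 * Real.exp (K * (1 + Real.log (2 * Real.exp 3 * ((r * L : ℕ) : ℝ) / K)) + L' * ((r * L : ℕ) : ℝ) * ε * Real.exp 3)) ^ (K * L')
        * (Real.exp 3)⁻¹ ^ (∑ i ∈ Finset.range (K * L'), i))) := by
  set X : ℝ := ((r * L : ℕ) : ℝ) with hXdef
  have hX : 0 < X := by rw [hXdef]; exact_mod_cast lt_of_lt_of_le hK hKX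
  set R := Real.exp 3 with hR
  have hR1 : 1 ≤ R := by rw [hR]; exact Real.one_le_exp (by norm_num)
  set C := Real.exp (K * (1 + Real.log (2 * R * X / K)) + L' * X * ε * R) with hC
  have hC0 : 0 < C := Real.exp_pos _
  have hcard : Fintype.card (Fin K × Fin L') = K * L' := by simp
  have hR0 : 0 < R := by linarith
  have hRi : R⁻¹ ≤ 1 := inv_le_one_of_one_le₀ hR1
  -- functions
  have hf : ∀ c : Fin K × Fin L', PSb R C (fun t => (∏ i ∈ Finset.range (c.1 : ℕ), ((X * t - i) / (i + 1))) * Real.exp (((c.2 : ℕ) * ε * X) * t)) := by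
    intro c
    refine ((PSb.choose hR1 hX.le c.1).mul hR1 (PSb.exp hR0.le _)).mono ?_
    rw [hC, Real.exp_add]
    have h1 := prod_choose_bound hR1 hX K hK (by rw [hXdef]; exact_mod_cast hKX) c.1 c.1.2.le
    refine mul_le_mul h1 ?_ (Real.exp_pos _).le (Real.exp_pos _).le
    apply Real.exp_le_exp.2
    rw [abs_of_nonneg (by positivity)]
    have : ((c.2 : ℕ) : ℝ) ≤ L' := by exact_mod_cast c.2.2.le
    nlinarith [mul_le_mul_of_nonneg_right this (show 0 ≤ ε * X * R by positivity)]
  choose W hW1 hW2 using fun c => (hf c).bounds hR1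
  set f : (Fin K × Fin L') → ℝ → ℝ := fun c t => (∏ i ∈ Finset.range (c.1 : ℕ), ((X * t - i) / (i + 1))) * Real.exp (((c.2 : ℕ) * ε * X) * t) with hfdef
  set t : Fin K × Fin L' → ℝ := fun i => x i / X with ht
  have htX : ∀ i, X * t i = x i := fun i => by rw [ht]; field_simp
  have ht0 : ∀ i, 0 ≤ t i := fun i => by rw [ht]; positivity
  have ht1 : ∀ i, t i ≤ 1 := fun i => by
    rw [ht]; simp only; rw [div_le_one hX, hXdef]; exact_mod_cast hx i
  have htabs : ∀ i, |t i| ≤ 1 := fun i => by rw [abs_of_nonneg (ht0 i)]; exact ht1 i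
  have hfv : ∀ i c, f c (t i) = ((x i).choose c.1 : ℝ) * Real.exp ((c.2 : ℕ) * ε * x i) := by
    intro i c
    rw [choose_prod_cast, hfdef]
    simp only [htX, mul_assoc]
  have key := det_bound (ι := Fin K × Fin L') (fun i p => t i ^ p) (fun p c => W c p)
    (fun i c => ((x i).choose c.1 : ℝ) * Real.exp ((c.2 : ℕ) * ε * x i) * Real.exp (-((c.2 : ℕ) * l i * Λ)) - ∑ p ∈ Finset.range (K * L'), t i ^ p * W c p)
    (fun i c => ((x i).choose c.1 : ℝ) * Real.exp ((c.2 : ℕ) * ε * x i) * Real.exp (-((c.2 : ℕ) * l i * Λ)))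
    (2 * C) R⁻¹ (by positivity) hRi (by positivity) ?_ ?_ ?_ ?_
  · rw [hcard] at key
    exact key
  · intro i p
    rw [abs_pow]
    exact pow_le_one₀ (abs_nonneg _) (htabs i)
  · intro p c
    refine (hW1 c p).trans ?_
    have : 0 ≤ C * R⁻¹ ^ p := by positivity
    nlinarith
  · intro i c
    rw [hcard]
    have h1 := hW2 c (t i) (htabs i) (K * L')
    have h2 := hW2 c (t i) (htabs i) 0
    simp only [Finset.range_zero, Finset.sum_empty, sub_zero, pow_zero, mul_one] at h2
    rw [← hfv]
    change |f c (t i)| ≤ C at h2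
    change |f c (t i) - _| ≤ _ at h1
    set y := -(((c.2 : ℕ) : ℝ) * l i * Λ) with hy
    have hyabs : 2 * |y| ≤ R⁻¹ ^ (K * L') := by
      refine le_trans ?_ hΛ
      rw [hy, abs_neg, abs_mul, abs_of_nonneg (by positivity)]
      have h1 : ((c.2 : ℕ) : ℝ) ≤ L' := by exact_mod_cast c.2.2.le
      have h2 : (l i : ℝ) ≤ L := by exact_mod_cast hl i
      have h3 : ((c.2 : ℕ) : ℝ) * l i ≤ L' * L := by gcongr
      nlinarith [mul_le_mul_of_nonneg_right h3 (abs_nonneg Λ)]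
    have hR2 : R⁻¹ ^ (K * L') ≤ 1 := pow_le_one₀ (by positivity) hRi
    have hexp : |Real.exp y - 1| ≤ 2 * |y| := Real.abs_exp_sub_one_le (by linarith [abs_nonneg y])
    have : f c (t i) * Real.exp y - ∑ p ∈ Finset.range (K * L'), t i ^ p * W c p =
      (f c (t i) - ∑ p ∈ Finset.range (K * L'), t i ^ p * W c p) + f c (t i) * (Real.exp y - 1) := by ring
    rw [this]
    refine (abs_add_le _ _).trans ?_
    rw [abs_mul]
    have : |f c (t i)| * |Real.exp y - 1| ≤ C * R⁻¹ ^ (K * L') := by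
      apply mul_le_mul h2 (hexp.trans hyabs) (abs_nonneg _) hC0.le
    linarith
  · intro i c
    rw [hcard]; ring

lemma choose_le_exp (K X x k : ℕ) (hK : 0 < K) (hKX : K ≤ X) (hx : x ≤ X) (hk : k ≤ K) :
    ((x.choose k : ℕ) : ℝ) ≤ Real.exp (K * (1 + Real.log (2 * 1 * (X : ℝ) / K))) := by
  refine le_trans ?_ (prod_choose_bound (R := 1) le_rfl (X := X) (by exact_mod_cast lt_of_lt_of_le hK hKX) K hK (by exact_mod_cast hKX) k hk)
  have h1 : ((x.choose k : ℕ) : ℝ) ≤ (X.choose k : ℕ) := by exact_mod_cast Nat.choose_le_choose k hx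
  refine h1.trans ?_
  rcases le_or_gt k X with h | h
  · rw [choose_prod_cast]
    apply Finset.prod_le_prod
    · intro i hi
      have : (i : ℝ) ≤ X := by exact_mod_cast (Finset.mem_range.1 hi).le.trans h
      apply div_nonneg (by linarith) (by positivity)
    · intro i hi
      have : (0:ℝ) ≤ i := by positivity
      gcongr
      linarith
  · rw [Nat.choose_eq_zero_of_lt h]
    simp only [Nat.cast_zero]
    apply Finset.prod_nonneg
    intro i hi
    positivity

end PartP5

section PartP6
theorem core {F : Type*} [Field F] [NumberField F] (hd : Module.finrank ℚ F ≤ 6) (σ₀ : F →+* ℂ)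
    (η u w : F) (hηi : IsIntegral ℤ η) (hui : IsIntegral ℤ u) (hwi : IsIntegral ℤ w)
    (ε ur wr Λ a b : ℝ) (hη0 : σ₀ η = ((Real.exp ε : ℝ) : ℂ)) (hu0 : σ₀ u = (ur : ℂ)) (hw0 : σ₀ w = (wr : ℂ))
    (hε : 0 < ε) (hur : 0 < ur) (hwr : 0 < wr) (N L' g r : ℕ)
    (hrel : ur * Real.exp (ε * r) = wr * Real.exp Λ)
    (ha : 0 ≤ a) (hb : 0 ≤ b)
    (hηH : ∀ σ : F →+* ℂ, ‖σ η‖ ≤ Real.exp a) (huH : ∀ σ : F →+* ℂ, ‖σ u‖ ≤ Real.exp b)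
    (hwH : ∀ σ : F →+* ℂ, ‖σ w‖ ≤ Real.exp b)
    (hN : 0 < N) (hL' : 0 < L') (hg : 0 < g) (hr : N + L' ≤ r)
    (hΛ : 2 * ((g * L' : ℕ) * L') * |Λ| ≤ (Real.exp 3)⁻¹ ^ (g * N * L')) :
    3 * ((g * N * L' : ℕ) - 1 : ℝ) / 2 ≤ 7 * Real.log ((g * N * L' : ℕ) + 1) + Real.log 2
      + 6 * ((g * N : ℕ) * (1 + Real.log (2 * Real.exp 3 * ((r * (g * L') : ℕ) : ℝ) / (g * N : ℕ))))
      + L' * ((r * (g * L') : ℕ) : ℝ) * ε * Real.exp 3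
      + 5 * ((N + L' : ℕ) * L' * a) + 6 * ((g * L' : ℕ) * L' * b) := by
  classical
  set K := g * N with hK
  set L := g * L' with hL
  set T := K * L' with hT
  have hK0 : 0 < K := Nat.mul_pos hg hN
  have hL0 : 0 < L := Nat.mul_pos hg hL'
  have hT0 : 0 < T := Nat.mul_pos hK0 hL'
  have hKX : K ≤ r * L := by
    have : K ≤ g * r := Nat.mul_le_mul_left g (by omega)
    calc K ≤ g * r := this
      _ ≤ (g * r) * L' := Nat.le_mul_of_pos_right _ hL'
      _ = r * L := by rw [hL]; ring
  have hune : u ≠ 0 := by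
    rintro rfl
    simp only [map_zero] at hu0
    exact hur.ne (by exact_mod_cast hu0)
  have hwne : w ≠ 0 := by
    rintro rfl
    simp only [map_zero] at hw0
    exact hwr.ne (by exact_mod_cast hw0)
  have hηne : η ≠ 0 := by
    rintro rfl
    simp only [map_zero] at hη0
    exact (Real.exp_pos ε).ne (by exact_mod_cast hη0)
  have hinj : ∀ a b : ℕ, η ^ a = η ^ b → a = b := by
    intro a b hab
    have h1 := congrArg σ₀ hab
    rw [map_pow, map_pow, hη0] at h1
    have h2 : Real.exp ε ^ a = Real.exp ε ^ b := by exact_mod_cast h1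
    exact pow_right_injective₀ (Real.exp_pos ε) (by simp [hε.ne']) h2
  -- the matrix
  let A : Matrix (Fin (N + L') × Fin L) (Fin K × Fin L') F := Matrix.of fun i c =>
    (((i.1 : ℕ) + r * i.2).choose c.1 : F) * η ^ ((i.1 : ℕ) * c.2) * w ^ ((i.2 : ℕ) * c.2) * u ^ ((i.2 : ℕ) * (L' - 1 - c.2))
  have hA : ∀ i c, A i c = u ^ ((i.2 : ℕ) * (L' - 1)) * ((((i.1 : ℕ) + r * i.2).choose c.1 : F) * (η ^ (i.1 : ℕ) * (w / u) ^ (i.2 : ℕ)) ^ (c.2 : ℕ)) := by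
    intro i c
    have hc : (c.2 : ℕ) ≤ L' - 1 := by omega
    have : u ^ ((i.2 : ℕ) * (L' - 1)) = u ^ ((i.2 : ℕ) * c.2) * u ^ ((i.2 : ℕ) * (L' - 1 - c.2)) := by
      rw [← pow_add, ← Nat.mul_add]; congr 2; omega
    rw [this]
    simp only [A, Matrix.of_apply, mul_pow, div_pow, ← pow_mul]
    field_simp
  obtain ⟨f, hf⟩ := exists_rows A (by
    intro p hp
    refine zero_estimate η (w / u) hηne (div_ne_zero hwne hune) hinj K L' N L r hK0 (by rw [hK, hL]; apply le_of_eq; ring) (by omega) p ?_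
    intro j hj l hl
    have h1 := congrFun hp (⟨j, hj⟩, ⟨l, hl⟩)
    rw [Matrix.mulVec, dotProduct, Pi.zero_apply] at h1
    simp only [hA, mul_assoc] at h1
    rw [← Finset.mul_sum] at h1
    have h2 := (mul_eq_zero.1 h1).resolve_left (pow_ne_zero _ hune)
    simpa only [mul_assoc] using h2)
  set D := (A.submatrix f id).det with hD
  have hcard : Fintype.card (Fin K × Fin L') = T := by simp [hT]
  -- integrality
  have hDi : IsIntegral ℤ D := by
    rw [hD]
    apply IsIntegral.det
    intro i c
    simp only [Matrix.submatrix_apply, id, A, Matrix.of_apply]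
    refine ((IsIntegral.mul (IsIntegral.mul ?_ (hηi.pow _)) (hwi.pow _)).mul (hui.pow _))
    have := isIntegral_algebraMap (R := ℤ) (A := F) (x := (((f i).1 + r * (f i).2 : ℕ).choose c.1 : ℤ))
    simpa using this
  have hxle : ∀ i, ((f i).1 : ℕ) + r * (f i).2 ≤ r * L := by
    intro i
    have h1 := (f i).1.2
    have h2 := (f i).2.2
    calc ((f i).1 : ℕ) + r * (f i).2 ≤ r + r * (f i).2 := by omega
      _ = r * ((f i).2 + 1) := by ring
      _ ≤ r * L := Nat.mul_le_mul_left r h2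
  -- conjugates
  set BC := (K : ℝ) * (1 + Real.log (2 * Real.exp 3 * ((r * L : ℕ) : ℝ) / K)) with hBC
  have hXK : (1 : ℝ) ≤ ((r * L : ℕ) : ℝ) / K := by
    rw [le_div_iff₀ (by exact_mod_cast hK0), one_mul]; exact_mod_cast hKX
  have he3 : (1 : ℝ) ≤ Real.exp 3 := Real.one_le_exp (by norm_num)
  have hBC1 : (K : ℝ) * (1 + Real.log (2 * 1 * ((r * L : ℕ) : ℝ) / K)) ≤ BC := by
    rw [hBC]
    have hlog : Real.log (2 * 1 * ((r * L : ℕ) : ℝ) / K) ≤ Real.log (2 * Real.exp 3 * ((r * L : ℕ) : ℝ) / K) := by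
      apply Real.log_le_log
      · rw [mul_div_assoc]; positivity
      · gcongr
    gcongr
  have hBC0 : 0 ≤ BC := by
    rw [hBC]
    have : 0 ≤ Real.log (2 * Real.exp 3 * ((r * L : ℕ) : ℝ) / K) := by
      apply Real.log_nonneg
      rw [mul_div_assoc]; nlinarith
    positivity
  set B := BC + (N + L' : ℕ) * L' * a + L * L' * b with hB
  have hB0 : 0 ≤ B := by positivity
  have hconj : ∀ σ : F →+* ℂ, ‖σ D‖ ≤ T.factorial * Real.exp B ^ T := by
    intro σ
    rw [hD, RingHom.map_det, ← hcard]
    apply det_norm_le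
    intro i c
    simp only [RingHom.mapMatrix_apply, Matrix.map_apply, Matrix.submatrix_apply, id, A, Matrix.of_apply, map_mul, map_pow, map_natCast, norm_mul, norm_pow]
    rw [hB, Real.exp_add, Real.exp_add]
    have h1 : ‖((((f i).1 : ℕ) + r * (f i).2 : ℕ).choose c.1 : ℂ)‖ ≤ Real.exp BC := by
      rw [Complex.norm_natCast]
      exact (choose_le_exp K (r * L) _ c.1 hK0 hKX (hxle i) c.1.2.le).trans (Real.exp_le_exp.2 hBC1)
    have h2 : ‖σ η‖ ^ (((f i).1 : ℕ) * c.2) ≤ Real.exp ((N + L' : ℕ) * L' * a) := by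
      calc ‖σ η‖ ^ (((f i).1 : ℕ) * c.2) ≤ Real.exp a ^ (((f i).1 : ℕ) * c.2) := pow_le_pow_left₀ (norm_nonneg _) (hηH σ) _
        _ ≤ Real.exp a ^ ((N + L') * L') := by
            apply pow_le_pow_right₀ (Real.one_le_exp ha)
            exact Nat.mul_le_mul (f i).1.2.le c.2.2.le
        _ = _ := by rw [← Real.exp_nat_mul]; push_cast; ring_nf
    have h3 : ‖σ w‖ ^ (((f i).2 : ℕ) * c.2) * ‖σ u‖ ^ (((f i).2 : ℕ) * (L' - 1 - c.2)) ≤ Real.exp (L * L' * b) := by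
      calc ‖σ w‖ ^ (((f i).2 : ℕ) * c.2) * ‖σ u‖ ^ (((f i).2 : ℕ) * (L' - 1 - c.2)) 
          ≤ Real.exp b ^ (((f i).2 : ℕ) * c.2) * Real.exp b ^ (((f i).2 : ℕ) * (L' - 1 - c.2)) := by
            gcongr
            · exact hwH σ
            · exact huH σ
        _ = Real.exp b ^ (((f i).2 : ℕ) * (L' - 1)) := by
            rw [← pow_add, ← Nat.mul_add]
            congr 2
            have := c.2.2
            omega
        _ ≤ Real.exp b ^ (L * L') := by
            apply pow_le_pow_right₀ (Real.one_le_exp hb)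
            exact Nat.mul_le_mul (f i).2.2.le (by omega)
        _ = _ := by rw [← Real.exp_nat_mul]; push_cast; ring_nf
    rw [mul_assoc]
    gcongr
  have hH1 : 1 ≤ (T.factorial : ℝ) * Real.exp B ^ T := by
    have h1 : (1 : ℝ) ≤ T.factorial := by exact_mod_cast Nat.factorial_pos T
    have h2 : 1 ≤ Real.exp B ^ T := one_le_pow₀ (Real.one_le_exp hB0)
    nlinarith
  have hliou := liouville hd σ₀ D hDi hf _ hH1 hconj
  -- real place
  set xx : Fin K × Fin L' → ℕ := fun i => ((f i).1 : ℕ) + r * (f i).2 with hxx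
  set ll : Fin K × Fin L' → ℕ := fun i => ((f i).2 : ℕ) with hll
  have hup := core_upper K L' L r xx ll ε Λ hε.le hK0 hKX hxle (fun i => (f i).2.2.le) hΛ
  set M := (Matrix.of (fun i c : Fin K × Fin L' => ((xx i).choose c.1 : ℝ) * Real.exp ((c.2 : ℕ) * ε * xx i)
        * Real.exp (-((c.2 : ℕ) * ll i * Λ)))) with hM
  have hwr' : wr / ur = Real.exp (ε * r - Λ) := by
    rw [div_eq_iff hur.ne', Real.exp_sub, div_mul_eq_mul_div, eq_div_iff (Real.exp_pos _).ne']
    linarith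
  have hDreal : σ₀ D = (((∏ i, ur ^ (ll i * (L' - 1))) * M.det : ℝ) : ℂ) := by
    rw [hD, RingHom.map_det, ← Matrix.det_mul_column, ← Complex.ofRealHom_eq_coe, RingHom.map_det]
    congr 1
    ext i c
    simp only [RingHom.mapMatrix_apply, Matrix.map_apply, Matrix.submatrix_apply, id, Matrix.of_apply, hA, map_mul, map_pow, map_natCast, map_div₀, hη0, hu0, hw0, Complex.ofRealHom_eq_coe, hM]
    rw [← Complex.ofReal_div, hwr']
    norm_cast
    rw [← Real.exp_nat_mul, ← Real.exp_nat_mul, ← Real.exp_add, ← Real.exp_nat_mul, mul_assoc (((xx i).choose c.1 : ℕ) : ℝ), ← Real.exp_add]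
    congr 3
    simp only [hxx, hll]
    push_cast
    ring
  have hurH : ur ≤ Real.exp b := by
    have := huH σ₀
    rw [hu0, Complex.norm_real, Real.norm_eq_abs] at this
    exact (le_abs_self _).trans this
  have hprod : ∏ i, ur ^ (ll i * (L' - 1)) ≤ Real.exp (L * L' * b) ^ T := by
    calc ∏ i, ur ^ (ll i * (L' - 1)) ≤ ∏ i : Fin K × Fin L', Real.exp (L * L' * b) := by
          apply Finset.prod_le_prod
          · intro i _; positivity
          · intro i _
            calc ur ^ (ll i * (L' - 1)) ≤ Real.exp b ^ (ll i * (L' - 1)) := pow_le_pow_left₀ hur.le hurH _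
              _ ≤ Real.exp b ^ (L * L') := by
                apply pow_le_pow_right₀ (Real.one_le_exp hb)
                exact Nat.mul_le_mul (f i).2.2.le (by omega)
              _ = _ := by rw [← Real.exp_nat_mul]; push_cast; ring_nf
      _ = _ := by rw [Finset.prod_const, Finset.card_univ, hcard]
  have hprod0 : 0 ≤ ∏ i, ur ^ (ll i * (L' - 1)) := Finset.prod_nonneg (fun i _ => by positivity)
  rw [hDreal, Complex.norm_real, Real.norm_eq_abs, abs_mul, abs_of_nonneg hprod0] at hliou
  have hfac : (T.factorial : ℝ) ≤ ((T : ℝ) + 1) ^ T := by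
    calc (T.factorial : ℝ) ≤ (T : ℝ) ^ T := by exact_mod_cast Nat.factorial_le_pow T
      _ ≤ _ := by gcongr; linarith
  set C := Real.exp (BC + L' * ((r * L : ℕ) : ℝ) * ε * Real.exp 3) with hC
  have hT1 : (0 : ℝ) < (T : ℝ) + 1 := by positivity
  have hfin : 1 ≤ (Real.exp (L * L' * b) ^ T * (((T : ℝ) + 1) ^ T * (((T : ℝ) + 1) ^ T * ((2 * C) ^ T
        * (Real.exp 3)⁻¹ ^ (∑ i ∈ Finset.range T, i))))) * (((T : ℝ) + 1) ^ T * Real.exp B ^ T) ^ 5 := by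
    refine hliou.trans ?_
    have hup' : |M.det| ≤ (((T : ℝ) + 1) ^ T * (((T : ℝ) + 1) ^ T * ((2 * C) ^ T
        * (Real.exp 3)⁻¹ ^ (∑ i ∈ Finset.range T, i)))) := by
      refine hup.trans ?_
      rw [← hT]
      gcongr
    gcongr
  have hlog := Real.log_le_log one_pos hfin
  rw [Real.log_one] at hlog
  have hC0 : C ≠ 0 := (Real.exp_pos _).ne'
  have he0 : ((Real.exp 3)⁻¹ : ℝ) ≠ 0 := inv_ne_zero (Real.exp_pos _).ne'
  have hE : ∀ y, Real.exp y ≠ 0 := fun y => (Real.exp_pos y).ne'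
  rw [Real.log_mul (by positivity) (by positivity), Real.log_mul (by positivity) (by positivity),
    Real.log_mul (by positivity) (by positivity), Real.log_mul (by positivity) (by positivity),
    Real.log_mul (by positivity) (by positivity), Real.log_pow, Real.log_pow, Real.log_pow, Real.log_pow, Real.log_pow,
    Real.log_mul (by positivity) (by positivity), Real.log_mul (by positivity) (by positivity), Real.log_pow, Real.log_pow, Real.log_inv, Real.log_exp, Real.log_exp, Real.log_exp, Real.log_exp] at hlog
  have hsum : ((∑ i ∈ Finset.range T, i : ℕ) : ℝ) = T * (T - 1) / 2 := by
    have h1 := Finset.sum_range_id_mul_two T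
    have h2 : (((∑ i ∈ Finset.range T, i) * 2 : ℕ) : ℝ) = ((T * (T - 1) : ℕ) : ℝ) := by rw [h1]
    push_cast [Nat.cast_sub hT0] at h2
    push_cast
    linarith
  rw [hsum] at hlog
  have hTr : (0 : ℝ) < T := by exact_mod_cast hT0
  have hlog2 : 0 ≤ (T : ℝ) * ((L * L' * b) + 7 * Real.log (T + 1) + Real.log 2 + (BC + L' * ((r * L : ℕ) : ℝ) * ε * Real.exp 3) - 3 * (T - 1) / 2 + 5 * B) := by
    push_cast at hlog ⊢
    linarith
  have hlog3 := nonneg_of_mul_nonneg_right hlog2 hTr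
  rw [hB] at hlog3
  push_cast at hlog3 ⊢
  linarith

end PartP6

section PartP7
open Real IntermediateField

lemma rho_exists : ∃ x : ℝ, 1 < x ∧ x ^ 3 = x + 1 := by
  have h : (0 : ℝ) ∈ Set.Icc ((fun x : ℝ => x ^ 3 - x - 1) 1) ((fun x : ℝ => x ^ 3 - x - 1) 2) := by
    constructor <;> norm_num
  obtain ⟨x, hx, hx0⟩ := intermediate_value_Icc (by norm_num : (1 : ℝ) ≤ 2) (by fun_prop : ContinuousOn (fun x : ℝ => x ^ 3 - x - 1) (Set.Icc 1 2)) h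
  simp only at hx0
  refine ⟨x, ?_, by linarith⟩
  rcases hx.1.lt_or_eq with h | h
  · exact h
  · rw [← h] at hx0; norm_num at hx0

noncomputable def rho : ℝ := Classical.choose rho_exists
lemma one_lt_rho : 1 < rho := (Classical.choose_spec rho_exists).1
lemma rho_cube : rho ^ 3 = rho + 1 := (Classical.choose_spec rho_exists).2
lemma rho_pos : 0 < rho := by linarith [one_lt_rho]

lemma lt_rho_of {a : ℝ} (h0 : 0 ≤ a) (h : a ^ 3 < a + 1) : a < rho := by
  by_contra hc
  push Not at hc
  have h1 := rho_cube
  have h2 := one_lt_rho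
  nlinarith [mul_nonneg (sub_nonneg.2 hc) h0, mul_nonneg (mul_nonneg (sub_nonneg.2 hc) h0) h0,
    mul_nonneg (sub_nonneg.2 hc) (by nlinarith : 0 ≤ a ^ 2 + a * rho + rho ^ 2 - 1)]

lemma rho_lt_of {a : ℝ} (h0 : 1 ≤ a) (h : a + 1 < a ^ 3) : rho < a := by
  by_contra hc
  push Not at hc
  have h1 := rho_cube
  have h2 := one_lt_rho
  nlinarith [mul_nonneg (sub_nonneg.2 hc) (by nlinarith : 0 ≤ a ^ 2 + a * rho + rho ^ 2 - 1)]

lemma rho_gt : 1.3247 < rho := lt_rho_of (by norm_num) (by norm_num)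
lemma rho_lt : rho < 1.3248 := rho_lt_of (by norm_num) (by norm_num)
lemma rho_inv : rho⁻¹ = rho ^ 2 - 1 := by
  have := rho_cube
  rw [inv_eq_of_mul_eq_one_right]
  nlinarith

lemma norm_conj_rho (z : ℂ) (hz : z ^ 3 = z + 1) : ‖z‖ ≤ rho ∧ ‖z⁻¹‖ ≤ rho := by
  have hr := rho_cube
  have h1 := rho_gt
  have h2 := rho_lt
  have hrc : (rho : ℂ) ^ 3 = rho + 1 := by exact_mod_cast hr
  have hfac : (z - rho) * (z ^ 2 + rho * z + (rho ^ 2 - 1)) = 0 := by linear_combination hz - hrc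
  have hrinv := rho_inv
  have hi1 : rho⁻¹ ≤ rho := by rw [hrinv]; nlinarith
  rcases mul_eq_zero.1 hfac with h | h
  · have : z = rho := by linear_combination h
    rw [this, ← Complex.ofReal_inv, Complex.norm_real, Complex.norm_real, norm_of_nonneg rho_pos.le,
      norm_of_nonneg (inv_nonneg.2 rho_pos.le)]
    exact ⟨le_rfl, hi1⟩
  · have hre := congrArg Complex.re h
    have him := congrArg Complex.im h
    simp [pow_two] at hre him
    have hns : ‖z‖ ^ 2 = rho ^ 2 - 1 := by
      rw [Complex.sq_norm, Complex.normSq_apply]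
      have h3 : z.im * (2 * z.re + rho) = 0 := by linarith
      rcases mul_eq_zero.1 h3 with h4 | h4
      · rw [h4] at hre
        exfalso
        nlinarith [sq_nonneg (2 * z.re + rho)]
      · nlinarith
    have hpos : 0 < ‖z‖ := by
      by_contra hc
      have : ‖z‖ = 0 := le_antisymm (not_lt.1 hc) (norm_nonneg _)
      rw [this] at hns
      nlinarith
    constructor
    · apply abs_le_of_sq_le_sq' _ rho_pos.le |>.2
      rw [hns]; linarith
    · rw [norm_inv]
      rw [inv_le_iff_one_le_mul₀ hpos]
      by_contra hc
      push Not at hc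
      have : (‖z‖ * rho) ^ 2 < 1 := by
        have : 0 ≤ ‖z‖ * rho := by positivity
        nlinarith
      rw [mul_pow, hns] at this
      nlinarith

lemma norm_conj_phi (z : ℂ) (hz : z ^ 2 = z + 1) : ‖z‖ ≤ goldenRatio ∧ ‖z⁻¹‖ ≤ goldenRatio := by
  have hg := goldenRatio_sq
  have h1 := one_lt_goldenRatio
  have hgc : (goldenRatio : ℂ) ^ 2 = goldenRatio + 1 := by exact_mod_cast hg
  have hfac : (z - goldenRatio) * (z + goldenRatio - 1) = 0 := by linear_combination hz - hgc
  have hginv : goldenRatio⁻¹ = goldenRatio - 1 := by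
    rw [inv_eq_of_mul_eq_one_right]; nlinarith
  have hi1 : goldenRatio⁻¹ ≤ goldenRatio := by rw [hginv]; linarith
  have h0 : 0 < goldenRatio := goldenRatio_pos
  rcases mul_eq_zero.1 hfac with h | h
  · have : z = goldenRatio := by linear_combination h
    rw [this, ← Complex.ofReal_inv, Complex.norm_real, Complex.norm_real, norm_of_nonneg h0.le,
      norm_of_nonneg (inv_nonneg.2 h0.le)]
    exact ⟨le_rfl, hi1⟩
  · have : z = ((-(goldenRatio⁻¹) : ℝ) : ℂ) := by rw [hginv, Complex.ofReal_neg, Complex.ofReal_sub, Complex.ofReal_one]; linear_combination h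
    rw [this, ← Complex.ofReal_inv, Complex.norm_real, Complex.norm_real, norm_neg, norm_of_nonneg (inv_nonneg.2 h0.le), inv_neg, inv_inv, norm_neg, norm_of_nonneg h0.le]
    exact ⟨hi1, le_rfl⟩

/-- The biquadratic-cubic field generated by `rho` and the golden ratio. -/
noncomputable def KK : IntermediateField ℚ ℂ := ℚ⟮(rho : ℂ)⟯ ⊔ ℚ⟮(goldenRatio : ℂ)⟯

lemma rhoC : (rho : ℂ) ^ 3 = rho + 1 := by exact_mod_cast rho_cube
lemma phiC : (goldenRatio : ℂ) ^ 2 = goldenRatio + 1 := by exact_mod_cast goldenRatio_sq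

lemma int_rhoC {F : Type*} [Field F] (x : F) (hx : x ^ 3 = x + 1) : IsIntegral ℤ x := by
  refine ⟨Polynomial.X ^ 3 - Polynomial.X - 1, ?_, ?_⟩
  · monicity!
  · simp [hx]
lemma int_phiC {F : Type*} [Field F] (x : F) (hx : x ^ 2 = x + 1) : IsIntegral ℤ x := by
  refine ⟨Polynomial.X ^ 2 - Polynomial.X - 1, ?_, ?_⟩
  · monicity!
  · simp [hx]

instance : FiniteDimensional ℚ KK := by
  have h1 : FiniteDimensional ℚ ℚ⟮(rho : ℂ)⟯ :=
    IntermediateField.adjoin.finiteDimensional (int_rhoC _ rhoC).tower_top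
  have h2 : FiniteDimensional ℚ ℚ⟮(goldenRatio : ℂ)⟯ :=
    IntermediateField.adjoin.finiteDimensional (int_phiC _ phiC).tower_top
  unfold KK
  infer_instance

instance : NumberField KK := { to_charZero := inferInstance, to_finiteDimensional := inferInstance }

lemma finrank_KK : Module.finrank ℚ KK ≤ 6 := by
  have i1 : IsIntegral ℚ (rho : ℂ) := (int_rhoC _ rhoC).tower_top
  have i2 : IsIntegral ℚ (goldenRatio : ℂ) := (int_phiC _ phiC).tower_top
  have h1 : Module.finrank ℚ ℚ⟮(rho : ℂ)⟯ ≤ 3 := by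
    rw [IntermediateField.adjoin.finrank i1]
    have hd : minpoly ℚ (rho : ℂ) ∣ (Polynomial.X ^ 3 - Polynomial.X - 1) := by
      apply minpoly.dvd; simp [rhoC]
    have hm : (Polynomial.X ^ 3 - Polynomial.X - 1 : Polynomial ℚ).natDegree = 3 := by compute_degree!
    rw [← hm]
    apply Polynomial.natDegree_le_of_dvd hd
    intro h0; rw [h0] at hm; simp at hm
  have h2 : Module.finrank ℚ ℚ⟮(goldenRatio : ℂ)⟯ ≤ 2 := by
    rw [IntermediateField.adjoin.finrank i2]
    have hd : minpoly ℚ (goldenRatio : ℂ) ∣ (Polynomial.X ^ 2 - Polynomial.X - 1) := by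
      apply minpoly.dvd; simp only [map_sub, map_pow, Polynomial.aeval_X, map_one, phiC]; ring
    have hm : (Polynomial.X ^ 2 - Polynomial.X - 1 : Polynomial ℚ).natDegree = 2 := by compute_degree!
    rw [← hm]
    apply Polynomial.natDegree_le_of_dvd hd
    intro h0; rw [h0] at hm; simp at hm
  have h3 := IntermediateField.finrank_sup_le ℚ⟮(rho : ℂ)⟯ ℚ⟮(goldenRatio : ℂ)⟯
  calc Module.finrank ℚ KK ≤ _ := h3
    _ ≤ 3 * 2 := Nat.mul_le_mul h1 h2

noncomputable def rK : KK := ⟨(rho : ℂ), by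
  apply (le_sup_left : ℚ⟮(rho : ℂ)⟯ ≤ _); exact IntermediateField.mem_adjoin_simple_self ℚ _⟩
noncomputable def pK : KK := ⟨(goldenRatio : ℂ), by
  apply (le_sup_right : ℚ⟮(goldenRatio : ℂ)⟯ ≤ _); exact IntermediateField.mem_adjoin_simple_self ℚ _⟩

lemma rK_cube : rK ^ 3 = rK + 1 := Subtype.ext rhoC
lemma pK_sq : pK ^ 2 = pK + 1 := Subtype.ext phiC

noncomputable def sig0 : KK →+* ℂ := KK.val.toRingHom
lemma sig0_r : sig0 rK = (rho : ℂ) := rfl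
lemma sig0_p : sig0 pK = (goldenRatio : ℂ) := rfl

lemma rK_ne : rK ≠ 0 := by
  intro h; have := rK_cube; rw [h] at this; norm_num at this
lemma pK_ne : pK ≠ 0 := by
  intro h; have := pK_sq; rw [h] at this; norm_num at this

lemma rK_inv : rK⁻¹ = rK ^ 2 - 1 := by
  rw [inv_eq_of_mul_eq_one_right]; linear_combination rK_cube
lemma pK_inv : pK⁻¹ = pK - 1 := by
  rw [inv_eq_of_mul_eq_one_right]; linear_combination pK_sq

lemma int_one {F : Type*} [Field F] : IsIntegral ℤ (1 : F) := isIntegral_one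
lemma int_rK : IsIntegral ℤ rK := int_rhoC _ rK_cube
lemma int_pK : IsIntegral ℤ pK := int_phiC _ pK_sq
lemma int_rK_inv : IsIntegral ℤ rK⁻¹ := by rw [rK_inv]; exact (int_rK.pow 2).sub isIntegral_one
lemma int_pK_inv : IsIntegral ℤ pK⁻¹ := by rw [pK_inv]; exact int_pK.sub isIntegral_one

lemma int_pK_zpow (t : ℤ) : IsIntegral ℤ (pK ^ t) := by
  obtain ⟨n, rfl | rfl⟩ := t.eq_nat_or_neg
  · rw [zpow_natCast]; exact int_pK.pow n
  · rw [zpow_neg, zpow_natCast, ← inv_pow]; exact int_pK_inv.pow n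

lemma sig_r (σ : KK →+* ℂ) : ‖σ rK‖ ≤ rho ∧ ‖(σ rK)⁻¹‖ ≤ rho :=
  norm_conj_rho _ (by rw [← map_pow, rK_cube, map_add, map_one])
lemma sig_p (σ : KK →+* ℂ) : ‖σ pK‖ ≤ goldenRatio ∧ ‖(σ pK)⁻¹‖ ≤ goldenRatio :=
  norm_conj_phi _ (by rw [← map_pow, pK_sq, map_add, map_one])

lemma sig_r_pow (σ : KK →+* ℂ) (s : ℕ) : ‖σ (rK ^ s)‖ ≤ exp (s * log rho) := by
  rw [map_pow, norm_pow, exp_nat_mul, exp_log rho_pos]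
  exact pow_le_pow_left₀ (norm_nonneg _) (sig_r σ).1 _

lemma sig_p_zpow (σ : KK →+* ℂ) (t : ℤ) : ‖σ (pK ^ t)‖ ≤ exp (|(t : ℝ)| * log goldenRatio) := by
  obtain ⟨n, rfl | rfl⟩ := t.eq_nat_or_neg
  · rw [zpow_natCast, map_pow, norm_pow]
    simp only [Int.cast_natCast, Nat.abs_cast]
    rw [exp_nat_mul, exp_log goldenRatio_pos]
    exact pow_le_pow_left₀ (norm_nonneg _) (sig_p σ).1 _
  · rw [zpow_neg, zpow_natCast, ← inv_pow, map_pow, norm_pow, map_inv₀]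
    simp only [Int.cast_neg, Int.cast_natCast, abs_neg, Nat.abs_cast]
    rw [exp_nat_mul, exp_log goldenRatio_pos]
    exact pow_le_pow_left₀ (norm_nonneg _) (sig_p σ).2 _

end PartP7

section PartP8
open Real

/-- arithmetic part of the stage lemma -/
lemma stage_arith (g N L' r : ℕ) (ε Q a b : ℝ) (hg : 0 < g) (hN : 0 < N) (hL0 : 0 < L')
    (hε : 0 < ε) (hε1 : ε ≤ 1) (hr : 0 < r) (hL : 15 * (1.02 + log (1 / ε)) ≤ L')
    (hgQ : 34 * Q ≤ g) (hrε : 1 ≤ r * ε) (hN1 : 40 * (L' * (r * ε)) ≤ N)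
    (ha : a ≤ 2 * Q) (hb : b ≤ 1.33 * (r * ε))
    (h : 3 * ((g * N * L' : ℕ) - 1 : ℝ) / 2 ≤ 7 * Real.log ((g * N * L' : ℕ) + 1) + Real.log 2
      + 6 * ((g * N : ℕ) * (1 + Real.log (2 * Real.exp 3 * ((r * (g * L') : ℕ) : ℝ) / (g * N : ℕ))))
      + L' * ((r * (g * L') : ℕ) : ℝ) * ε * Real.exp 3
      + 5 * ((N + L' : ℕ) * L' * a) + 6 * ((g * L' : ℕ) * L' * b)) : False := by
  have hgr : (0 : ℝ) < g := by exact_mod_cast hg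
  have hg1 : (1 : ℝ) ≤ g := by exact_mod_cast hg
  have hNr : (0 : ℝ) < N := by exact_mod_cast hN
  have hLr : (0 : ℝ) < L' := by exact_mod_cast hL0
  have hrr : (0 : ℝ) < r := by exact_mod_cast hr
  have hlogε : 0 ≤ log (1 / ε) := log_nonneg (by rw [le_div_iff₀ hε]; linarith)
  have hL15 : (15 : ℝ) ≤ L' := by linarith
  set T : ℝ := g * N * L' with hT
  have he3 : exp 3 ≤ 20.0857 := by
    have h1 := exp_one_lt_d9
    have h2 : exp 3 = exp 1 ^ 3 := by rw [← exp_nat_mul]; norm_num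
    rw [h2]
    calc exp 1 ^ 3 ≤ 2.7182818286 ^ 3 := pow_le_pow_left₀ (exp_pos _).le h1.le 3
      _ ≤ _ := by norm_num
  have hX : ((r * (g * L') : ℕ) : ℝ) = r * (g * L') := by push_cast; ring
  have hTc : ((g * N * L' : ℕ) : ℝ) = T := by push_cast; ring
  rw [hTc, hX] at h
  push_cast at h
  -- lower bound on T
  have hLre : (L' : ℝ) ≤ L' * (r * ε) := by nlinarith
  have hNbig : 40 * (L' : ℝ) ≤ N := by linarith
  have hT9 : 9000 ≤ T := by
    have h1 : (600 : ℝ) ≤ N := by linarith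
    have h2 : (600 : ℝ) * 15 ≤ N * L' := mul_le_mul h1 hL15 (by norm_num) hNr.le
    have h3 : 1 * (N * L' : ℝ) ≤ g * (N * L') := by gcongr
    rw [hT, mul_assoc]
    linarith
  -- log term
  have t1 : log (T + 1) ≤ T / 1000 + 7 := by
    have h1 : log (T + 1) = log ((T + 1) / 1000) + log 1000 := by
      rw [← log_mul (by positivity) (by norm_num)]; congr 1; field_simp
    have h2 := log_le_sub_one_of_pos (show 0 < (T + 1) / 1000 by positivity)
    have h3 : log 1000 ≤ 7 := by
      rw [show (1000 : ℝ) = 10 ^ 3 by norm_num, log_pow]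
      have : log 10 ≤ 7 / 3 := by
        rw [log_le_iff_le_exp (by norm_num)]
        have h5 : exp (7 / 3) = exp (1 / 3) * exp 1 ^ 2 := by
          rw [← exp_nat_mul, ← exp_add]; norm_num
        have h6 := exp_one_gt_d9
        have h7 : (1 : ℝ) / 3 + (1/3)^2/2 + 1 ≤ exp (1 / 3) := by
          have := quadratic_le_exp_of_nonneg (show (0 : ℝ) ≤ 1 / 3 by norm_num)
          linarith
        rw [h5]
        have h8 : (2.718281828 : ℝ) ^ 2 ≤ exp 1 ^ 2 := pow_le_pow_left₀ (by norm_num) (by linarith) 2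
        calc (10 : ℝ) ≤ ((1 : ℝ) / 3 + (1/3)^2/2 + 1) * (2.718281828 : ℝ) ^ 2 := by norm_num
          _ ≤ _ := mul_le_mul h7 h8 (by positivity) (exp_pos _).le
      push_cast; linarith
    linarith
  have t2 : log 2 ≤ 1 := by linarith [log_two_lt_d9]
  have t3 : 1 + log (2 * exp 3 * (r * (g * L')) / (g * N)) ≤ 1.02 + log (1 / ε) := by
    have h1 : 2 * exp 3 * (r * (g * L')) / (g * N) ≤ (1 / ε) * (exp 3 * (1/20)) := by
      rw [div_le_iff₀ (by positivity)]
      have : (1 / ε) * (exp 3 * (1/20)) * (g * N) = exp 3 * g / 20 * ((1 / ε) * N) := by ring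
      rw [this]
      have h2 : 40 * (L' * r) ≤ (1 / ε) * N := by
        rw [div_mul_eq_mul_div, one_mul, le_div_iff₀ hε]; linarith
      have h3 : exp 3 * g / 20 * (40 * (L' * r)) ≤ exp 3 * g / 20 * ((1 / ε) * N) := by gcongr
      calc _ = exp 3 * g / 20 * (40 * (L' * r)) := by ring
        _ ≤ _ := h3
    have h2 : log (2 * exp 3 * (r * (g * L')) / (g * N)) ≤ log (1 / ε) + log (exp 3 * (1/20)) := by
      rw [← log_mul (by positivity) (by positivity)]
      exact log_le_log (by positivity) h1
    have h3 : log (exp 3 * (1/20)) ≤ 0.02 := by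
      have := log_le_sub_one_of_pos (show 0 < exp 3 * (1/20) by positivity)
      linarith
    linarith
  have s3 : 6 * ((g * N : ℝ) * (1 + log (2 * exp 3 * (r * (g * L')) / (g * N)))) ≤ 0.4 * T := by
    have h1 : 1 + log (2 * exp 3 * (r * (g * L')) / (g * N)) ≤ L' / 15 := by linarith
    have h2 : (g * N : ℝ) * (1 + log (2 * exp 3 * (r * (g * L')) / (g * N))) ≤ (g * N : ℝ) * (L' / 15) := by gcongr
    rw [hT]; linarith
  have s4 : L' * (r * (g * L')) * ε * exp 3 ≤ 0.5022 * T := by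
    have h1 : (L' : ℝ) * (r * (g * L')) * ε = (g * L') * (L' * (r * ε)) := by ring
    rw [h1]
    have h2 : (g * L' : ℝ) * (L' * (r * ε)) ≤ (g * L') * (N / 40) := by gcongr; linarith
    have h3 : (g * L' : ℝ) * (N / 40) = T / 40 := by rw [hT]; ring
    calc (g * L' : ℝ) * (L' * (r * ε)) * exp 3 ≤ (T / 40) * 20.0857 := by
          apply mul_le_mul (by linarith) he3 (exp_pos _).le (by positivity)
      _ ≤ _ := by linarith
  have s5 : 5 * ((N + L' : ℝ) * L' * a) ≤ 0.3016 * T := by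
    have h1 : (N + L' : ℝ) * L' * a ≤ (41/40 * N) * L' * (g / 17) := by
      have : a ≤ g / 17 := by linarith
      have h2 : (N + L' : ℝ) ≤ 41 / 40 * N := by linarith
      calc (N + L' : ℝ) * L' * a ≤ (N + L' : ℝ) * L' * (g / 17) := by gcongr
        _ ≤ _ := by gcongr
    have h2 : (41/40 * N : ℝ) * L' * (g / 17) = 41/40/17 * T := by rw [hT]; ring
    linarith
  have s6 : 6 * ((g * L' : ℝ) * L' * b) ≤ 0.1996 * T := by
    have h1 : (g * L' : ℝ) * L' * b ≤ (g * L' : ℝ) * L' * (1.33 * (r * ε)) := by gcongr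
    have h2 : (g * L' : ℝ) * (L' * (r * ε)) ≤ (g * L') * (N / 40) := by gcongr; linarith
    have h3 : (g * L' : ℝ) * (N / 40) = T / 40 := by rw [hT]; ring
    linarith
  linarith

theorem stage (q1 q2 L' g m' n : ℕ) (ε Q h G Λ ur wr : ℝ) (u w : KK)
    (hq1 : 0 < q1) (hQdef : Q = q1 * log rho) (hεdef : ε = q1 * log rho - q2 * log goldenRatio)
    (hε : 0 < ε) (hε1 : ε ≤ 1) (hL : 15 * (1.02 + log (1 / ε)) ≤ L') (hg : 0 < g) (hgQ : 34 * Q ≤ g)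
    (hui : IsIntegral ℤ u) (hwi : IsIntegral ℤ w) (hu0 : sig0 u = (ur : ℂ)) (hw0 : sig0 w = (wr : ℂ))
    (hur : 0 < ur) (hwr : 0 < wr) (hh : 0 ≤ h)
    (huH : ∀ σ : KK →+* ℂ, ‖σ u‖ ≤ exp h) (hwH : ∀ σ : KK →+* ℂ, ‖σ w‖ ≤ exp h)
    (hG : |log (ur / wr)| ≤ G) (hΛ1 : |Λ| ≤ 1)
    (hrel : ur * rho ^ m' = wr * goldenRatio ^ n * exp Λ)
    (hbig : h + 2 * Q + G + 1 ≤ 0.33 * ((m' / q1 : ℕ) * ε))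
    (hr1 : 80 * (L' * ε) ≤ 1) (hr2 : 2 * (L' + 1) ≤ m' / q1) (hrε : (1 : ℝ) ≤ (m' / q1 : ℕ) * ε)
    (hΛ : |Λ| ≤ exp (-(125 * g * L' ^ 2 * ((m' / q1 : ℕ) * ε)))) : False := by
  set r := m' / q1 with hr
  set s := m' % q1 with hs
  have hm' : m' = r * q1 + s := by rw [hr, hs, mul_comm]; exact (Nat.div_add_mod m' q1).symm
  have hsq : s < q1 := Nat.mod_lt _ hq1
  set t : ℤ := (n : ℤ) - r * q2 with ht
  have hphi0 : 0 < goldenRatio := goldenRatio_pos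
  have hlr : 0 < log rho := log_pos one_lt_rho
  have hlp : 0 < log goldenRatio := log_pos one_lt_goldenRatio
  have hlogε : 0 ≤ log (1 / ε) := log_nonneg (by rw [le_div_iff₀ hε]; linarith)
  have hLr : (15 : ℝ) ≤ L' := by linarith
  have hL0 : 0 < L' := by
    rcases Nat.eq_zero_or_pos L' with h | h
    · rw [h] at hLr; norm_num at hLr
    · exact h
  have hQ : 0 < Q := by rw [hQdef]; have : (0 : ℝ) < q1 := by exact_mod_cast hq1
                        positivity
  have hrpos : 0 < r := by omega
  set N := ⌈40 * (L' * (r * ε))⌉₊ with hN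
  have hN1 : 40 * (L' * (r * ε)) ≤ N := Nat.le_ceil _
  have hN2 : (N : ℝ) < 40 * (L' * (r * ε)) + 1 := Nat.ceil_lt_add_one (by positivity)
  have hN0 : 0 < N := Nat.ceil_pos.2 (by positivity)
  have hgr : (0 : ℝ) < g := by exact_mod_cast hg
  set η : KK := rK ^ q1 * pK ^ (-(q2 : ℤ)) with hη
  set u' : KK := u * (rK ^ s * pK ^ (-t)) with hu'
  -- log relation
  have hlogrel : log (ur / wr) + m' * log rho = n * log goldenRatio + Λ := by
    have h1 := congrArg log hrel
    rw [log_mul hur.ne' (pow_ne_zero _ rho_pos.ne'), log_mul (mul_ne_zero hwr.ne' (pow_ne_zero _ hphi0.ne')) (exp_pos _).ne',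
      log_mul hwr.ne' (pow_ne_zero _ hphi0.ne'), log_pow, log_pow, log_exp] at h1
    rw [log_div hur.ne' hwr.ne']
    linarith
  have hm'r : (m' : ℝ) = r * q1 + s := by exact_mod_cast hm'
  have htr : (t : ℝ) = n - r * q2 := by rw [ht]; push_cast; ring
  have htlog : t * log goldenRatio = s * log rho + r * ε + log (ur / wr) - Λ := by
    rw [htr, hεdef]; rw [hm'r] at hlogrel; linarith
  have hsQ : s * log rho ≤ Q := by
    rw [hQdef]
    have : (s : ℝ) ≤ q1 := by exact_mod_cast hsq.le
    gcongr
  have hs0 : 0 ≤ s * log rho := by positivity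
  have htabs : |(t : ℝ)| * log goldenRatio ≤ Q + r * ε + G + 1 := by
    rw [← abs_of_pos hlp, ← abs_mul, htlog, abs_le]
    have h1 := abs_le.1 hG
    have h2 := abs_le.1 hΛ1
    constructor <;> linarith
  set b := h + 2 * Q + r * ε + G + 1 with hb
  have hG0 : 0 ≤ G := (abs_nonneg _).trans hG
  have hrε0 : 0 ≤ r * ε := by positivity
  have hcast : ∀ (x : ℕ) (z : ℤ), sig0 (rK ^ x * pK ^ z) = ((rho ^ x * goldenRatio ^ z : ℝ) : ℂ) := by
    intro x z
    rw [map_mul, map_pow, map_zpow₀, sig0_r, sig0_p, Complex.ofReal_mul, Complex.ofReal_pow, Complex.ofReal_zpow]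
  have hexpz : ∀ (x : ℕ) (z : ℤ), rho ^ x * goldenRatio ^ z = exp (x * log rho + z * log goldenRatio) := by
    intro x z
    rw [exp_add, exp_nat_mul, exp_log rho_pos, mul_comm (z : ℝ), ← rpow_def_of_pos hphi0, rpow_intCast]
  have hcore := core finrank_KK sig0 η u' w ((int_rK.pow _).mul (int_pK_zpow _))
    (hui.mul ((int_rK.pow _).mul (int_pK_zpow _))) hwi ε (ur * (rho ^ s * goldenRatio ^ (-t))) wr Λ
    (q1 * log rho + q2 * log goldenRatio) b (by
      rw [hη, hcast, hexpz, hεdef]; push_cast; ring_nf) (by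
      rw [hu', map_mul, hcast, hu0, ← Complex.ofReal_mul]) hw0 hε
    (mul_pos hur (mul_pos (pow_pos rho_pos _) (zpow_pos hphi0 _))) hwr N L' g r
    (by
      rw [hexpz]
      have h1 : ur = exp (log ur) := (exp_log hur).symm
      have h2 : wr = exp (log wr) := (exp_log hwr).symm
      rw [h1, h2, ← exp_add, ← exp_add, ← exp_add]
      congr 1
      rw [log_div hur.ne' hwr.ne'] at htlog
      push_cast
      linarith)
    (by positivity) (by positivity)
    (by
      intro σ
      rw [hη, map_mul, norm_mul, exp_add]
      refine mul_le_mul (sig_r_pow σ q1) ?_ (norm_nonneg _) (exp_pos _).le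
      have := sig_p_zpow σ (-(q2 : ℤ))
      simpa using this)
    (by
      intro σ
      rw [hu', map_mul, map_mul, norm_mul, norm_mul]
      have h1 := sig_p_zpow σ (-t)
      have h2 : |((-t : ℤ) : ℝ)| = |(t : ℝ)| := by push_cast; rw [abs_neg]
      rw [h2] at h1
      calc ‖σ u‖ * (‖σ (rK ^ s)‖ * ‖σ (pK ^ (-t))‖) ≤ exp h * (exp (s * log rho) * exp (|(t : ℝ)| * log goldenRatio)) := by
            gcongr
            · exact huH σ
            · exact sig_r_pow σ s
        _ = exp (h + (s * log rho + |(t : ℝ)| * log goldenRatio)) := by rw [exp_add, exp_add]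
        _ ≤ exp b := by apply exp_le_exp.2; linarith)
    (by
      intro σ
      refine (hwH σ).trans (exp_le_exp.2 ?_)
      linarith)
    hN0 hL0 hg
    (by
      have h1 : (N : ℝ) + L' ≤ r := by
        have h2 : (2 * (L' + 1) : ℝ) ≤ r := by exact_mod_cast hr2
        have h3 : 80 * (L' * (r * ε)) ≤ r := by
          have : (80 * (L' * ε)) * r ≤ 1 * r := by gcongr
          linarith
        linarith
      exact_mod_cast h1)
    (by
      have hNL : (g * N * L' : ℝ) ≤ 40 * (g * L' ^ 2 * (r * ε)) + g * L' := by
        have : (g * L' : ℝ) * N ≤ (g * L') * (40 * (L' * (r * ε)) + 1) := by gcongr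
        linarith
      have h1 : (Real.exp 3)⁻¹ ^ (g * N * L') = exp (-(3 * (g * N * L' : ℝ))) := by
        rw [← exp_neg, ← exp_nat_mul]; push_cast; ring_nf
      rw [h1]
      have h2 : (2 * ((g * L' : ℕ) * L') : ℝ) ≤ exp (2 * (g * L' ^ 2)) := by
        push_cast
        have := add_one_le_exp (2 * (g * L' ^ 2) : ℝ)
        linarith
      calc _ ≤ exp (2 * (g * L' ^ 2)) * exp (-(125 * g * L' ^ 2 * (r * ε))) := by gcongr
        _ = exp (2 * (g * L' ^ 2) + -(125 * g * L' ^ 2 * (r * ε))) := by rw [exp_add]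
        _ ≤ _ := by
          apply exp_le_exp.2
          have h3 : (g * L' ^ 2 : ℝ) * 1 ≤ g * L' ^ 2 * (r * ε) := by gcongr
          have h4 : (g * L' : ℝ) * 1 ≤ g * L' * L' := by gcongr; linarith
          linarith)
  refine stage_arith g N L' r ε Q (q1 * log rho + q2 * log goldenRatio) b hg hN0 hL0 hε hε1 hrpos hL hgQ hrε hN1 ?_ ?_ hcore
  · rw [hεdef] at hε; linarith
  · rw [hb]; linarith

end PartP8

section PartPL
open Real

/-- evaluate the first argument before going on (only matters for kernel evaluation) -/
def force {α : Type} (n : ℕ) (f : ℕ → α) : α := Nat.casesOn n (f 0) (fun m => f (Nat.succ m))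

lemma force_eq {α : Type} (n : ℕ) (f : ℕ → α) : force n f = f n := by cases n <;> rfl

/-- lower bound for the series of `-log (1 - x)`, fixed point with denominator `D` -/
def lgLo (D X n : ℕ) : ℕ → ℕ → ℕ → ℕ :=
  Nat.rec (fun _ _ S => S) (fun _ ih i P S =>
    force (Nat.div (Nat.mul P X) D) fun P' => force (Nat.add S (Nat.div P' i)) fun S' =>
      force (Nat.succ i) fun i' => ih i' P' S') n

/-- upper bound for the series of `-log (1 - x)`, fixed point with denominator `D` -/
def lgUp (D X n : ℕ) : ℕ → ℕ → ℕ → ℕ :=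
  Nat.rec (fun _ P S => Nat.succ (Nat.add S (Nat.div (Nat.mul P X) (Nat.sub D X)))) (fun _ ih i P S =>
    force (Nat.succ (Nat.div (Nat.mul P X) D)) fun P' => force (Nat.succ (Nat.add S (Nat.div P' i))) fun S' =>
      force (Nat.succ i) fun i' => ih i' P' S') n

lemma lgLo_succ (D X n i P S : ℕ) : lgLo D X (n+1) i P S = lgLo D X n (i+1) (P * X / D) (S + P * X / D / i) := by
  unfold lgLo
  simp only [force_eq]; rfl

lemma lgUp_succ (D X n i P S : ℕ) : lgUp D X (n+1) i P S = lgUp D X n (i+1) (P * X / D + 1) (S + (P * X / D + 1) / i + 1) := by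
  unfold lgUp
  simp only [force_eq]; rfl

lemma natdiv_le_real (a b : ℕ) : ((a / b : ℕ) : ℝ) ≤ (a : ℝ) / b := Nat.cast_div_le
lemma real_le_natdiv (a b : ℕ) (hb : 0 < b) : (a : ℝ) / b ≤ ((a / b : ℕ) : ℝ) + 1 := by
  rw [div_le_iff₀ (by exact_mod_cast hb)]
  have h : a ≤ (a / b + 1) * b := (Nat.lt_mul_of_div_lt (Nat.lt_succ_self _) hb).le.trans (by rw [Nat.succ_eq_add_one])
  exact_mod_cast h

lemma lgLo_bound (D X : ℕ) (hD : 0 < D) (x : ℝ) (hx0 : 0 ≤ x) (hX : (X : ℝ) ≤ D * x) (n : ℕ) :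
    ∀ (j P S : ℕ), (P : ℝ) ≤ D * x ^ j → (S : ℝ) ≤ D * ∑ i ∈ Finset.range j, x ^ (i+1) / ((i : ℝ) + 1) →
      (lgLo D X n (j+1) P S : ℝ) ≤ D * ∑ i ∈ Finset.range (j + n), x ^ (i+1) / ((i : ℝ) + 1) := by
  have hDr : (0 : ℝ) < D := by exact_mod_cast hD
  induction n with
  | zero => intro j P S _ hS; exact hS
  | succ n ih =>
    intro j P S hP hS
    rw [lgLo_succ]
    have hP' : ((P * X / D : ℕ) : ℝ) ≤ D * x ^ (j+1) := by
      refine (natdiv_le_real _ _).trans ?_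
      rw [div_le_iff₀ hDr]
      push_cast
      calc (P : ℝ) * X ≤ (D * x ^ j) * (D * x) := by gcongr
        _ = _ := by ring
    have := ih (j+1) (P * X / D) (S + P * X / D / (j+1)) hP' ?_
    · rw [show j + (n + 1) = j + 1 + n by ring]; exact this
    · rw [Finset.sum_range_succ]
      push_cast
      have h1 := natdiv_le_real (P * X / D) (j+1)
      have h2 : ((P * X / D : ℕ) : ℝ) / ((j+1 : ℕ) : ℝ) ≤ D * (x ^ (j+1) / ((j : ℝ) + 1)) := by
        push_cast
        rw [← mul_div_assoc]
        gcongr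
      push_cast at h1 h2 ⊢
      linarith

lemma lgLo_le (D X : ℕ) (hD : 0 < D) (x : ℝ) (hx0 : 0 ≤ x) (hx1 : x < 1) (hX : (X : ℝ) ≤ D * x) (n : ℕ) :
    (lgLo D X n 1 D 0 : ℝ) ≤ D * (-log (1 - x)) := by
  have h1 := lgLo_bound D X hD x hx0 hX n 0 D 0 (by simp) (by simp)
  refine h1.trans ?_
  have hs := hasSum_pow_div_log_of_abs_lt_one (show |x| < 1 by rwa [abs_of_nonneg hx0])
  gcongr
  exact sum_le_hasSum _ (fun i _ => by positivity) hs

lemma lgUp_bound (D X : ℕ) (hD : 0 < D) (hXD : X < D) (x : ℝ) (hx0 : 0 ≤ x) (hx1 : x < 1) (hX : D * x ≤ (X : ℝ)) (n : ℕ) :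
    ∀ (j P S : ℕ), D * x ^ j ≤ (P : ℝ) → D * ∑ i ∈ Finset.range j, x ^ (i+1) / ((i : ℝ) + 1) ≤ (S : ℝ) →
      D * (-log (1 - x)) ≤ (lgUp D X n (j+1) P S : ℝ) := by
  have hDr : (0 : ℝ) < D := by exact_mod_cast hD
  induction n with
  | zero =>
    intro j P S hP hS
    change _ ≤ ((Nat.succ (S + P * X / (D - X)) : ℕ) : ℝ)
    have hs := hasSum_pow_div_log_of_abs_lt_one (show |x| < 1 by rwa [abs_of_nonneg hx0])
    have htail : -log (1 - x) ≤ ∑ i ∈ Finset.range j, x ^ (i+1) / ((i : ℝ) + 1) + x ^ (j+1) / (1 - x) := by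
      have h1 := (hasSum_nat_add_iff' j).2 hs
      have h2 : HasSum (fun n => x ^ (j + 1) * x ^ n) (x ^ (j+1) * (1 - x)⁻¹) :=
        (hasSum_geometric_of_lt_one hx0 hx1).mul_left _
      have h3 := hasSum_le (fun n => ?_) h1 h2
      · rw [← div_eq_mul_inv] at h3; linarith
      · rw [← pow_add, show j + 1 + n = n + j + 1 by ring]
        apply div_le_self (by positivity)
        push_cast
        have : (0 : ℝ) ≤ n + j := by positivity
        linarith
    have hDX : (0 : ℝ) < (D - X : ℕ) := by exact_mod_cast Nat.sub_pos_of_lt hXD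
    have hDXr : ((D - X : ℕ) : ℝ) = D - X := by push_cast [Nat.cast_sub hXD.le]; ring
    have h4 := real_le_natdiv (P * X) (D - X) (Nat.sub_pos_of_lt hXD)
    have h5 : D * (x ^ (j+1) / (1 - x)) ≤ ((P * X : ℕ) : ℝ) / ((D - X : ℕ) : ℝ) := by
      rw [le_div_iff₀ hDX, hDXr]
      have h6 : ((D : ℝ) - X) ≤ D * (1 - x) := by linarith
      have hx1' : 0 < 1 - x := by linarith
      calc D * (x ^ (j+1) / (1 - x)) * (D - X) ≤ D * (x ^ (j+1) / (1 - x)) * (D * (1 - x)) := by gcongr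
        _ = (D * x ^ j) * (D * x) := by field_simp; ring
        _ ≤ P * X := by gcongr
        _ = _ := by push_cast; ring
    push_cast at h4 h5 ⊢
    have h7 := mul_le_mul_of_nonneg_left htail hDr.le
    linarith
  | succ n ih =>
    intro j P S hP hS
    rw [lgUp_succ]
    have hP' : D * x ^ (j+1) ≤ ((P * X / D + 1 : ℕ) : ℝ) := by
      push_cast
      refine le_trans ?_ (real_le_natdiv _ _ hD)
      rw [le_div_iff₀ hDr]
      push_cast
      calc D * x ^ (j+1) * D = (D * x ^ j) * (D * x) := by ring
        _ ≤ _ := by gcongr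
    refine ih (j+1) (P * X / D + 1) (S + (P * X / D + 1) / (j+1) + 1) hP' ?_
    rw [Finset.sum_range_succ]
    have h1 := real_le_natdiv (P * X / D + 1) (j+1) (by omega)
    have h2 : D * (x ^ (j+1) / ((j : ℝ) + 1)) ≤ ((P * X / D + 1 : ℕ) : ℝ) / ((j+1 : ℕ) : ℝ) := by
      push_cast
      rw [← mul_div_assoc]
      gcongr
      exact_mod_cast hP'
    push_cast at h1 h2 hS ⊢
    linarith

lemma le_lgUp (D X : ℕ) (hD : 0 < D) (hXD : X < D) (x : ℝ) (hx0 : 0 ≤ x) (hx1 : x < 1) (hX : D * x ≤ (X : ℝ)) (n : ℕ) :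
    D * (-log (1 - x)) ≤ (lgUp D X n 1 D 0 : ℝ) :=
  lgUp_bound D X hD hXD x hx0 hx1 hX n 0 D 0 (by simp) (by simp)

end PartPL

section PartPM
open Real

@[irreducible] def D0 : ℕ := 2 ^ 1400
@[irreducible] def rr : ℕ := 36653660506781939247565743449283084654600243823482930889493193706517349206108681530510481064641076285434451115154488616723351850731277538727923028642603942064848724814313717234369038879220297417585616632532583151108291961608261931814146823205251932531103070104380292258755238979119386565696264948872808237707331205500956384296467718271609417114857524465778069670609327561159385633000088242626335838702440577724278471990131
@[irreducible] def ff : ℕ := 44769430494793038568929506311370019553307833548224432686974454908766132869974619346197293926250052519509058752685014236762900515122975887719874126153749803386545700978280574487116649219065003613196617491397878973589171557969353704130702454539982793927749687636343315621407336978302598975030925551417643631065936192404121358677149900419879516459854858643925600591741109212627189414709907792591245340334986645809477814299952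
@[irreducible] def al : ℕ := 7780519374344970934233893311696788902739765521881430596261765447205287491009685425549536430391521696689107048152627044959552085627008364851886472256170525667235071674972600561576252431022246461621197350032202230411837009593807894768251367393150901709701396084387271330822102074630730958747721971985244136411232822365124024481070716169307743458292802090631838895990761587639518584382904655570750158628203322035275990087874
@[irreducible] def fl : ℕ := 13314664280892612088464930375863076241523820505376021903953053905681563686532589253348984340435833337305378028118927516442321385377176031387928818381277532382109726251119085862359122266799950454488958200073220763534464592161657321965277403534526706402185608892734183345769300547345024236121363612168383012308199581553102798535474841235367885371273923780618036663209051421679589902405341364575988454589508273207611352845152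
@[irreducible] def iL : ℕ := rr * rr / D0 - D0
@[irreducible] def iU : ℕ := (rr + 1) * (rr + 1) / D0 + 1 - D0
@[irreducible] def jL : ℕ := ff - D0
@[irreducible] def jU : ℕ := ff + 1 - D0

lemma D0_pos : 0 < D0 := by decide +kernel
lemma D0_posR : (0 : ℝ) < D0 := by exact_mod_cast D0_pos

lemma rr_lt : (rr : ℝ) < D0 * rho := by
  have h : rr ^ 3 < (rr + D0) * D0 ^ 2 := by decide +kernel
  have hr : (rr : ℝ) ^ 3 < (rr + D0) * D0 ^ 2 := by exact_mod_cast h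
  have hD := D0_posR
  have := lt_rho_of (a := (rr : ℝ) / D0) (by positivity) (by
    rw [div_pow, div_lt_iff₀ (by positivity)]
    calc _ < _ := hr
      _ = _ := by field_simp)
  rw [div_lt_iff₀ hD] at this
  linarith

lemma lt_rr : D0 * rho < (rr : ℝ) + 1 := by
  have h : (rr + 1 + D0) * D0 ^ 2 < (rr + 1) ^ 3 := by decide +kernel
  have hr : ((rr : ℝ) + 1 + D0) * D0 ^ 2 < (rr + 1) ^ 3 := by exact_mod_cast h
  have h1 : D0 ≤ rr + 1 := by decide +kernel
  have h1r : (D0 : ℝ) ≤ rr + 1 := by exact_mod_cast h1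
  have hD := D0_posR
  have := rho_lt_of (a := ((rr : ℝ) + 1) / D0) (by rw [le_div_iff₀ hD]; linarith) (by
    rw [div_pow, lt_div_iff₀ (by positivity)]
    calc _ = ((rr : ℝ) + 1 + D0) * D0 ^ 2 := by field_simp
      _ < _ := hr)
  rw [lt_div_iff₀ hD] at this
  linarith

lemma ff_lt : (ff : ℝ) < D0 * goldenRatio := by
  have h : ff ^ 2 < (ff + D0) * D0 := by decide +kernel
  have hr : (ff : ℝ) ^ 2 < (ff + D0) * D0 := by exact_mod_cast h
  have hD := D0_posR
  have h1 := goldenRatio_sq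
  have h2 := one_lt_goldenRatio
  by_contra hc
  push Not at hc
  have h3 : (D0 : ℝ) * goldenRatio * (goldenRatio * D0 - D0) ≤ ff * (ff - D0) := by
    apply mul_le_mul hc (by linarith) (by nlinarith) (by positivity)
  have : (D0 : ℝ) * goldenRatio * (goldenRatio * D0 - D0) = D0 ^ 2 * (goldenRatio ^ 2 - goldenRatio) := by ring
  rw [this, h1] at h3
  nlinarith

lemma lt_ff : D0 * goldenRatio < (ff : ℝ) + 1 := by
  have h : (ff + 1 + D0) * D0 < (ff + 1) ^ 2 := by decide +kernel
  have hr : ((ff : ℝ) + 1 + D0) * D0 < (ff + 1) ^ 2 := by exact_mod_cast h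
  have h0 : D0 ≤ ff := by decide +kernel
  have h0r : (D0 : ℝ) ≤ ff := by exact_mod_cast h0
  have hD := D0_posR
  have h1 := goldenRatio_sq
  have h2 := one_lt_goldenRatio
  by_contra hc
  push Not at hc
  have h3 : ((ff : ℝ) + 1) * (ff + 1 - D0) ≤ (D0 : ℝ) * goldenRatio * (goldenRatio * D0 - D0) := by
    apply mul_le_mul hc (by linarith) (by linarith) (by positivity)
  have : (D0 : ℝ) * goldenRatio * (goldenRatio * D0 - D0) = D0 ^ 2 * (goldenRatio ^ 2 - goldenRatio) := by ring
  rw [this, h1] at h3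
  nlinarith

lemma iL_le : (iL : ℝ) ≤ D0 * rho⁻¹ := by
  have h0 : D0 ≤ rr * rr / D0 := by decide +kernel
  have h1 := natdiv_le_real (rr * rr) D0
  have h2 : (iL : ℝ) = ((rr * rr / D0 : ℕ) : ℝ) - D0 := by
    rw [iL, Nat.cast_sub h0]
  rw [h2, rho_inv]
  have h3 : ((rr * rr : ℕ) : ℝ) / D0 ≤ D0 * rho ^ 2 := by
    rw [div_le_iff₀ D0_posR]
    push_cast
    have := rr_lt
    have h4 : 0 ≤ D0 * rho := (mul_pos D0_posR rho_pos).le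
    calc (rr : ℝ) * rr ≤ (D0 * rho) * (D0 * rho) := by gcongr
      _ = _ := by ring
  linarith

lemma le_iU : D0 * rho⁻¹ ≤ (iU : ℝ) := by
  have h0 : D0 ≤ (rr + 1) * (rr + 1) / D0 + 1 := by decide +kernel
  have h1 := real_le_natdiv ((rr + 1) * (rr + 1)) D0 D0_pos
  have h2 : (iU : ℝ) = ((((rr + 1) * (rr + 1)) / D0 : ℕ) : ℝ) + 1 - D0 := by
    rw [iU, Nat.cast_sub h0]; push_cast; ring
  rw [h2, rho_inv]
  have h3 : D0 * rho ^ 2 ≤ (((rr + 1) * (rr + 1) : ℕ) : ℝ) / D0 := by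
    rw [le_div_iff₀ D0_posR]
    push_cast
    have := lt_rr
    have h4 := D0_posR
    have h5 := rho_pos
    calc D0 * rho ^ 2 * D0 = (D0 * rho) * (D0 * rho) := by ring
      _ ≤ _ := by gcongr
  linarith

lemma phi_inv : goldenRatio⁻¹ = goldenRatio - 1 := by
  rw [inv_eq_of_mul_eq_one_right]; nlinarith [goldenRatio_sq]

lemma jL_le : (jL : ℝ) ≤ D0 * goldenRatio⁻¹ := by
  have h0 : D0 ≤ ff := by decide +kernel
  rw [jL, Nat.cast_sub h0, phi_inv]
  linarith [ff_lt]

lemma le_jU : D0 * goldenRatio⁻¹ ≤ (jU : ℝ) := by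
  have h0 : D0 ≤ ff + 1 := by decide +kernel
  rw [jU, Nat.cast_sub h0, phi_inv]
  push_cast
  linarith [lt_ff]

lemma fixmul_le (a b D : ℕ) (hD : 0 < D) (x y : ℝ) (hx : 0 ≤ x) (ha : (a : ℝ) ≤ D * x) (hb : (b : ℝ) ≤ D * y) :
    ((a * b / D : ℕ) : ℝ) ≤ D * (x * y) := by
  have hDr : (0 : ℝ) < D := by exact_mod_cast hD
  refine (natdiv_le_real _ _).trans ?_
  rw [div_le_iff₀ hDr]
  push_cast
  calc (a : ℝ) * b ≤ (D * x) * (D * y) := by gcongr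
    _ = _ := by ring

lemma le_fixmul (a b D : ℕ) (hD : 0 < D) (x y : ℝ) (hy : 0 ≤ y) (ha : D * x ≤ (a : ℝ)) (hb : D * y ≤ (b : ℝ)) :
    D * (x * y) ≤ ((a * b / D + 1 : ℕ) : ℝ) := by
  have hDr : (0 : ℝ) < D := by exact_mod_cast hD
  push_cast
  refine le_trans ?_ (real_le_natdiv _ _ hD)
  rw [le_div_iff₀ hDr]
  push_cast
  calc D * (x * y) * D = (D * x) * (D * y) := by ring
    _ ≤ _ := by gcongr

@[irreducible] def i2L : ℕ := iL * iL / D0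
@[irreducible] def i3L : ℕ := i2L * iL / D0
@[irreducible] def i5L : ℕ := i3L * i2L / D0
@[irreducible] def i2U : ℕ := iU * iU / D0 + 1
@[irreducible] def i3U : ℕ := i2U * iU / D0 + 1
@[irreducible] def i5U : ℕ := i3U * i2U / D0 + 1

lemma rho_log5 : log rho = -log (1 - rho⁻¹ ^ 5) := by
  have h : 1 - rho⁻¹ ^ 5 = rho⁻¹ := by
    have h1 := rho_cube
    have h2 : rho * rho⁻¹ = 1 := mul_inv_cancel₀ rho_pos.ne'
    have h3' : rho ^ 5 = rho ^ 4 + 1 := by linear_combination (rho ^ 2 - rho + 1) * h1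
    have h4 : rho ^ 5 ≠ 0 := pow_ne_zero _ rho_pos.ne'
    rw [rho_inv]
    linear_combination ((-3)*rho^0+(3)*rho^1+(3)*rho^2+(-6)*rho^3+(-1)*rho^4+(4)*rho^5+(0)*rho^6+(-1)*rho^7)*h1
  rw [h, log_inv, neg_neg]

lemma phi_log2 : log goldenRatio = -log (1 - goldenRatio⁻¹ ^ 2) := by
  have h : 1 - goldenRatio⁻¹ ^ 2 = goldenRatio⁻¹ := by
    have h1 := goldenRatio_sq
    rw [phi_inv]; linarith
  rw [h, log_inv, neg_neg]

lemma rho_inv_pos : 0 < rho⁻¹ := inv_pos.2 rho_pos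
lemma rho_inv_lt : rho⁻¹ < 1 := inv_lt_one_of_one_lt₀ one_lt_rho
lemma phi_inv_pos : 0 < goldenRatio⁻¹ := inv_pos.2 goldenRatio_pos
lemma phi_inv_lt : goldenRatio⁻¹ < 1 := inv_lt_one_of_one_lt₀ one_lt_goldenRatio

lemma al_le : (al : ℝ) ≤ D0 * log rho := by
  have h : al ≤ lgLo D0 i5L 700 1 D0 0 := by decide +kernel
  rw [rho_log5]
  refine le_trans (by exact_mod_cast h) (lgLo_le D0 i5L D0_pos _ (pow_nonneg rho_inv_pos.le _) (pow_lt_one₀ rho_inv_pos.le rho_inv_lt (by norm_num)) ?_ 700)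
  have h2 := fixmul_le iL iL D0 D0_pos _ _ rho_inv_pos.le iL_le iL_le
  rw [← i2L] at h2
  have h3 := fixmul_le i2L iL D0 D0_pos _ _ (mul_nonneg rho_inv_pos.le rho_inv_pos.le) h2 iL_le
  rw [← i3L] at h3
  have h5 := fixmul_le i3L i2L D0 D0_pos _ _ (mul_nonneg (mul_nonneg rho_inv_pos.le rho_inv_pos.le) rho_inv_pos.le) h3 h2
  rw [← i5L] at h5
  refine h5.trans (le_of_eq (by ring))

lemma le_al : D0 * log rho ≤ (al : ℝ) + 2 ^ 14 := by
  have h : lgUp D0 i5U 700 1 D0 0 ≤ al + 2 ^ 14 := by decide +kernel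
  have hlt : i5U < D0 := by decide +kernel
  rw [rho_log5]
  refine le_trans (le_lgUp D0 i5U D0_pos hlt _ (pow_nonneg rho_inv_pos.le _) (pow_lt_one₀ rho_inv_pos.le rho_inv_lt (by norm_num)) ?_ 700) (by exact_mod_cast h)
  have h2 := le_fixmul iU iU D0 D0_pos _ _ rho_inv_pos.le le_iU le_iU
  rw [← i2U] at h2
  have h3 := le_fixmul i2U iU D0 D0_pos _ _ rho_inv_pos.le h2 le_iU
  rw [← i3U] at h3
  have h5 := le_fixmul i3U i2U D0 D0_pos _ _ (mul_nonneg rho_inv_pos.le rho_inv_pos.le) h3 h2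
  rw [← i5U] at h5
  refine (le_of_eq (by ring)).trans h5

lemma fl_le : (fl : ℝ) ≤ D0 * log goldenRatio := by
  have h : fl ≤ lgLo D0 (jL * jL / D0) 1020 1 D0 0 := by decide +kernel
  rw [phi_log2]
  refine le_trans (by exact_mod_cast h) (lgLo_le D0 _ D0_pos _ (pow_nonneg phi_inv_pos.le _) (pow_lt_one₀ phi_inv_pos.le phi_inv_lt (by norm_num)) ?_ 1020)
  have h2 := fixmul_le jL jL D0 D0_pos _ _ phi_inv_pos.le jL_le jL_le
  refine h2.trans (le_of_eq (by ring))

lemma le_fl : D0 * log goldenRatio ≤ (fl : ℝ) + 2 ^ 14 := by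
  have h : lgUp D0 (jU * jU / D0 + 1) 1020 1 D0 0 ≤ fl + 2 ^ 14 := by decide +kernel
  have hlt : jU * jU / D0 + 1 < D0 := by decide +kernel
  rw [phi_log2]
  refine le_trans (le_lgUp D0 _ D0_pos hlt _ (pow_nonneg phi_inv_pos.le _) (pow_lt_one₀ phi_inv_pos.le phi_inv_lt (by norm_num)) ?_ 1020) (by exact_mod_cast h)
  have h2 := le_fixmul jU jU D0 D0_pos _ _ phi_inv_pos.le le_jU le_jU
  refine (le_of_eq (by ring)).trans h2

end PartPM

section PartP9
open Real

lemma pad_rec (k : ℕ) : padovan (k+3) = padovan (k+1) + padovan k := rfl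

noncomputable def cz : ℝ := rho ^ 4 / (3 * rho ^ 2 - 1)

lemma den_bd : 4.26449 < 3 * rho ^ 2 - 1 ∧ 3 * rho ^ 2 - 1 < 4.2653 := by
  have h1 := rho_gt; have h2 := rho_lt
  constructor <;> nlinarith

lemma cz_mul : cz * (3 * rho ^ 2 - 1) = rho ^ 4 := by
  have h : 3 * rho ^ 2 - 1 ≠ 0 := by linarith [den_bd.1]
  unfold cz; rw [div_mul_cancel₀ _ h]

noncomputable def ez (m : ℕ) : ℝ := padovan m - cz * rho ^ m

lemma dz (m : ℕ) : (padovan (m+2) : ℝ) + rho * padovan (m+1) + (rho^2-1) * padovan m = rho ^ 4 * rho ^ m := by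
  induction m with
  | zero =>
    simp [padovan]; linear_combination (-rho) * rho_cube
  | succ k ih =>
    have : (padovan (k+1+2) : ℝ) = padovan (k+1) + padovan k := by
      rw [show k+1+2 = k+3 by ring, pad_rec]; push_cast; ring
    rw [this, show k+1+1 = k+2 by ring]
    rw [pow_succ rho k]
    linear_combination rho * ih - padovan k * rho_cube

lemma ez_rec (m : ℕ) : ez (m+2) = -rho * ez (m+1) - (rho^2-1) * ez m := by
  have h1 := dz m
  have h2 := cz_mul
  unfold ez
  linear_combination h1 - rho ^ m * h2

lemma qz_succ (m : ℕ) : ez (m+2) ^ 2 + rho * ez (m+1) * ez (m+2) + (rho^2-1) * ez (m+1) ^ 2 =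
    (rho^2-1) * (ez (m+1) ^ 2 + rho * ez m * ez (m+1) + (rho^2-1) * ez m ^ 2) := by
  rw [ez_rec m]; ring

lemma s_bd : 0.754 < rho^2 - 1 ∧ rho^2 - 1 < 0.7551 := by
  have h1 := rho_gt; have h2 := rho_lt
  constructor <;> nlinarith

lemma cz_bd : 0.7220 < cz ∧ cz < 0.7223 := by
  have h1 := rho_gt; have h2 := rho_lt
  have h3 := den_bd
  have h4 : rho ^ 4 = rho ^ 2 + rho := by linear_combination rho * rho_cube
  unfold cz
  rw [h4]
  constructor
  · rw [lt_div_iff₀ (by linarith)]; nlinarith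
  · rw [div_lt_iff₀ (by linarith)]; nlinarith

lemma qz_le (m : ℕ) : ez (m+1) ^ 2 + rho * ez m * ez (m+1) + (rho^2-1) * ez m ^ 2 ≤ 0.079 := by
  have h1 := rho_gt; have h2 := rho_lt
  have hs := s_bd
  induction m with
  | zero =>
    have hc := cz_bd
    have e0 : ez 0 = 1 - cz := by simp [ez, padovan]
    have e1 : ez 1 = 1 - cz * rho := by simp [ez, padovan]
    have a0 : 0.2777 < ez 0 ∧ ez 0 < 0.2780 := by rw [e0]; constructor <;> linarith
    have a1 : 0.043 < ez 1 ∧ ez 1 < 0.0437 := by rw [e1]; constructor <;> nlinarith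
    have b1 : ez 1 ^ 2 ≤ 0.0437 ^ 2 := by gcongr <;> linarith
    have b2 : rho * ez 0 * ez 1 ≤ 1.3248 * 0.278 * 0.0437 := by gcongr <;> linarith
    have b3 : (rho^2-1) * ez 0 ^ 2 ≤ 0.7551 * 0.278 ^ 2 := by gcongr <;> linarith
    simp only [zero_add]
    norm_num at b1 b2 b3 ⊢
    linarith
  | succ k ih =>
    rw [show k + 1 + 1 = k + 2 by ring, qz_succ]
    have : 0 ≤ ez (k+1) ^ 2 + rho * ez k * ez (k+1) + (rho^2-1) * ez k ^ 2 := by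
      nlinarith [sq_nonneg (ez (k+1) + rho / 2 * ez k), sq_nonneg (ez k)]
    nlinarith

lemma ez_le (m : ℕ) : |ez m| ≤ 1/2 := by
  have h := qz_le m
  have h1 := rho_gt; have h2 := rho_lt
  have h3 : 0.316 ≤ rho^2 - 1 - rho^2/4 := by nlinarith
  have h4 : 0.316 * ez m ^ 2 ≤ 0.079 := by
    nlinarith [sq_nonneg (ez (m+1) + rho / 2 * ez m), sq_nonneg (ez m)]
  apply abs_le_of_sq_le_sq _ (by norm_num)
  linarith

lemma sqrt5_bd : 2.236 < √5 ∧ √5 < 2.2361 := by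
  constructor
  · apply lt_sqrt_of_sq_lt; norm_num
  · rw [sqrt_lt' (by norm_num)]; norm_num

lemma phi_bd : 1.618 < goldenRatio ∧ goldenRatio < 1.6181 := by
  have := sqrt5_bd
  unfold goldenRatio; constructor <;> linarith

lemma fib_err (n : ℕ) : |(Nat.fib n : ℝ) - goldenRatio ^ n / √5| ≤ 1/2 := by
  have h5 := sqrt5_bd
  rw [coe_fib_eq]
  have : (goldenRatio ^ n - goldenConj ^ n) / √5 - goldenRatio ^ n / √5 = -(goldenConj ^ n / √5) := by ring
  rw [this, abs_neg, abs_div, abs_pow]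
  have h1 : |goldenConj| ≤ 1 := by
    rw [abs_le]; exact ⟨neg_one_lt_goldenConj.le, by linarith [goldenConj_neg]⟩
  have h2 : |goldenConj| ^ n ≤ 1 := pow_le_one₀ (abs_nonneg _) h1
  rw [abs_of_pos (by linarith : 0 < √5), div_le_iff₀ (by linarith)]
  linarith

lemma pad_five (m : ℕ) : padovan (m+5) = padovan (m+4) + padovan m := by
  have h1 : padovan (m+5) = padovan (m+3) + padovan (m+2) := rfl
  have h2 : padovan (m+4) = padovan (m+2) + padovan (m+1) := rfl
  have h3 := pad_rec m
  omega

lemma pad_step (m : ℕ) : padovan m ≤ padovan (m+1) := by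
  rcases m with _ | _ | _ | _ | m
  · decide
  · decide
  · decide
  · decide
  · exact (Nat.le_add_right _ _).trans (pad_five m).ge

lemma pad_mono : Monotone padovan := monotone_nat_of_le_succ pad_step

lemma pad_diff (m m1 : ℕ) (h : m1 < m) (h20 : 20 ≤ m) : padovan m1 + 14 ≤ padovan m := by
  obtain ⟨j, rfl⟩ : ∃ j, m = j + 5 := ⟨m - 5, by omega⟩
  rw [pad_five]
  have h1 := pad_mono (show m1 ≤ j + 4 by omega)
  have h2 := pad_mono (show 13 ≤ j by omega)
  have h3 : padovan 13 = 28 := by decide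
  omega

theorem setup (m n m1 n1 : ℕ) (hm : m1 < m) (hn : n1 < n) (h20 : 20 ≤ m)
    (heq : padovan m + Nat.fib n1 = padovan m1 + Nat.fib n) :
    ∃ Λ : ℝ, |Λ| ≤ 24 * goldenRatio⁻¹ ^ n ∧ |Λ| ≤ 1 ∧
      √5 * (1 - rho⁻¹ ^ (m - m1)) * rho ^ (m+4) =
        (3 * rho^2 - 1) * (1 - goldenRatio⁻¹ ^ (n - n1)) * goldenRatio ^ n * exp Λ := by
  have h5 := sqrt5_bd
  have hden := den_bd
  have hphi := phi_bd
  have hphi0 := goldenRatio_pos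
  have hpd := pad_diff m m1 hm h20
  have hn7 : 8 ≤ n := by
    by_contra hc
    have : Nat.fib n ≤ Nat.fib 7 := Nat.fib_mono (by omega)
    have h7 : Nat.fib 7 = 13 := by decide
    omega
  have hR : cz * rho ^ m * (1 - rho⁻¹ ^ (m - m1)) = cz * rho ^ m - cz * rho ^ m1 := by
    have : rho ^ m * rho⁻¹ ^ (m - m1) = rho ^ m1 := by
      rw [inv_pow, ← div_eq_mul_inv, div_eq_iff (pow_ne_zero _ rho_pos.ne'), ← pow_add]
      congr 1; omega
    rw [← this]; ring
  have hF : goldenRatio ^ n / √5 * (1 - goldenRatio⁻¹ ^ (n - n1)) = goldenRatio ^ n / √5 - goldenRatio ^ n1 / √5 := by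
    have : goldenRatio ^ n * goldenRatio⁻¹ ^ (n - n1) = goldenRatio ^ n1 := by
      rw [inv_pow, ← div_eq_mul_inv, div_eq_iff (pow_ne_zero _ hphi0.ne'), ← pow_add]
      congr 1; omega
    rw [← this]; ring
  set X := 1 - rho⁻¹ ^ (m - m1) with hX
  set Y := 1 - goldenRatio⁻¹ ^ (n - n1) with hY
  have hYlo : 0.381 ≤ Y := by
    have h1 : goldenRatio⁻¹ ^ (n - n1) ≤ goldenRatio⁻¹ ^ 1 :=
      pow_le_pow_of_le_one phi_inv_pos.le phi_inv_lt.le (by omega)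
    rw [pow_one] at h1
    have h2 := phi_inv
    rw [hY]; linarith
  have hheq : (padovan m : ℝ) + Nat.fib n1 = padovan m1 + Nat.fib n := by exact_mod_cast heq
  set δ := (cz * rho ^ m * X - goldenRatio ^ n / √5 * Y) / (goldenRatio ^ n / √5 * Y) with hδ
  have hGpos : 0 < goldenRatio ^ n / √5 * Y := by positivity
  have hGinv : goldenRatio⁻¹ ^ n * goldenRatio ^ n = 1 := by
    rw [← mul_pow, inv_mul_cancel₀ hphi0.ne', one_pow]
  have hnum : |cz * rho ^ m * X - goldenRatio ^ n / √5 * Y| ≤ 2 := by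
    rw [hR, hF]
    have e1 := abs_le.1 (ez_le m); have e2 := abs_le.1 (ez_le m1)
    have e3 := abs_le.1 (fib_err n); have e4 := abs_le.1 (fib_err n1)
    unfold ez at e1 e2
    rw [abs_le]; constructor <;> linarith
  have hδb : |δ| ≤ 12 * goldenRatio⁻¹ ^ n := by
    rw [hδ, abs_div, abs_of_pos hGpos, div_le_iff₀ hGpos]
    refine hnum.trans ?_
    have : 12 * goldenRatio⁻¹ ^ n * (goldenRatio ^ n / √5 * Y) = (goldenRatio⁻¹ ^ n * goldenRatio ^ n) * (12 / √5 * Y) := by ring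
    rw [this, hGinv, one_mul, div_mul_eq_mul_div, le_div_iff₀ (by linarith)]
    linarith
  have hsmall : 12 * goldenRatio⁻¹ ^ n ≤ 1/2 := by
    have h1 : goldenRatio⁻¹ ^ n ≤ goldenRatio⁻¹ ^ 8 :=
      pow_le_pow_of_le_one phi_inv_pos.le phi_inv_lt.le hn7
    have h2 : goldenRatio⁻¹ ^ 8 ≤ 1/24 := by
      refine le_trans (b := (0.6181:ℝ) ^ 8) ?_ (by norm_num)
      apply pow_le_pow_left₀ phi_inv_pos.le
      rw [phi_inv]; linarith
    linarith
  have hδ2 := abs_le.1 (hδb.trans hsmall)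
  have h1δ : 0 < 1 + δ := by linarith
  have hlogb : |log (1 + δ)| ≤ 2 * |δ| := by
    have u := log_le_sub_one_of_pos h1δ
    have v := one_sub_inv_le_log_of_pos h1δ
    have v2 : 1 - (1+δ)⁻¹ = δ / (1+δ) := by field_simp; ring
    have hv3 : -(2 * |δ|) ≤ δ / (1+δ) := by
      rw [le_div_iff₀ h1δ]
      rcases abs_cases δ with ⟨h, _⟩ | ⟨h, _⟩ <;> rw [h] <;> nlinarith
    rw [abs_le]
    constructor
    · linarith
    · have := le_abs_self δ; have := abs_nonneg δ; linarith
  refine ⟨log (1 + δ), by linarith, by linarith, ?_⟩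
  rw [exp_log h1δ]
  have h6 : cz * rho ^ m * X = goldenRatio ^ n / √5 * Y * (1 + δ) := by
    rw [hδ]; field_simp; ring
  have h7 : √5 * (goldenRatio ^ n / √5) = goldenRatio ^ n := by field_simp
  calc √5 * X * rho ^ (m+4) = √5 * X * rho ^ m * (cz * (3 * rho ^ 2 - 1)) := by rw [cz_mul]; ring
    _ = √5 * (3 * rho ^ 2 - 1) * (cz * rho ^ m * X) := by ring
    _ = (3 * rho ^ 2 - 1) * Y * (√5 * (goldenRatio ^ n / √5)) * (1 + δ) := by rw [h6]; ring
    _ = _ := by rw [h7]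

end PartP9

section PartQ1
open Real

noncomputable def Ak (k : ℕ) : ℝ := -log (1 - rho⁻¹ ^ k)
noncomputable def Bl (l : ℕ) : ℝ := -log (1 - goldenRatio⁻¹ ^ l)
noncomputable def lgz : ℝ := log √5 - log (3 * rho ^ 2 - 1)
/-- the linear form in logarithms -/
noncomputable def Lam (m' n k l : ℕ) : ℝ := lgz + m' * log rho - n * log goldenRatio - Ak k + Bl l

lemma log_series_le (x c : ℝ) (hx : 0 ≤ x) (hxc : x ≤ c) (hc : c < 1) :
    0 ≤ -log (1 - x) ∧ -log (1 - x) ≤ x / (1 - c) := by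
  have h0 : 0 < 1 - x := by linarith
  have u := log_le_sub_one_of_pos h0
  have v := one_sub_inv_le_log_of_pos h0
  refine ⟨by linarith, ?_⟩
  have : (1 - x)⁻¹ - 1 = x / (1 - x) := by field_simp; ring
  have h2 : x / (1 - x) ≤ x / (1 - c) := by gcongr
  linarith

lemma rho_inv_bd : rho⁻¹ < 0.7551 := by rw [rho_inv]; exact s_bd.2
lemma phi_inv_bd : goldenRatio⁻¹ < 0.6181 := by rw [phi_inv]; linarith [phi_bd.2]

lemma Ak_zero : Ak 0 = 0 := by simp [Ak]
lemma Bl_zero : Bl 0 = 0 := by simp [Bl]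

lemma Ak_bd (k : ℕ) : 0 ≤ Ak k ∧ Ak k ≤ 4.1 * rho⁻¹ ^ k := by
  rcases Nat.eq_zero_or_pos k with rfl | hk
  · rw [Ak_zero]; norm_num
  · have h1 : rho⁻¹ ^ k ≤ rho⁻¹ ^ 1 := pow_le_pow_of_le_one rho_inv_pos.le rho_inv_lt.le hk
    rw [pow_one] at h1
    have h0 : 0 ≤ rho⁻¹ ^ k := pow_nonneg rho_inv_pos.le _
    have := log_series_le (rho⁻¹ ^ k) 0.7551 h0 (by linarith [rho_inv_bd]) (by norm_num)
    refine ⟨this.1, this.2.trans ?_⟩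
    rw [div_le_iff₀ (by norm_num)]
    linarith

lemma Bl_bd (k : ℕ) : 0 ≤ Bl k ∧ Bl k ≤ 2.63 * goldenRatio⁻¹ ^ k := by
  rcases Nat.eq_zero_or_pos k with rfl | hk
  · rw [Bl_zero]; norm_num
  · have h1 : goldenRatio⁻¹ ^ k ≤ goldenRatio⁻¹ ^ 1 := pow_le_pow_of_le_one phi_inv_pos.le phi_inv_lt.le hk
    rw [pow_one] at h1
    have h0 : 0 ≤ goldenRatio⁻¹ ^ k := pow_nonneg phi_inv_pos.le _
    have := log_series_le (goldenRatio⁻¹ ^ k) 0.6181 h0 (by linarith [phi_inv_bd]) (by norm_num)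
    refine ⟨this.1, this.2.trans ?_⟩
    rw [div_le_iff₀ (by norm_num)]
    linarith

lemma Ak_le (k : ℕ) : Ak k ≤ 3.1 := by
  rcases Nat.eq_zero_or_pos k with rfl | hk
  · rw [Ak_zero]; norm_num
  · have h1 : rho⁻¹ ^ k ≤ rho⁻¹ ^ 1 := pow_le_pow_of_le_one rho_inv_pos.le rho_inv_lt.le hk
    rw [pow_one] at h1
    linarith [(Ak_bd k).2, rho_inv_bd]

lemma Bl_le (k : ℕ) : Bl k ≤ 1.63 := by
  rcases Nat.eq_zero_or_pos k with rfl | hk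
  · rw [Bl_zero]; norm_num
  · have h1 : goldenRatio⁻¹ ^ k ≤ goldenRatio⁻¹ ^ 1 := pow_le_pow_of_le_one phi_inv_pos.le phi_inv_lt.le hk
    rw [pow_one] at h1
    linarith [(Bl_bd k).2, phi_inv_bd]

lemma lgz_bd : -1 ≤ lgz ∧ lgz ≤ 0 := by
  have h5 := sqrt5_bd
  have hd := den_bd
  unfold lgz
  rw [← log_div (by linarith) (by linarith)]
  constructor
  · rw [le_log_iff_exp_le (by apply div_pos <;> linarith), le_div_iff₀ (by linarith)]
    have h1 : exp (-1) ≤ 1 / 2 := by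
      rw [exp_neg, ← one_div]
      apply one_div_le_one_div_of_le (by norm_num)
      have := add_one_le_exp (1:ℝ); linarith
    nlinarith [exp_pos (-1)]
  · apply log_nonpos (by apply div_nonneg <;> linarith)
    rw [div_le_one (by linarith)]; linarith

lemma Xpos (k : ℕ) (hk : 0 < k) : 0 < 1 - rho⁻¹ ^ k := by
  have := pow_lt_one₀ rho_inv_pos.le rho_inv_lt hk.ne'
  linarith
lemma Ypos (k : ℕ) (hk : 0 < k) : 0 < 1 - goldenRatio⁻¹ ^ k := by
  have := pow_lt_one₀ phi_inv_pos.le phi_inv_lt hk.ne'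
  linarith

theorem setup' (m n m1 n1 : ℕ) (hm : m1 < m) (hn : n1 < n) (h20 : 20 ≤ m)
    (heq : padovan m + Nat.fib n1 = padovan m1 + Nat.fib n) :
    |Lam (m+4) n (m-m1) (n-n1)| ≤ 24 * goldenRatio⁻¹ ^ n ∧ |Lam (m+4) n (m-m1) (n-n1)| ≤ 1 := by
  obtain ⟨Λ, h1, h2, h3⟩ := setup m n m1 n1 hm hn h20 heq
  have : Lam (m+4) n (m-m1) (n-n1) = Λ := by
    have hX := Xpos (m-m1) (by omega)
    have hY := Ypos (n-n1) (by omega)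
    have h5 := sqrt5_bd
    have hd := den_bd
    have h4 := congrArg log h3
    have hr := rho_pos
    have hp := goldenRatio_pos
    rw [log_mul (by positivity) (by positivity), log_mul (by positivity) hX.ne', log_pow,
      log_mul (by apply ne_of_gt; apply mul_pos (mul_pos (by linarith) hY) (by positivity)) (by positivity), log_mul (by apply ne_of_gt; apply (mul_pos (by linarith) hY)) (by positivity),
      log_mul (by linarith) hY.ne', log_pow, log_exp] at h4
    unfold Lam lgz Ak Bl
    linarith
  rw [this]; exact ⟨h1, h2⟩

end PartQ1

section PartQ2
open Real

lemma exp3 : 13 ≤ exp 3 := by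
  have h := exp_one_gt_d9
  have : exp 3 = exp 1 ^ 3 := by rw [← exp_nat_mul]; norm_num
  rw [this]
  refine le_trans (b := (2.7:ℝ)^3) (by norm_num) ?_
  gcongr; linarith

lemma sqrt5_phi : √5 = 2 * goldenRatio - 1 := by unfold goldenRatio; ring

lemma ux (k : ℕ) : ∃ u : KK, IsIntegral ℤ u ∧ sig0 u = ((√5 * exp (-Ak k) : ℝ) : ℂ) ∧
    ∀ σ : KK →+* ℂ, ‖σ u‖ ≤ exp (3 + k * log rho) := by
  have hi : IsIntegral ℤ (2 * pK - 1 : KK) := by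
    rw [two_mul]; exact (int_pK.add int_pK).sub isIntegral_one
  have hb : ∀ σ : KK →+* ℂ, ‖σ (2 * pK - 1)‖ ≤ 4.3 := by
    intro σ
    rw [map_sub, map_mul, map_one, map_ofNat]
    refine (norm_sub_le _ _).trans ?_
    rw [norm_mul, norm_one]
    have := (sig_p σ).1
    have h2 : ‖(2:ℂ)‖ = 2 := by norm_num
    rw [h2]; linarith [phi_bd.2]
  have e3 := exp3
  rcases Nat.eq_zero_or_pos k with rfl | hk
  · refine ⟨2 * pK - 1, hi, ?_, ?_⟩
    · rw [Ak_zero, map_sub, map_mul, map_one, map_ofNat, sig0_p, sqrt5_phi]; simp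
    · intro σ
      refine (hb σ).trans ?_
      simp; linarith
  · refine ⟨(2 * pK - 1) * (1 - rK⁻¹ ^ k), hi.mul (isIntegral_one.sub (int_rK_inv.pow k)), ?_, ?_⟩
    · rw [Ak, neg_neg, exp_log (Xpos k hk), sqrt5_phi]
      rw [map_mul, map_sub, map_sub, map_mul, map_one, map_ofNat, sig0_p, map_pow, map_inv₀, sig0_r]; push_cast; ring
    · intro σ
      rw [map_mul, norm_mul]
      have h1 := hb σ
      have h2 : ‖σ (1 - rK⁻¹ ^ k)‖ ≤ 2 * exp (k * log rho) := by
        rw [map_sub, map_one, map_pow, map_inv₀]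
        refine (norm_sub_le _ _).trans ?_
        rw [norm_one, norm_pow, exp_nat_mul, exp_log rho_pos]
        have h3 := pow_le_pow_left₀ (norm_nonneg _) (sig_r σ).2 k
        have h4 : 1 ≤ rho ^ k := one_le_pow₀ one_lt_rho.le
        linarith
      rw [exp_add]
      calc ‖σ (2 * pK - 1)‖ * ‖σ (1 - rK⁻¹ ^ k)‖ ≤ 4.3 * (2 * exp (k * log rho)) := by gcongr
        _ = 8.6 * exp (k * log rho) := by ring
        _ ≤ _ := by gcongr; linarith

lemma wx (k : ℕ) : ∃ u : KK, IsIntegral ℤ u ∧ sig0 u = (((3 * rho ^ 2 - 1) * exp (-Bl k) : ℝ) : ℂ) ∧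
    ∀ σ : KK →+* ℂ, ‖σ u‖ ≤ exp (3 + k * log goldenRatio) := by
  have hi : IsIntegral ℤ (3 * rK ^ 2 - 1 : KK) := by
    have : (3 * rK ^ 2 - 1 : KK) = rK ^ 2 + rK ^ 2 + rK ^ 2 - 1 := by ring
    rw [this]
    exact (((int_rK.pow 2).add (int_rK.pow 2)).add (int_rK.pow 2)).sub isIntegral_one
  have hb : ∀ σ : KK →+* ℂ, ‖σ (3 * rK ^ 2 - 1)‖ ≤ 6.3 := by
    intro σ
    rw [map_sub, map_mul, map_one, map_ofNat, map_pow]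
    refine (norm_sub_le _ _).trans ?_
    rw [norm_mul, norm_one, norm_pow]
    have := pow_le_pow_left₀ (norm_nonneg _) (sig_r σ).1 2
    have h2 : ‖(3:ℂ)‖ = 3 := by norm_num
    rw [h2]; linarith [den_bd.2]
  have e3 := exp3
  rcases Nat.eq_zero_or_pos k with rfl | hk
  · refine ⟨3 * rK ^ 2 - 1, hi, ?_, ?_⟩
    · rw [Bl_zero, map_sub, map_mul, map_one, map_ofNat, map_pow, sig0_r]; simp
    · intro σ
      refine (hb σ).trans ?_
      simp; linarith
  · refine ⟨(3 * rK ^ 2 - 1) * (1 - pK⁻¹ ^ k), hi.mul (isIntegral_one.sub (int_pK_inv.pow k)), ?_, ?_⟩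
    · rw [Bl, neg_neg, exp_log (Ypos k hk)]
      rw [map_mul, map_sub, map_sub, map_mul, map_one, map_ofNat, map_pow, map_pow, map_inv₀, sig0_r, sig0_p]; push_cast; ring
    · intro σ
      rw [map_mul, norm_mul]
      have h1 := hb σ
      have h2 : ‖σ (1 - pK⁻¹ ^ k)‖ ≤ 2 * exp (k * log goldenRatio) := by
        rw [map_sub, map_one, map_pow, map_inv₀]
        refine (norm_sub_le _ _).trans ?_
        rw [norm_one, norm_pow, exp_nat_mul, exp_log goldenRatio_pos]
        have h3 := pow_le_pow_left₀ (norm_nonneg _) (sig_p σ).2 k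
        have h4 : 1 ≤ goldenRatio ^ k := one_le_pow₀ one_lt_goldenRatio.le
        linarith
      rw [exp_add]
      calc ‖σ (3 * rK ^ 2 - 1)‖ * ‖σ (1 - pK⁻¹ ^ k)‖ ≤ 6.3 * (2 * exp (k * log goldenRatio)) := by gcongr
        _ = 12.6 * exp (k * log goldenRatio) := by ring
        _ ≤ _ := by gcongr; linarith

lemma log_rho_bd : 0.2811 < log rho ∧ log rho < 0.2813 := by
  have h1 := al_le; have h2 := le_al
  have hD := D0_posR
  have c1 : 2811 * D0 < 10000 * al := by decide +kernel
  have c2 : 10000 * (al + 2 ^ 14) < 2813 * D0 := by decide +kernel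
  have c1r : (2811 : ℝ) * D0 < 10000 * al := by exact_mod_cast c1
  have c2r : (10000 : ℝ) * (al + 2 ^ 14) < 2813 * D0 := by exact_mod_cast c2
  constructor
  · by_contra hc; push Not at hc
    have := mul_le_mul_of_nonneg_left hc hD.le
    linarith
  · by_contra hc; push Not at hc
    have := mul_le_mul_of_nonneg_left hc hD.le
    linarith

lemma log_phi_bd : 0.4812 < log goldenRatio ∧ log goldenRatio < 0.4813 := by
  have h1 := fl_le; have h2 := le_fl
  have hD := D0_posR
  have c1 : 4812 * D0 < 10000 * fl := by decide +kernel
  have c2 : 10000 * (fl + 2 ^ 14) < 4813 * D0 := by decide +kernel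
  have c1r : (4812 : ℝ) * D0 < 10000 * fl := by exact_mod_cast c1
  have c2r : (10000 : ℝ) * (fl + 2 ^ 14) < 4813 * D0 := by exact_mod_cast c2
  constructor
  · by_contra hc; push Not at hc
    have := mul_le_mul_of_nonneg_left hc hD.le
    linarith
  · by_contra hc; push Not at hc
    have := mul_le_mul_of_nonneg_left hc hD.le
    linarith

lemma eps_bd (q1 q2 E1 E2 S : ℕ) (h1 : E1 * D0 + S * (q2 * (fl + 2 ^ 14)) ≤ S * (q1 * al))
    (h2 : S * (q1 * (al + 2 ^ 14)) ≤ E2 * D0 + S * (q2 * fl)) :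
    (E1 : ℝ) ≤ S * (q1 * log rho - q2 * log goldenRatio) ∧
    S * (q1 * log rho - q2 * log goldenRatio) ≤ (E2 : ℝ) := by
  have a1 := al_le; have a2 := le_al
  have f1 := fl_le; have f2 := le_fl
  have hD := D0_posR
  have c1 := (Nat.cast_le (α := ℝ)).2 h1
  have c2 := (Nat.cast_le (α := ℝ)).2 h2
  push_cast at c1 c2
  have b1 : (S : ℝ) * (q2 * (D0 * log goldenRatio)) ≤ S * (q2 * (fl + 2 ^ 14)) := by gcongr
  have b2 : (S : ℝ) * (q1 * al) ≤ S * (q1 * (D0 * log rho)) := by gcongr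
  have b3 : (S : ℝ) * (q2 * fl) ≤ S * (q2 * (D0 * log goldenRatio)) := by gcongr
  have b4 : (S : ℝ) * (q1 * (D0 * log rho)) ≤ S * (q1 * (al + 2 ^ 14)) := by gcongr
  constructor
  · refine le_of_mul_le_mul_right ?_ hD
    linarith
  · refine le_of_mul_le_mul_right ?_ hD
    linarith

theorem stageV (q1 q2 L' g j m' n k l : ℕ) (e1 e2 T s : ℝ) (hq1 : 0 < q1)
    (he1 : 0 < e1) (he2 : e2 ≤ 1)
    (hlo : e1 ≤ q1 * log rho - q2 * log goldenRatio) (hhi : q1 * log rho - q2 * log goldenRatio ≤ e2)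
    (hj : 1 ≤ e1 * 2 ^ j) (hL : 15 * (1.02 + 0.6931471808 * (j : ℝ)) ≤ L')
    (hg : 34 * (q1 * 0.2813) ≤ (g : ℝ)) (hr1 : 80 * (L' * e2) ≤ 1)
    (hm100 : 100 * q1 ≤ m') (hr2 : 2 * (L' + 1) * q1 ≤ m') (hrε : q1 ≤ 0.99 * (m' * e1))
    (hkT : k * log rho ≤ T) (hlT : l * log goldenRatio ≤ T)
    (hbig : (T + 2 * (q1 * 0.2813) + 8) * q1 ≤ 0.3267 * (m' * e1))
    (hΛ1 : |Lam m' n k l| ≤ 1)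
    (hs : 125 * g * L' ^ 2 * (m' * e2) ≤ s * q1)
    (hΛ : |Lam m' n k l| ≤ exp (-s)) : False := by
  obtain ⟨u, hui, hu0, huH⟩ := ux k
  obtain ⟨w, hwi, hw0, hwH⟩ := wx l
  have hla := log_rho_bd
  have hlf := log_phi_bd
  have hq : (0 : ℝ) < q1 := by exact_mod_cast hq1
  have h5 := sqrt5_bd
  have hd := den_bd
  have hT : 0 ≤ T := le_trans (by have := hla.1; positivity) hkT
  have hrle : ((m' / q1 : ℕ) : ℝ) * q1 ≤ m' := by exact_mod_cast Nat.div_mul_le_self m' q1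
  have hrge : 0.99 * (m' : ℝ) ≤ ((m' / q1 : ℕ) : ℝ) * q1 := by
    have h1 := real_le_natdiv m' q1 hq1
    rw [div_le_iff₀ hq] at h1
    have h2 : (100 : ℝ) * q1 ≤ m' := by exact_mod_cast hm100
    linarith
  set ε := q1 * log rho - q2 * log goldenRatio with hε
  have hε0 : 0 < ε := by linarith
  have hrε0 : 0.99 * (m' * e1) ≤ ((m' / q1 : ℕ) : ℝ) * ε * q1 := by
    calc 0.99 * (m' * e1) = (0.99 * m') * e1 := by ring
      _ ≤ (((m' / q1 : ℕ) : ℝ) * q1) * ε := by gcongr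
      _ = _ := by ring
  refine stage q1 q2 L' g m' n ε (q1 * log rho) (3 + T) 4 (Lam m' n k l) (√5 * exp (-Ak k))
    ((3 * rho ^ 2 - 1) * exp (-Bl l)) u w hq1 rfl hε hε0 (by linarith) ?_ ?_ ?_ hui hwi hu0 hw0 ?_ ?_ (by linarith) ?_ ?_ ?_ hΛ1 ?_ ?_ ?_ ?_ ?_ ?_
  · have h1 : log (1 / ε) ≤ j * log 2 := by
      rw [← log_pow]
      apply log_le_log (by positivity)
      rw [div_le_iff₀ hε0]
      refine hj.trans ?_
      rw [mul_comm]; gcongr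
    have h2 := log_two_lt_d9
    have h3 : (j : ℝ) * log 2 ≤ j * 0.6931471808 := by gcongr
    linarith
  · have : (0 : ℝ) < g := lt_of_lt_of_le (by positivity) hg
    exact_mod_cast this
  · refine le_trans ?_ hg
    gcongr; exact hla.2.le
  · positivity
  · apply mul_pos (by linarith) (exp_pos _)
  · intro σ; refine (huH σ).trans ?_
    gcongr
  · intro σ; refine (hwH σ).trans ?_
    gcongr
  · rw [log_div (by positivity) (mul_pos (by linarith) (exp_pos _)).ne', log_mul (by positivity) (exp_pos _).ne', log_mul (by linarith) (exp_pos _).ne', log_exp, log_exp]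
    have h1 := lgz_bd
    unfold lgz at h1
    have h2 := Ak_bd k; have h3 := Ak_le k; have h4 := Bl_bd l; have h6 := Bl_le l
    have h7 : Ak k ≤ 3 := by
      rcases Nat.eq_zero_or_pos k with rfl | hk
      · rw [Ak_zero]; norm_num
      · have h1 : rho⁻¹ ^ k ≤ rho⁻¹ ^ 1 := pow_le_pow_of_le_one rho_inv_pos.le rho_inv_lt.le hk
        have hX := Xpos k hk
        rw [pow_one] at h1
        rw [Ak, neg_le, le_log_iff_exp_le hX]
        have h8 : exp (-3) ≤ 1 / 13 := by
          rw [exp_neg, ← one_div]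
          exact one_div_le_one_div_of_le (by norm_num) exp3
        linarith [rho_inv_bd]
    rw [abs_le]; constructor <;> linarith
  · have h1 : √5 * exp (-Ak k) * rho ^ m' = exp (log √5 - Ak k + m' * log rho) := by
      rw [exp_add, sub_eq_add_neg, exp_add, exp_log (by linarith), exp_nat_mul, exp_log rho_pos]
    have h2 : (3 * rho ^ 2 - 1) * exp (-Bl l) * goldenRatio ^ n * exp (Lam m' n k l) =
        exp (log (3 * rho ^ 2 - 1) - Bl l + n * log goldenRatio + Lam m' n k l) := by
      rw [exp_add, exp_add, sub_eq_add_neg (log _) (Bl l), exp_add, exp_log (by linarith), exp_nat_mul, exp_log goldenRatio_pos]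
    rw [h1, h2]
    congr 1
    unfold Lam lgz; ring
  · refine le_of_mul_le_mul_right ?_ hq
    have h1 : (3 + T + 2 * (q1 * log rho) + 4 + 1) * q1 ≤ (T + 2 * (q1 * 0.2813) + 8) * q1 := by
      have h2 : (q1 : ℝ) * log rho ≤ q1 * 0.2813 := by gcongr; exact hla.2.le
      gcongr ?_ * _
      linarith
    linarith
  · have : (L' : ℝ) * ε ≤ L' * e2 := by gcongr
    linarith
  · rw [Nat.le_div_iff_mul_le hq1]; exact hr2
  · refine le_of_mul_le_mul_right ?_ hq
    linarith
  · refine hΛ.trans ?_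
    rw [exp_le_exp, neg_le_neg_iff]
    refine le_of_mul_le_mul_right ?_ hq
    refine le_trans ?_ hs
    calc 125 * g * L' ^ 2 * ((m' / q1 : ℕ) * ε) * q1 = 125 * g * L' ^ 2 * (((m' / q1 : ℕ) * q1) * ε) := by ring
      _ ≤ _ := by gcongr

end PartQ2

section PartQ3
open Real

lemma st3 (m' n k l : ℕ) (T : ℝ) (hM : (10:ℝ) ^ 188 ≤ m') (hkT : k * log rho ≤ T) (hlT : l * log goldenRatio ≤ T)
    (hΛ : |Lam m' n k l| ≤ exp (-(0.28 * m'))) : 0.00000000000000008 * m' < T := by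
  by_contra hc
  push Not at hc
  have hE := eps_bd 7162036 4185187 1797722 1797723 1000000000000000 (by decide +kernel) (by decide +kernel)
  have hMn : 10 ^ 188 ≤ m' := by exact_mod_cast hM
  have hs : (125:ℝ) * (68499145 : ℕ) * (328 : ℕ) ^ 2 * (1797723 / 1000000000000000) ≤ 0.28 * (7162036 : ℕ) := by norm_num
  have hs' := mul_le_mul_of_nonneg_right hs (Nat.cast_nonneg (α := ℝ) m')
  refine stageV 7162036 4185187 328 68499145 30 m' n k l (1797722 / 1000000000000000) (1797723 / 1000000000000000) T (0.28 * m') (by norm_num) (by norm_num) (by norm_num)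
    ?_ ?_ (by norm_num) (by norm_num) (by norm_num) (by norm_num) ?_ ?_ ?_ hkT hlT ?_ ?_ ?_ hΛ
  · rw [div_le_iff₀ (by norm_num)]; push_cast at hE ⊢; linarith [hE.1]
  · rw [le_div_iff₀ (by norm_num)]; push_cast at hE ⊢; linarith [hE.2]
  · refine le_trans ?_ hMn; norm_num
  · refine le_trans ?_ hMn; norm_num
  · have : 0.99 * ((10:ℝ) ^ 188 * (1797722 / 1000000000000000)) ≤ 0.99 * ((m':ℝ) * (1797722 / 1000000000000000)) := by gcongr
    refine le_trans ?_ this; norm_num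
  · have h1 : (T + 2 * (((7162036 : ℕ) : ℝ) * 0.2813) + 8) * ((7162036 : ℕ) : ℝ) ≤ (0.00000000000000008 * m' + 2 * (((7162036 : ℕ) : ℝ) * 0.2813) + 8) * ((7162036 : ℕ) : ℝ) := by gcongr
    refine h1.trans ?_
    push_cast
    linarith
  · refine hΛ.trans (exp_le_one_iff.2 ?_)
    have : (0:ℝ) ≤ 0.28 * m' := by positivity
    linarith
  · calc _ = _ := by ring
      _ ≤ _ := hs'
      _ = _ := by ring

lemma st2 (m' n k l : ℕ) (T : ℝ) (hM : (10:ℝ) ^ 188 ≤ m') (hkT : k * log rho ≤ T) (hlT : l * log goldenRatio ≤ T)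
    (hΛ : |Lam m' n k l| ≤ exp (-(0.00000000000000007 * m'))) : 0.00000000000000000000000000000000000000000000000000004 * m' < T := by
  by_contra hc
  push Not at hc
  have hE := eps_bd 17324910788600725507006519 10123935625094815120354071 2176689 2176690 1000000000000000000000000000000000 (by decide +kernel) (by decide +kernel)
  have hMn : 10 ^ 188 ≤ m' := by exact_mod_cast hM
  have hs : (125:ℝ) * (165698911764335058894111750 : ℕ) * (941 : ℕ) ^ 2 * (2176690 / 1000000000000000000000000000000000) ≤ 0.00000000000000007 * (17324910788600725507006519 : ℕ) := by norm_num
  have hs' := mul_le_mul_of_nonneg_right hs (Nat.cast_nonneg (α := ℝ) m')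
  refine stageV 17324910788600725507006519 10123935625094815120354071 941 165698911764335058894111750 89 m' n k l (2176689 / 1000000000000000000000000000000000) (2176690 / 1000000000000000000000000000000000) T (0.00000000000000007 * m') (by norm_num) (by norm_num) (by norm_num)
    ?_ ?_ (by norm_num) (by norm_num) (by norm_num) (by norm_num) ?_ ?_ ?_ hkT hlT ?_ ?_ ?_ hΛ
  · rw [div_le_iff₀ (by norm_num)]; push_cast at hE ⊢; linarith [hE.1]
  · rw [le_div_iff₀ (by norm_num)]; push_cast at hE ⊢; linarith [hE.2]
  · refine le_trans ?_ hMn; norm_num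
  · refine le_trans ?_ hMn; norm_num
  · have : 0.99 * ((10:ℝ) ^ 188 * (2176689 / 1000000000000000000000000000000000)) ≤ 0.99 * ((m':ℝ) * (2176689 / 1000000000000000000000000000000000)) := by gcongr
    refine le_trans ?_ this; norm_num
  · have h1 : (T + 2 * (((17324910788600725507006519 : ℕ) : ℝ) * 0.2813) + 8) * ((17324910788600725507006519 : ℕ) : ℝ) ≤ (0.00000000000000000000000000000000000000000000000000004 * m' + 2 * (((17324910788600725507006519 : ℕ) : ℝ) * 0.2813) + 8) * ((17324910788600725507006519 : ℕ) : ℝ) := by gcongr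
    refine h1.trans ?_
    push_cast
    linarith
  · refine hΛ.trans (exp_le_one_iff.2 ?_)
    have : (0:ℝ) ≤ 0.00000000000000007 * m' := by positivity
    linarith
  · calc _ = _ := by ring
      _ ≤ _ := hs'
      _ = _ := by ring

lemma st1 (m' n k l : ℕ) (T : ℝ) (hM : (10:ℝ) ^ 188 ≤ m') (hkT : k * log rho ≤ T) (hlT : l * log goldenRatio ≤ T)
    (hΛ : |Lam m' n k l| ≤ exp (-(0.00000000000000000000000000000000000000000000000000003 * m'))) : 0 < T := by
  by_contra hc
  push Not at hc
  have hE := eps_bd 128426005483080664960822672806109229623577444542245541161760163 75046655533387209827264545781314009422716107994777207307418616 2098504 2098505 1000000000000000000000000000000000000000000000000000000000000000000000 (by decide +kernel) (by decide +kernel)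
  have hMn : 10 ^ 188 ≤ m' := by exact_mod_cast hM
  have hs : (125:ℝ) * (1228292001641280095818300207252189893965819395090944804779306551 : ℕ) * (2189 : ℕ) ^ 2 * (2098505 / 1000000000000000000000000000000000000000000000000000000000000000000000) ≤ 0.00000000000000000000000000000000000000000000000000003 * (128426005483080664960822672806109229623577444542245541161760163 : ℕ) := by norm_num
  have hs' := mul_le_mul_of_nonneg_right hs (Nat.cast_nonneg (α := ℝ) m')
  refine stageV 128426005483080664960822672806109229623577444542245541161760163 75046655533387209827264545781314009422716107994777207307418616 2189 1228292001641280095818300207252189893965819395090944804779306551 209 m' n k l (2098504 / 1000000000000000000000000000000000000000000000000000000000000000000000) (2098505 / 1000000000000000000000000000000000000000000000000000000000000000000000) T (0.00000000000000000000000000000000000000000000000000003 * m') (by norm_num) (by norm_num) (by norm_num)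
    ?_ ?_ (by norm_num) (by norm_num) (by norm_num) (by norm_num) ?_ ?_ ?_ hkT hlT ?_ ?_ ?_ hΛ
  · rw [div_le_iff₀ (by norm_num)]; push_cast at hE ⊢; linarith [hE.1]
  · rw [le_div_iff₀ (by norm_num)]; push_cast at hE ⊢; linarith [hE.2]
  · refine le_trans ?_ hMn; norm_num
  · refine le_trans ?_ hMn; norm_num
  · have : 0.99 * ((10:ℝ) ^ 188 * (2098504 / 1000000000000000000000000000000000000000000000000000000000000000000000)) ≤ 0.99 * ((m':ℝ) * (2098504 / 1000000000000000000000000000000000000000000000000000000000000000000000)) := by gcongr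
    refine le_trans ?_ this; norm_num
  · have h1 : (T + 2 * (((128426005483080664960822672806109229623577444542245541161760163 : ℕ) : ℝ) * 0.2813) + 8) * ((128426005483080664960822672806109229623577444542245541161760163 : ℕ) : ℝ) ≤ (0 + 2 * (((128426005483080664960822672806109229623577444542245541161760163 : ℕ) : ℝ) * 0.2813) + 8) * ((128426005483080664960822672806109229623577444542245541161760163 : ℕ) : ℝ) := by gcongr
    refine h1.trans ?_
    push_cast
    linarith
  · refine hΛ.trans (exp_le_one_iff.2 ?_)
    have : (0:ℝ) ≤ 0.00000000000000000000000000000000000000000000000000003 * m' := by positivity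
    linarith
  · calc _ = _ := by ring
      _ ≤ _ := hs'
      _ = _ := by ring


lemma phi_inv_exp (n : ℕ) : goldenRatio⁻¹ ^ n = exp (-(n * log goldenRatio)) := by
  rw [exp_neg, exp_nat_mul, exp_log goldenRatio_pos, inv_pow]
lemma rho_inv_exp (n : ℕ) : rho⁻¹ ^ n = exp (-(n * log rho)) := by
  rw [exp_neg, exp_nat_mul, exp_log rho_pos, inv_pow]

lemma exp4 : 26 ≤ exp 4 := by
  have : exp 4 = exp 3 * exp 1 := by rw [← exp_add]; norm_num
  have h1 := exp3
  have h2 := add_one_le_exp (1:ℝ)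
  rw [this]; nlinarith

lemma exp_three (x y z s : ℝ) (hx : x ≤ s - 2) (hy : y ≤ s - 2) (hz : z ≤ s - 2) : exp x + exp y + exp z ≤ exp s := by
  have h1 : exp x ≤ exp (s - 2) := exp_le_exp.2 hx
  have h2 : exp y ≤ exp (s - 2) := exp_le_exp.2 hy
  have h3 : exp z ≤ exp (s - 2) := exp_le_exp.2 hz
  have h4 : exp s = exp (s - 2) * exp 2 := by rw [← exp_add]; ring_nf
  have h5 := add_one_le_exp (2:ℝ)
  nlinarith [exp_pos (s-2)]

lemma nf_ge (m' n k l : ℕ) (h1 : |Lam m' n k l| ≤ 1) :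
    m' * log rho - 6 ≤ n * log goldenRatio ∧ n * log goldenRatio ≤ m' * log rho + 3 := by
  have := abs_le.1 h1
  have a1 := Ak_bd k; have a2 := Ak_le k; have b1 := Bl_bd l; have b2 := Bl_le l
  have l1 := lgz_bd
  unfold Lam at this
  constructor <;> linarith

lemma Ak_exp (k : ℕ) : Ak k ≤ exp (4 - k * log rho) := by
  refine (Ak_bd k).2.trans ?_
  rw [rho_inv_exp, sub_eq_add_neg, exp_add]
  gcongr; linarith [exp4]
lemma Bl_exp (k : ℕ) : Bl k ≤ exp (4 - k * log goldenRatio) := by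
  refine (Bl_bd k).2.trans ?_
  rw [phi_inv_exp, sub_eq_add_neg, exp_add]
  gcongr; linarith [exp4]
lemma Lam_exp (m' n k l : ℕ) (h1 : |Lam m' n k l| ≤ 1) (h2 : |Lam m' n k l| ≤ 24 * goldenRatio⁻¹ ^ n) :
    |Lam m' n k l| ≤ exp (10 - m' * log rho) := by
  refine h2.trans ?_
  have := (nf_ge m' n k l h1).1
  rw [phi_inv_exp]
  calc 24 * exp (-(n * log goldenRatio)) ≤ exp 4 * exp (-(n * log goldenRatio)) := by gcongr; linarith [exp4]
    _ = exp (4 - n * log goldenRatio) := by rw [← exp_add]; ring_nf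
    _ ≤ _ := by rw [exp_le_exp]; linarith

lemma Lam_k0 (m' n k l : ℕ) : |Lam m' n 0 l| ≤ |Lam m' n k l| + Ak k := by
  have : Lam m' n 0 l = Lam m' n k l + Ak k := by unfold Lam; rw [Ak_zero]; ring
  rw [this]
  refine (abs_add_le _ _).trans ?_
  rw [abs_of_nonneg (Ak_bd k).1]
lemma Lam_l0 (m' n k l : ℕ) : |Lam m' n k 0| ≤ |Lam m' n k l| + Bl l := by
  have : Lam m' n k 0 = Lam m' n k l + -Bl l := by unfold Lam; rw [Bl_zero]; ring
  rw [this]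
  refine (abs_add_le _ _).trans ?_
  rw [abs_neg, abs_of_nonneg (Bl_bd l).1]

theorem big_bound (m' n k l : ℕ) (h1 : |Lam m' n k l| ≤ 1) (h2 : |Lam m' n k l| ≤ 24 * goldenRatio⁻¹ ^ n) :
    (m' : ℝ) < 10 ^ 188 := by
  by_contra hM
  push Not at hM
  have hla := log_rho_bd
  have hL := Lam_exp m' n k l h1 h2
  have hM' : (10:ℝ) ^ 60 ≤ m' := le_trans (by norm_num) hM
  have hma : 0.2811 * (m' : ℝ) ≤ m' * log rho := by nlinarith
  have hka := Ak_exp k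
  have hlb := Bl_exp l
  have h3 := st3 m' n k l (max (k * log rho) (l * log goldenRatio)) hM (le_max_left _ _) (le_max_right _ _)
    (hL.trans (exp_le_exp.2 (by linarith)))
  have hboth : 0.00000000000000000000000000000000000000000000000000004 * (m':ℝ) < k * log rho ∧ 0.00000000000000000000000000000000000000000000000000004 * (m':ℝ) < l * log goldenRatio := by
    rcases lt_max_iff.1 h3 with h | h
    · refine ⟨by linarith, ?_⟩
      apply st2 m' n 0 l _ hM (by have := log_phi_bd.1; simp; positivity) le_rfl
      refine ((Lam_k0 m' n k l).trans (add_le_add hL hka)).trans ?_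
      refine le_trans ?_ (exp_three (10 - m' * log rho) (4 - k * log rho) (4 - k * log rho) _ ?_ ?_ ?_)
      · linarith [exp_pos (4 - k * log rho)]
      all_goals linarith
    · refine ⟨?_, by linarith⟩
      apply st2 m' n k 0 _ hM le_rfl (by have := log_rho_bd.1; simp; positivity)
      refine ((Lam_l0 m' n k l).trans (add_le_add hL hlb)).trans ?_
      refine le_trans ?_ (exp_three (10 - m' * log rho) (4 - l * log goldenRatio) (4 - l * log goldenRatio) _ ?_ ?_ ?_)
      · linarith [exp_pos (4 - l * log goldenRatio)]
      all_goals linarith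
  have h4 := st1 m' n 0 0 0 hM (by simp) (by simp) (by
    refine ((Lam_k0 m' n k 0).trans (add_le_add ((Lam_l0 m' n k l).trans (add_le_add hL hlb)) hka)).trans ?_
    apply exp_three <;> linarith [hboth.1, hboth.2])
  exact lt_irrefl _ h4

end PartQ3

section PartQ4
open Real

/-- separate a list by parity, halving the entries -/
def splitP (l : List ℕ) : List ℕ → List ℕ → (List ℕ → List ℕ → Bool) → Bool :=
  List.rec (fun E O c => c E O) (fun x _ ih E O c =>
    force (Nat.div x 2) fun y => Nat.casesOn (Nat.mod x 2) (ih (y :: E) O c) (fun _ => ih E (y :: O) c)) l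

/-- certified disjointness of two lists of naturals -/
def disj (n : ℕ) : List ℕ → List ℕ → Bool :=
  Nat.rec (fun _ _ => false) (fun _ ih A B =>
    List.casesOn A true (fun _ _ => List.casesOn B true (fun _ _ =>
      splitP A [] [] fun E O => splitP B [] [] fun E' O' => Bool.casesOn (ih E E') false (ih O O')))) n

lemma splitP_spec (l : List ℕ) : ∀ (E O : List ℕ) (c : List ℕ → List ℕ → Bool), splitP l E O c = true →
    ∃ E' O', c E' O' = true ∧ (∀ x ∈ E, x ∈ E') ∧ (∀ x ∈ O, x ∈ O') ∧
      ∀ x ∈ l, (x % 2 = 0 → x / 2 ∈ E') ∧ (x % 2 ≠ 0 → x / 2 ∈ O') := by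
  induction l with
  | nil => intro E O c h; exact ⟨E, O, h, fun _ h => h, fun _ h => h, by simp⟩
  | cons x l ih =>
    intro E O c h
    have h' : (force (x / 2) fun y => (Nat.casesOn (x % 2) (splitP l (y :: E) O c) (fun _ => splitP l E (y :: O) c) : Bool)) = true := h
    rw [force_eq] at h'
    rcases hx : x % 2 with _ | j
    · rw [hx] at h'
      obtain ⟨E', O', h1, h2, h3, h4⟩ := ih _ _ _ h'
      refine ⟨E', O', h1, fun y hy => h2 y (List.mem_cons_of_mem _ hy), h3, ?_⟩
      intro y hy
      rcases List.mem_cons.1 hy with rfl | hy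
      · exact ⟨fun _ => h2 _ (List.mem_cons_self ..), fun h => absurd hx h⟩
      · exact h4 y hy
    · rw [hx] at h'
      obtain ⟨E', O', h1, h2, h3, h4⟩ := ih _ _ _ h'
      refine ⟨E', O', h1, h2, fun y hy => h3 y (List.mem_cons_of_mem _ hy), ?_⟩
      intro y hy
      rcases List.mem_cons.1 hy with rfl | hy
      · exact ⟨fun h => by omega, fun _ => h3 _ (List.mem_cons_self ..)⟩
      · exact h4 y hy

lemma disj_spec (n : ℕ) : ∀ A B : List ℕ, disj n A B = true → ∀ x ∈ A, x ∈ B → False := by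
  induction n with
  | zero => intro A B h; exact absurd h (by simp [disj])
  | succ n ih =>
    intro A B h x hA hB
    match A, B, h, hA, hB with
    | [], _, _, hA, _ => simp at hA
    | _, [], _, _, hB => simp at hB
    | a :: A, b :: B, h, hA, hB =>
      have h' : (splitP (a :: A) [] [] fun E O => splitP (b :: B) [] [] fun E' O' =>
        (Bool.casesOn (disj n E E') false (disj n O O') : Bool)) = true := h
      obtain ⟨E, O, h1, _, _, h2⟩ := splitP_spec _ _ _ _ h'
      obtain ⟨E', O', h3, _, _, h4⟩ := splitP_spec _ _ _ _ h1
      rcases hd : disj n E E' with _ | _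
      · rw [hd] at h3; exact absurd h3 (by simp)
      · rw [hd] at h3
        by_cases hx : x % 2 = 0
        · exact ih _ _ hd _ ((h2 x hA).1 hx) ((h4 x hB).1 hx)
        · exact ih _ _ h3 _ ((h2 x hA).2 hx) ((h4 x hB).2 hx)

/-- table generator (continuation passing): `n` steps starting with index `k` -/
def genT (D e qW Φ Xl Xu fu : ℕ) (pu : ℕ → List ℕ → List ℕ) (n : ℕ) :
    ℕ → ℕ → ℕ → List ℕ → (List ℕ → Bool) → Bool :=
  Nat.rec (fun _ _ _ acc c => c acc) (fun _ ih k xl xu acc c =>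
    force (Nat.add (Nat.div fu k) 2) fun fuel =>
    force (lgLo D xl fuel 1 D 0) fun lo =>
    force (lgUp D xu fuel 1 D 0) fun hi =>
    Bool.casesOn (Nat.ble hi (Nat.add lo e)) false
      (Bool.casesOn (Nat.ble lo (Nat.mul 4 D)) false
        (Bool.casesOn (Nat.ble (Nat.succ xu) D) false
          (force (Nat.div (Nat.mul qW lo) Φ) fun F =>
            force (Nat.div (Nat.mul xl Xl) D) fun xl' =>
            force (Nat.succ (Nat.div (Nat.mul xu Xu) D)) fun xu' =>
            force (Nat.succ k) fun k' =>
              ih k' xl' xu' (pu F acc) c)))) n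

lemma resid_good (D e qW Φ lo : ℕ) (v f : ℝ) (hD : 0 < D) (hΦ : 0 < Φ) (hf1 : (Φ : ℝ) ≤ D * f) (hf2 : D * f ≤ Φ + 2)
    (hlo : (lo : ℝ) ≤ D * v) (hhi : D * v ≤ lo + e) (h4 : lo ≤ 4 * D) (hc1 : qW * e ≤ Φ) (hc2 : 8 * D * qW ≤ Φ * Φ) :
    |qW * v / f - ((qW * lo / Φ : ℕ) : ℝ)| ≤ 2 := by
  have hDr : (0:ℝ) < D := by exact_mod_cast hD
  have hΦr : (0:ℝ) < Φ := by exact_mod_cast hΦ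
  have hf : 0 < f := by
    by_contra h; push Not at h
    nlinarith
  have hy : qW * v / f = qW * (D * v) / (D * f) := by field_simp
  have h1 := natdiv_le_real (qW * lo) Φ
  have h2 := real_le_natdiv (qW * lo) Φ hΦ
  push_cast at h1 h2
  have hDf : 0 < D * f := by positivity
  have hDv : 0 ≤ D * v := (Nat.cast_nonneg lo).trans hlo
  have hqDv : 0 ≤ qW * (D * v) := mul_nonneg (Nat.cast_nonneg _) hDv
  rw [hy, abs_le]
  have up : qW * (D * v) / (D * f) ≤ (qW * lo : ℝ) / Φ + 1 := by
    have : (qW : ℝ) * (D * v) / (D * f) ≤ qW * (lo + e) / Φ := by gcongr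
    refine this.trans ?_
    have h3 : (qW : ℝ) * e ≤ Φ := by exact_mod_cast hc1
    rw [mul_add, add_div]
    have : (qW : ℝ) * e / Φ ≤ 1 := (div_le_one hΦr).2 h3
    linarith
  have dn : (qW * lo : ℝ) / Φ - 1 ≤ qW * (D * v) / (D * f) := by
    have h3 : (qW : ℝ) * lo / (Φ + 2) ≤ qW * (D * v) / (D * f) := by gcongr
    refine le_trans ?_ h3
    rw [le_div_iff₀ (by linarith), sub_mul, div_mul_eq_mul_div, mul_add, add_div, mul_div_cancel_right₀ _ hΦr.ne']
    have h5 : (qW : ℝ) * lo * 2 / Φ ≤ Φ := by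
      rw [div_le_iff₀ hΦr]
      have h6 : qW * lo * 2 ≤ Φ * Φ := by
        refine le_trans ?_ hc2
        calc qW * lo * 2 ≤ qW * (4 * D) * 2 := by gcongr
          _ = _ := by ring
      exact_mod_cast h6
    linarith
  constructor <;> linarith

lemma genT_spec (D e qW Φ Xl Xu fu : ℕ) (pu : ℕ → List ℕ → List ℕ) (x f : ℝ) (hD : 0 < D) (hΦ : 0 < Φ)
    (hf1 : (Φ : ℝ) ≤ D * f) (hf2 : D * f ≤ Φ + 2) (hx0 : 0 ≤ x) (hx1 : x < 1)
    (hXl : (Xl : ℝ) ≤ D * x) (hXu : D * x ≤ (Xu : ℝ)) (hc1 : qW * e ≤ Φ) (hc2 : 8 * D * qW ≤ Φ * Φ)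
    (hpu : ∀ F acc, ∀ y ∈ acc, y ∈ pu F acc) (n : ℕ) :
    ∀ (k xl xu : ℕ) (acc : List ℕ) (c : List ℕ → Bool), 0 < k → (xl : ℝ) ≤ D * x ^ k → D * x ^ k ≤ (xu : ℝ) →
      genT D e qW Φ Xl Xu fu pu n k xl xu acc c = true →
      ∃ acc', c acc' = true ∧ (∀ y ∈ acc, y ∈ acc') ∧ ∀ j, k ≤ j → j < k + n →
        ∃ F acc0, |qW * (-log (1 - x ^ j)) / f - (F : ℕ)| ≤ 2 ∧ ∀ y ∈ pu F acc0, y ∈ acc' := by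
  induction n with
  | zero =>
    intro k xl xu acc c _ _ _ h
    exact ⟨acc, h, fun _ h => h, fun j h1 h2 => by omega⟩
  | succ n ih =>
    intro k xl xu acc c hk hl hu h
    have h' : (force (fu / k + 2) fun fuel =>
      force (lgLo D xl fuel 1 D 0) fun lo =>
      force (lgUp D xu fuel 1 D 0) fun hi =>
      (Bool.casesOn (Nat.ble hi (lo + e)) false
        (Bool.casesOn (Nat.ble lo (4 * D)) false
        (Bool.casesOn (Nat.ble (xu + 1) D) false
          (force (qW * lo / Φ) fun F =>
            force (xl * Xl / D) fun xl' =>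
            force (xu * Xu / D + 1) fun xu' =>
            force (k + 1) fun k' =>
              genT D e qW Φ Xl Xu fu pu n k' xl' xu' (pu F acc) c))) : Bool)) = true := h
    simp only [force_eq] at h'
    set lo := lgLo D xl (fu / k + 2) 1 D 0 with hlo
    set hi := lgUp D xu (fu / k + 2) 1 D 0 with hhi
    rcases b1 : Nat.ble hi (lo + e) with _ | _
    · rw [b1] at h'; exact absurd h' (by simp)
    rcases b2 : Nat.ble lo (4 * D) with _ | _
    · rw [b1, b2] at h'; exact absurd h' (by simp)
    rcases b3 : Nat.ble (xu + 1) D with _ | _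
    · rw [b1, b2, b3] at h'; exact absurd h' (by simp)
    rw [b1, b2, b3] at h'
    have c1 := Nat.le_of_ble_eq_true b1
    have c2 := Nat.le_of_ble_eq_true b2
    have c3 : xu < D := Nat.le_of_ble_eq_true b3
    have hk0 : 0 ≤ x ^ k := pow_nonneg hx0 k
    have hk1 : x ^ k < 1 := pow_lt_one₀ hx0 hx1 hk.ne'
    have d1 := lgLo_le D xl hD (x ^ k) hk0 hk1 hl (fu / k + 2)
    have d2 := le_lgUp D xu hD c3 (x ^ k) hk0 hk1 hu (fu / k + 2)
    rw [← hlo] at d1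
    rw [← hhi] at d2
    have c1r : (hi : ℝ) ≤ lo + e := by exact_mod_cast c1
    have good := resid_good D e qW Φ lo (-log (1 - x ^ k)) f hD hΦ hf1 hf2 d1 (d2.trans c1r) c2 hc1 hc2
    obtain ⟨acc', g1, g2, g3⟩ := ih (k+1) (xl * Xl / D) (xu * Xu / D + 1) (pu (qW * lo / Φ) acc) c (by omega)
      (by rw [pow_succ]; exact fixmul_le _ _ _ hD _ _ hk0 hl hXl)
      (by rw [pow_succ]; exact le_fixmul _ _ _ hD _ _ hx0 hu hXu) h'
    refine ⟨acc', g1, fun y hy => g2 y (hpu _ _ y hy), fun j hj1 hj2 => ?_⟩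
    rcases Nat.eq_or_lt_of_le hj1 with rfl | hj
    · exact ⟨_, acc, good, g2⟩
    · exact g3 j hj (by omega)

end PartQ4

section PartQ5
open Real

def redCheck (D e qW Φ rXl rXu fXl fXu fuR fuF K L H N S t fuel : ℕ) : Bool :=
  genT D e qW Φ rXl rXu fuR (fun F acc => Nat.mod (Nat.div F H) N :: acc) K 1 rXl rXu [0] fun LA =>
    genT D e qW Φ fXl fXu fuF (fun F acc => Nat.mod (Nat.div (Nat.add F S) H) N :: Nat.mod (Nat.div (Nat.add (Nat.add F S) t) H) N :: acc) L 1 fXl fXu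
      [Nat.mod (Nat.div S H) N, Nat.mod (Nat.div (Nat.add S t) H) N] fun LB => disj fuel LA LB

lemma redCheck_spec (D e qW Φ rXl rXu fXl fXu fuR fuF K L H N S t fuel : ℕ) (hD : 0 < D) (hΦ : 0 < Φ)
    (hf1 : (Φ : ℝ) ≤ D * log goldenRatio) (hf2 : D * log goldenRatio ≤ Φ + 2)
    (hrXl : (rXl : ℝ) ≤ D * rho⁻¹) (hrXu : D * rho⁻¹ ≤ (rXu : ℝ))
    (hfXl : (fXl : ℝ) ≤ D * goldenRatio⁻¹) (hfXu : D * goldenRatio⁻¹ ≤ (fXu : ℝ))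
    (hc1 : qW * e ≤ Φ) (hc2 : 8 * D * qW ≤ Φ * Φ)
    (h : redCheck D e qW Φ rXl rXu fXl fXu fuR fuF K L H N S t fuel = true) (k l : ℕ) (hk : k ≤ K) (hl : l ≤ L) :
    ∃ FA FB : ℕ, |qW * Ak k / log goldenRatio - FA| ≤ 2 ∧ |qW * Bl l / log goldenRatio - FB| ≤ 2 ∧
      FA / H % N ≠ (FB + S) / H % N ∧ FA / H % N ≠ (FB + S + t) / H % N := by
  obtain ⟨LA, h1, h2, h3⟩ := genT_spec D e qW Φ rXl rXu fuR _ rho⁻¹ (log goldenRatio) hD hΦ hf1 hf2 rho_inv_pos.le rho_inv_lt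
    hrXl hrXu hc1 hc2 (fun F acc y hy => List.mem_cons_of_mem _ hy) K 1 rXl rXu _ _ one_pos
    (by rw [pow_one]; exact hrXl) (by rw [pow_one]; exact hrXu) h
  obtain ⟨LB, g1, g2, g3⟩ := genT_spec D e qW Φ fXl fXu fuF _ goldenRatio⁻¹ (log goldenRatio) hD hΦ hf1 hf2 phi_inv_pos.le phi_inv_lt
    hfXl hfXu hc1 hc2 (fun F acc y hy => List.mem_cons_of_mem _ (List.mem_cons_of_mem _ hy)) L 1 fXl fXu _ _ one_pos
    (by rw [pow_one]; exact hfXl) (by rw [pow_one]; exact hfXu) h1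
  have hd := disj_spec _ _ _ g1
  have hA : ∃ FA : ℕ, |qW * Ak k / log goldenRatio - FA| ≤ 2 ∧ FA / H % N ∈ LA := by
    rcases Nat.eq_zero_or_pos k with rfl | hk0
    · refine ⟨0, by rw [Ak_zero]; simp, ?_⟩
      simpa using h2 0 (by simp)
    · obtain ⟨F, acc0, a1, a2⟩ := h3 k hk0 (by omega)
      exact ⟨F, a1, a2 _ (List.mem_cons_self ..)⟩
  have hB : ∃ FB : ℕ, |qW * Bl l / log goldenRatio - FB| ≤ 2 ∧ (FB + S) / H % N ∈ LB ∧ (FB + S + t) / H % N ∈ LB := by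
    rcases Nat.eq_zero_or_pos l with rfl | hl0
    · refine ⟨0, by rw [Bl_zero]; simp, ?_, ?_⟩
      · rw [zero_add]; exact g2 _ (List.mem_cons_self ..)
      · rw [zero_add]; exact g2 _ (List.mem_cons_of_mem _ (List.mem_cons_self ..))
    · obtain ⟨F, acc0, a1, a2⟩ := g3 l hl0 (by omega)
      exact ⟨F, a1, a2 _ (List.mem_cons_self ..), a2 _ (List.mem_cons_of_mem _ (List.mem_cons_self ..))⟩
  obtain ⟨FA, a1, a2⟩ := hA
  obtain ⟨FB, b1, b2, b3⟩ := hB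
  exact ⟨FA, FB, a1, b1, fun he => hd _ a2 (he ▸ b2), fun he => hd _ a2 (he ▸ b3)⟩

lemma bucket (H N u s t FA z1 z2 : ℕ) (hst : s ≤ t) (htH : t < H)
    (h : FA + H * N * z1 = u + s + H * N * z2) : FA / H % N = u / H % N ∨ FA / H % N = (u + t) / H % N := by
  have hH : 0 < H := by omega
  have key : FA / H % N = (u + s) / H % N := by
    have h1 : (FA + H * N * z1) / H % N = FA / H % N := by
      rw [mul_assoc, Nat.add_mul_div_left _ _ hH, Nat.add_mul_mod_self_left]
    have h2 : (u + s + H * N * z2) / H % N = (u + s) / H % N := by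
      rw [mul_assoc, Nat.add_mul_div_left _ _ hH, Nat.add_mul_mod_self_left]
    rw [← h1, h, h2]
  have m1 : u / H ≤ (u + s) / H := Nat.div_le_div_right (by omega)
  have m2 : (u + s) / H ≤ (u + t) / H := Nat.div_le_div_right (by omega)
  have m3 : (u + t) / H ≤ u / H + 1 := by
    rw [← Nat.add_div_right _ hH]; exact Nat.div_le_div_right (by omega)
  rcases Nat.eq_or_lt_of_le m1 with e | e
  · left; rw [key, ← e]
  · right; rw [key]; congr 1; omega

noncomputable def Cx : ℝ := -log (1 - (1 - √5 / (3 - rho⁻¹ ^ 2)))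

lemma lgz_eq : lgz = -2 * log rho - Cx := by
  have h5 := sqrt5_bd
  have hd := den_bd
  have hr := rho_pos
  unfold Cx lgz
  have h1 : 3 * rho ^ 2 - 1 = rho ^ 2 * (3 - rho⁻¹ ^ 2) := by field_simp
  have h2 : 0 < 3 - rho⁻¹ ^ 2 := by
    have : 0 < rho ^ 2 * (3 - rho⁻¹ ^ 2) := by rw [← h1]; linarith
    exact (pos_iff_pos_of_mul_pos this).1 (by positivity)
  rw [h1, log_mul (by positivity) h2.ne', log_pow, sub_sub_cancel, log_div (by positivity) h2.ne']
  push_cast; ring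

theorem red (D e q p M Φ rXl rXu fXl fXu fuR fuF K L H N S c fuel FC : ℕ) (κ : ℝ) (hD : 0 < D) (hΦ : 0 < Φ)
    (hf1 : (Φ : ℝ) ≤ D * log goldenRatio) (hf2 : D * log goldenRatio ≤ Φ + 2)
    (hrXl : (rXl : ℝ) ≤ D * rho⁻¹) (hrXu : D * rho⁻¹ ≤ (rXu : ℝ))
    (hfXl : (fXl : ℝ) ≤ D * goldenRatio⁻¹) (hfXu : D * goldenRatio⁻¹ ≤ (fXu : ℝ))
    (hc1 : q * (H * N) * e ≤ Φ) (hc2 : 8 * D * (q * (H * N)) ≤ Φ * Φ)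
    (h : redCheck D e (q * (H * N)) Φ rXl rXu fXl fXu fuR fuF K L H N S (2 * c) fuel = true)
    (hFC : |((q * (H * N) : ℕ) : ℝ) * Cx / log goldenRatio - FC| ≤ 2)
    (hS : (S + FC + c) % (H * N) = 0) (hcH : 2 * c < H)
    (hκ : |q * log rho - p * log goldenRatio| ≤ κ)
    (m' n k l : ℕ) (hm2 : 2 ≤ m') (hmM : m' ≤ M) (hk : k ≤ K) (hl : l ≤ L) :
    ((c : ℝ) - 6) * log goldenRatio < (H * N : ℕ) * (q * |Lam m' n k l| + M * κ) := by
  by_contra hcon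
  push Not at hcon
  obtain ⟨FA, FB, hA, hB, hne1, hne2⟩ := redCheck_spec D e (q * (H * N)) Φ rXl rXu fXl fXu fuR fuF K L H N S (2 * c) fuel
    hD hΦ hf1 hf2 hrXl hrXu hfXl hfXu hc1 hc2 h k l hk hl
  obtain ⟨J, hJ⟩ := Nat.dvd_of_mod_eq_zero hS
  set W := H * N with hW
  have hf : 0 < log goldenRatio := log_pos one_lt_goldenRatio
  set f := log goldenRatio with hfdef
  set z : ℤ := m' * p - n * q - 2 * p with hz
  set ε := q * log rho - p * f with hε
  have hid : q * (Bl l - Ak k - Cx) + z * f = q * Lam m' n k l - ((m' : ℝ) - 2) * ε := by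
    rw [hε, hz]; unfold Lam; rw [lgz_eq, ← hfdef]; push_cast; ring
  have hbound : |q * (Bl l - Ak k - Cx) + z * f| ≤ q * |Lam m' n k l| + M * κ := by
    rw [hid]
    refine (abs_sub _ _).trans ?_
    rw [abs_mul, abs_mul, Nat.abs_cast]
    have h1 : |(m' : ℝ) - 2| ≤ M := by
      have : (2 : ℝ) ≤ m' := by exact_mod_cast hm2
      have : (m' : ℝ) ≤ M := by exact_mod_cast hmM
      rw [abs_of_nonneg (by linarith)]; linarith
    gcongr
  have hX : |((q * W : ℕ) : ℝ) * Bl l / f - (q * W : ℕ) * Ak k / f - (q * W : ℕ) * Cx / f + W * z| ≤ c - 6 := by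
    have e1 : ((q * W : ℕ) : ℝ) * Bl l / f - (q * W : ℕ) * Ak k / f - (q * W : ℕ) * Cx / f + W * z =
        W * (q * (Bl l - Ak k - Cx) + z * f) / f := by push_cast; field_simp
    rw [e1, abs_div, abs_of_pos hf, div_le_iff₀ hf, abs_mul, Nat.abs_cast]
    refine le_trans ?_ hcon
    gcongr
  have hZbd : |(FB : ℤ) - FA - FC + W * z| ≤ c := by
    have : |(FB : ℝ) - FA - FC + W * z| ≤ c := by
      rw [abs_le] at hA hB hFC hX ⊢
      constructor <;> linarith
    exact_mod_cast this
  rw [abs_le] at hZbd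
  -- FA = FB + S + s + W (z - J)
  obtain ⟨s, hs⟩ : ∃ s : ℕ, (s : ℤ) = c - ((FB : ℤ) - FA - FC + W * z) :=
    ⟨(c - ((FB : ℤ) - FA - FC + W * z)).toNat, Int.toNat_of_nonneg (by linarith)⟩
  have hs2 : s ≤ 2 * c := by
    have : (s : ℤ) ≤ 2 * c := by rw [hs]; linarith
    exact_mod_cast this
  have hJ' : (S : ℤ) + FC + c = W * J := by exact_mod_cast hJ
  obtain ⟨z1, z2, hzz⟩ : ∃ z1 z2 : ℕ, z - (J : ℤ) = (z2 : ℤ) - z1 :=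
    ⟨(-(z - J)).toNat, (z - J).toNat, by omega⟩
  have hfin : FA + W * z1 = (FB + S) + s + W * z2 := by
    have : (FA : ℤ) + W * z1 = (FB + S) + s + W * z2 := by
      rw [hs]
      linear_combination W * hzz - hJ'
    exact_mod_cast this
  rcases bucket H N (FB + S) s (2 * c) FA z1 z2 hs2 hcH hfin with h | h
  · exact hne1 h
  · exact hne2 h

end PartQ5

section PartQ6
open Real

@[irreducible] def D1 : ℕ := 2 ^ 800
@[irreducible] def T6 : ℕ := 2 ^ 600
@[irreducible] def fi1 : ℕ := fl / T6
@[irreducible] def rXl1 : ℕ := iL / T6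
@[irreducible] def rXu1 : ℕ := iU / T6 + 1
@[irreducible] def fXl1 : ℕ := jL / T6
@[irreducible] def fXu1 : ℕ := jU / T6 + 1

def qA : ℕ := 296256138537698907072305624054551881781268906501299860384635646059078540284438699787700022325545039942759127083378594577932644360399395991459669704635058030620963359448113048715139135508340744036013559
def pA : ℕ := 173119395054447866857161132477898983567975901166525577044517414988333694949839507514561111716235590787510414789426931249613065873463085401358936927254126318872247428381884375836743976736028729212289609
def qB : ℕ := 1070830520
def pB : ℕ := 625747479
def eA : ℕ := 2 ^ 88

lemma checkA : (force D1 fun D => force fi1 fun Φ => force rXl1 fun a => force rXu1 fun b => force fXl1 fun a' => force fXu1 fun b' =>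
    force (Nat.mul qA (2^18*2^22)) fun qW => force eA fun e => force (2^18) fun H => force (2^22) fun N => force (2*(2^17-1)) fun t =>
    redCheck D e qW Φ a b a' b' 1780 1040 1740 1010 H N 963368350804 t 30) = true := by decide +kernel

end PartQ6

section PartQ7
open Real

lemma D1_pos : 0 < D1 := by decide +kernel
lemma T6_pos : 0 < T6 := by decide +kernel
lemma D0_split : (D0 : ℝ) = D1 * T6 := by
  have h : D0 = D1 * T6 := by decide +kernel
  exact_mod_cast h
lemma T6_posR : (0 : ℝ) < T6 := by exact_mod_cast T6_pos
lemma D1_posR : (0 : ℝ) < D1 := by exact_mod_cast D1_pos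

lemma down_le (a : ℕ) (x : ℝ) (h : (a : ℝ) ≤ D0 * x) : ((a / T6 : ℕ) : ℝ) ≤ D1 * x := by
  refine (natdiv_le_real _ _).trans ?_
  rw [div_le_iff₀ T6_posR]
  rw [D0_split] at h
  linarith

lemma le_up (a : ℕ) (x : ℝ) (h : D0 * x ≤ (a : ℝ)) : D1 * x ≤ ((a / T6 + 1 : ℕ) : ℝ) := by
  push_cast
  refine le_trans ?_ (real_le_natdiv _ _ T6_pos)
  rw [le_div_iff₀ T6_posR]
  rw [D0_split] at h
  linarith

lemma fi1_le : (fi1 : ℝ) ≤ D1 * log goldenRatio := by rw [fi1]; exact down_le _ _ fl_le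
lemma le_fi1 : D1 * log goldenRatio ≤ fi1 + 2 := by
  have h := le_up (fl + 2 ^ 14) (log goldenRatio) (by rw [Nat.cast_add, Nat.cast_pow]; exact_mod_cast le_fl)
  have h2 : (fl + 2 ^ 14) / T6 + 1 ≤ fi1 + 2 := by decide +kernel
  refine h.trans ?_
  exact_mod_cast h2
lemma rXl1_le : (rXl1 : ℝ) ≤ D1 * rho⁻¹ := by rw [rXl1]; exact down_le _ _ iL_le
lemma le_rXu1 : D1 * rho⁻¹ ≤ (rXu1 : ℝ) := by rw [rXu1]; exact le_up _ _ le_iU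
lemma fXl1_le : (fXl1 : ℝ) ≤ D1 * goldenRatio⁻¹ := by rw [fXl1]; exact down_le _ _ jL_le
lemma le_fXu1 : D1 * goldenRatio⁻¹ ≤ (fXu1 : ℝ) := by rw [fXu1]; exact le_up _ _ le_jU

@[irreducible] def YU : ℕ := (2 * ff + 2 - D0) * D1 / (3 * D0 - i2U) + 1
@[irreducible] def YL : ℕ := (2 * ff - D0) * D1 / (3 * D0 - i2L)
@[irreducible] def XL : ℕ := D1 - YU
@[irreducible] def XU : ℕ := D1 - YL
@[irreducible] def cl : ℕ := lgLo D1 XL 230 1 D1 0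

lemma i2_bd : (i2L : ℝ) ≤ D0 * rho⁻¹ ^ 2 ∧ D0 * rho⁻¹ ^ 2 ≤ (i2U : ℝ) := by
  rw [i2L, i2U, pow_two]
  exact ⟨fixmul_le iL iL D0 D0_pos _ _ rho_inv_pos.le iL_le iL_le, le_fixmul iU iU D0 D0_pos _ _ rho_inv_pos.le le_iU le_iU⟩

lemma YL_le : (YL : ℝ) ≤ D1 * (√5 / (3 - rho⁻¹ ^ 2)) := by
  rw [YL]
  refine (natdiv_le_real _ _).trans ?_
  have h1 : D0 ≤ 2 * ff := by decide +kernel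
  have h2 : i2L < 3 * D0 := by decide +kernel
  have h2r : (i2L : ℝ) < 3 * D0 := by exact_mod_cast h2
  have hs : rho⁻¹ ^ 2 < 1 := pow_lt_one₀ rho_inv_pos.le rho_inv_lt (by norm_num)
  have hD := D0_posR; have hD1 := D1_posR
  rw [Nat.cast_mul, Nat.cast_sub h1, Nat.cast_sub h2.le, ← mul_div_assoc, div_le_div_iff₀ (by push_cast; linarith) (by linarith)]
  have a := ff_lt
  have b := i2_bd.1
  have h5 := sqrt5_phi
  have hp := one_lt_goldenRatio
  push_cast
  have e1 : (2 * (ff:ℝ) - D0) ≤ D0 * √5 := by rw [h5]; linarith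
  have e2 : D0 * (3 - rho⁻¹ ^ 2) ≤ 3 * D0 - i2L := by linarith
  have e3 : 0 ≤ √5 := sqrt_nonneg _
  calc (2 * (ff:ℝ) - D0) * D1 * (3 - rho⁻¹ ^ 2) ≤ (D0 * √5) * D1 * (3 - rho⁻¹ ^ 2) := by
        have : 0 ≤ 3 - rho⁻¹ ^ 2 := by linarith
        gcongr
    _ = D1 * √5 * (D0 * (3 - rho⁻¹ ^ 2)) := by ring
    _ ≤ _ := by gcongr

lemma le_YU : D1 * (√5 / (3 - rho⁻¹ ^ 2)) ≤ (YU : ℝ) := by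
  rw [YU]
  have h1 : D0 ≤ 2 * ff + 2 := by decide +kernel
  have h2 : i2U < 3 * D0 := by decide +kernel
  have h2r : (i2U : ℝ) < 3 * D0 := by exact_mod_cast h2
  have hpos : 0 < 3 * D0 - i2U := by omega
  rw [Nat.cast_add, Nat.cast_one]
  refine le_trans ?_ (real_le_natdiv _ _ hpos)
  have hs : rho⁻¹ ^ 2 < 1 := pow_lt_one₀ rho_inv_pos.le rho_inv_lt (by norm_num)
  have hD := D0_posR; have hD1 := D1_posR
  rw [Nat.cast_mul, Nat.cast_sub h1, Nat.cast_sub h2.le, ← mul_div_assoc, div_le_div_iff₀ (by linarith) (by push_cast; linarith)]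
  have a := lt_ff
  have b := i2_bd.2
  have h5 := sqrt5_phi
  push_cast
  have e1 : D0 * √5 ≤ (2 * (ff:ℝ) + 2 - D0) := by rw [h5]; linarith
  have e2 : 3 * D0 - i2U ≤ D0 * (3 - rho⁻¹ ^ 2) := by linarith
  have e3 : 0 ≤ √5 := sqrt_nonneg _
  calc D1 * √5 * (3 * D0 - i2U) ≤ D1 * √5 * (D0 * (3 - rho⁻¹ ^ 2)) := by gcongr
    _ = (D0 * √5) * D1 * (3 - rho⁻¹ ^ 2) := by ring
    _ ≤ _ := by
        have : 0 ≤ 3 - rho⁻¹ ^ 2 := by linarith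
        gcongr

lemma Cx_bd : (cl : ℝ) ≤ D1 * Cx ∧ D1 * Cx ≤ cl + eA := by
  have hD := D1_posR
  have hYU : YU ≤ D1 := by decide +kernel
  have hYL : YL ≤ D1 := by decide +kernel
  have hYL0 : 0 < YL := by decide +kernel
  set x := 1 - √5 / (3 - rho⁻¹ ^ 2) with hx
  have h1 := YL_le
  have h2 := le_YU
  have h3 : (YU : ℝ) ≤ D1 := by exact_mod_cast hYU
  have h4 : (0:ℝ) < YL := by exact_mod_cast hYL0
  have x0 : 0 ≤ x := by
    have : D1 * (√5 / (3 - rho⁻¹ ^ 2)) ≤ D1 * 1 := by linarith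
    have := le_of_mul_le_mul_left this hD
    linarith
  have x1 : x < 1 := by
    have : 0 < D1 * (√5 / (3 - rho⁻¹ ^ 2)) := by linarith
    have := (pos_iff_pos_of_mul_pos this).1 hD
    linarith
  have hl : (XL : ℝ) ≤ D1 * x := by
    rw [XL, Nat.cast_sub hYU, hx]; linarith
  have hu : D1 * x ≤ (XU : ℝ) := by
    rw [XU, Nat.cast_sub hYL, hx]; linarith
  unfold Cx
  rw [← hx]
  constructor
  · rw [cl]; exact lgLo_le D1 XL D1_pos x x0 x1 hl 230
  · have hlt : XU < D1 := by decide +kernel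
    have h : lgUp D1 XU 230 1 D1 0 ≤ cl + eA := by decide +kernel
    refine (le_lgUp D1 XU D1_pos hlt x x0 x1 hu 230).trans ?_
    exact_mod_cast h

lemma checkB : (force D1 fun D => force fi1 fun Φ => force rXl1 fun a => force rXu1 fun b => force fXl1 fun a' => force fXu1 fun b' =>
    force (Nat.mul qB (2^10*2^16)) fun qW => force eA fun e => force (2^10) fun H => force (2^16) fun N => force (2*(2^9-1)) fun t =>
    redCheck D e qW Φ a b a' b' 1780 1040 160 100 H N 14293004 t 30) = true := by decide +kernel

lemma redA (m' n k l : ℕ) (hm2 : 2 ≤ m') (hmM : m' ≤ 10 ^ 188) (hk : k ≤ 1740) (hl : l ≤ 1010) :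
    3 * (0.00000000000000000000000000000000000000000000000000000000000000000000000000000000000000000000000000000000000000000000000000000000000000000000000000000000000000000000000000000000000000000000000000000000000000006 : ℝ) < |Lam m' n k l| := by
  have hc := checkA
  simp only [force_eq] at hc
  have hΦ : 0 < fi1 := by decide +kernel
  have c1 : qA * (2 ^ 18 * 2 ^ 22) * eA ≤ fi1 := by decide +kernel
  have c2 : 8 * D1 * (qA * (2 ^ 18 * 2 ^ 22)) ≤ fi1 * fi1 := by decide +kernel
  have c4 : cl ≤ 4 * D1 := by decide +kernel
  have hFC := resid_good D1 eA (qA * (2 ^ 18 * 2 ^ 22)) fi1 cl Cx (log goldenRatio) D1_pos hΦ fi1_le le_fi1 Cx_bd.1 Cx_bd.2 c4 c1 c2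
  have hS : (963368350804 + qA * (2 ^ 18 * 2 ^ 22) * cl / fi1 + (2 ^ 17 - 1)) % (2 ^ 18 * 2 ^ 22) = 0 := by decide +kernel
  have hκ := eps_bd qA pA 1 2600 (10 ^ 207) (by decide +kernel) (by decide +kernel)
  have hκ' : |(qA : ℝ) * log rho - pA * log goldenRatio| ≤ 2600 / 10 ^ 207 := by
    push_cast at hκ
    rw [abs_of_nonneg (by nlinarith [hκ.1]), le_div_iff₀ (by positivity)]
    linarith [hκ.2]
  have := red D1 eA qA pA (10 ^ 188) fi1 rXl1 rXu1 fXl1 fXu1 1780 1040 1740 1010 (2 ^ 18) (2 ^ 22) 963368350804 (2 ^ 17 - 1) 30 _ _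
    D1_pos hΦ fi1_le le_fi1 rXl1_le le_rXu1 fXl1_le le_fXu1 c1 c2 hc hFC hS (by norm_num) hκ' m' n k l hm2 hmM hk hl
  have hf := log_phi_bd.1
  have hq : (qA : ℝ) ≤ 296300000000000000000000000000000000000000000000000000000000000000000000000000000000000000000000000000000000000000000000000000000000000000000000000000000000000000000000000000000000000000000000000000000 := by norm_num [qA]
  have hL := abs_nonneg (Lam m' n k l)
  by_contra hcon
  push Not at hcon
  have h1 : (qA : ℝ) * |Lam m' n k l| ≤ 296300000000000000000000000000000000000000000000000000000000000000000000000000000000000000000000000000000000000000000000000000000000000000000000000000000000000000000000000000000000000000000000000000000 * (3 * 0.00000000000000000000000000000000000000000000000000000000000000000000000000000000000000000000000000000000000000000000000000000000000000000000000000000000000000000000000000000000000000000000000000000000000000006) := by gcongr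
  push_cast at this
  norm_num at this h1 hf ⊢
  linarith

lemma redB (m' n k l : ℕ) (hm2 : 2 ≤ m') (hmM : m' ≤ 1760) (hk : k ≤ 160) (hl : l ≤ 100) :
    3 * (0.000000000000001 : ℝ) < |Lam m' n k l| := by
  have hc := checkB
  simp only [force_eq] at hc
  have hΦ : 0 < fi1 := by decide +kernel
  have c1 : qB * (2 ^ 10 * 2 ^ 16) * eA ≤ fi1 := by decide +kernel
  have c2 : 8 * D1 * (qB * (2 ^ 10 * 2 ^ 16)) ≤ fi1 * fi1 := by decide +kernel
  have c4 : cl ≤ 4 * D1 := by decide +kernel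
  have hFC := resid_good D1 eA (qB * (2 ^ 10 * 2 ^ 16)) fi1 cl Cx (log goldenRatio) D1_pos hΦ fi1_le le_fi1 Cx_bd.1 Cx_bd.2 c4 c1 c2
  have hS : (14293004 + qB * (2 ^ 10 * 2 ^ 16) * cl / fi1 + (2 ^ 9 - 1)) % (2 ^ 10 * 2 ^ 16) = 0 := by decide +kernel
  have hκ := eps_bd qB pB 1 30 (10 ^ 12) (by decide +kernel) (by decide +kernel)
  have hκ' : |(qB : ℝ) * log rho - pB * log goldenRatio| ≤ 30 / 10 ^ 12 := by
    push_cast at hκ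
    rw [abs_of_nonneg (by nlinarith [hκ.1]), le_div_iff₀ (by positivity)]
    linarith [hκ.2]
  have := red D1 eA qB pB 1760 fi1 rXl1 rXu1 fXl1 fXu1 1780 1040 160 100 (2 ^ 10) (2 ^ 16) 14293004 (2 ^ 9 - 1) 30 _ _
    D1_pos hΦ fi1_le le_fi1 rXl1_le le_rXu1 fXl1_le le_fXu1 c1 c2 hc hFC hS (by norm_num) hκ' m' n k l hm2 hmM hk hl
  have hf := log_phi_bd.1
  have hq : (qB : ℝ) ≤ 1071000000 := by norm_num [qB]
  have hL := abs_nonneg (Lam m' n k l)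
  by_contra hcon
  push Not at hcon
  have h1 : (qB : ℝ) * |Lam m' n k l| ≤ 1071000000 * (3 * 0.000000000000001) := by gcongr
  push_cast at this
  norm_num at this h1 hf ⊢
  linarith

lemma chain (M K L n0 : ℕ) (τ : ℝ) (hred : ∀ m' n k l : ℕ, 2 ≤ m' → m' ≤ M → k ≤ K → l ≤ L → 3 * τ < |Lam m' n k l|)
    (h1 : 24 * (0.6181:ℝ) ^ n0 ≤ τ) (h2 : 4.1 * (0.7551:ℝ) ^ K ≤ τ) (h3 : 2.63 * (0.6181:ℝ) ^ L ≤ τ)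
    (m' n k l : ℕ) (hm2 : 2 ≤ m') (hmM : m' ≤ M) (h : |Lam m' n k l| ≤ 24 * goldenRatio⁻¹ ^ n) : n < n0 := by
  by_contra hn
  push Not at hn
  have hp := phi_inv_bd.le; have hp0 := phi_inv_pos.le; have hp1 := phi_inv_lt.le
  have hr := rho_inv_bd.le; have hr0 := rho_inv_pos.le; have hr1 := rho_inv_lt.le
  have hτ : 0 ≤ τ := le_trans (by positivity) h1
  have a1 : |Lam m' n k l| ≤ τ := by
    refine h.trans (le_trans ?_ h1)
    have : goldenRatio⁻¹ ^ n ≤ (0.6181:ℝ) ^ n0 := (pow_le_pow_of_le_one hp0 hp1 hn).trans (pow_le_pow_left₀ hp0 hp _)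
    linarith
  have a2 : K ≤ k → Ak k ≤ τ := by
    intro hk
    refine (Ak_bd k).2.trans (le_trans ?_ h2)
    have : rho⁻¹ ^ k ≤ (0.7551:ℝ) ^ K := (pow_le_pow_of_le_one hr0 hr1 hk).trans (pow_le_pow_left₀ hr0 hr _)
    linarith
  have a3 : L ≤ l → Bl l ≤ τ := by
    intro hk
    refine (Bl_bd l).2.trans (le_trans ?_ h3)
    have : goldenRatio⁻¹ ^ l ≤ (0.6181:ℝ) ^ L := (pow_le_pow_of_le_one hp0 hp1 hk).trans (pow_le_pow_left₀ hp0 hp _)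
    linarith
  by_cases hk : k ≤ K <;> by_cases hl : l ≤ L
  · linarith [hred m' n k l hm2 hmM hk hl]
  · linarith [hred m' n k 0 hm2 hmM hk (Nat.zero_le _), Lam_l0 m' n k l, a3 (by omega)]
  · linarith [hred m' n 0 l hm2 hmM (Nat.zero_le _) hl, Lam_k0 m' n k l, a2 (by omega)]
  · linarith [hred m' n 0 0 hm2 hmM (Nat.zero_le _) (Nat.zero_le _), Lam_l0 m' n 0 l, Lam_k0 m' n k l, a2 (by omega), a3 (by omega)]

set_option exponentiation.threshold 5000 in
lemma final_bound (m' n k l : ℕ) (hm2 : 2 ≤ m') (h1 : |Lam m' n k l| ≤ 1) (h2 : |Lam m' n k l| ≤ 24 * goldenRatio⁻¹ ^ n) :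
    m' < 170 := by
  have hb := big_bound m' n k l h1 h2
  have hb' : m' ≤ 10 ^ 188 := by
    have : m' < 10 ^ 188 := by exact_mod_cast hb
    exact this.le
  have n1 := chain (10 ^ 188) 1740 1010 1010 0.00000000000000000000000000000000000000000000000000000000000000000000000000000000000000000000000000000000000000000000000000000000000000000000000000000000000000000000000000000000000000000000000000000000000000006 redA (by norm_num) (by norm_num) (by norm_num) m' n k l hm2 hb' h2
  have nf := (nf_ge m' n k l h1).1
  have la := log_rho_bd.1; have lf := log_phi_bd.2; have lf0 := log_phi_bd.1
  have key : ∀ n0 : ℕ, n ≤ n0 → (m' : ℝ) * 0.2811 ≤ n0 * 0.4813 + 6 := by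
    intro n0 hn
    have hn' : (n : ℝ) ≤ n0 := by exact_mod_cast hn
    have e1 : (m' : ℝ) * 0.2811 ≤ m' * log rho := by gcongr
    have e2 : (n : ℝ) * log goldenRatio ≤ n0 * 0.4813 := by gcongr
    linarith
  have m1 : m' ≤ 1760 := by
    have := key 1009 (by omega)
    have : (m' : ℝ) ≤ 1760 := by norm_num at this; linarith
    exact_mod_cast this
  have n2 := chain 1760 160 100 85 0.000000000000001 redB (by norm_num) (by norm_num) (by norm_num) m' n k l hm2 m1 h2
  have := key 84 (by omega)
  have : (m' : ℝ) < 170 := by norm_num at this; linarith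
  exact_mod_cast this

end PartQ7

section PartQ8
open Real

/-- differences `y - x` for `x` before `y` in the list, with `thr ≤ y` -/
def difs (thr : ℕ) (l : List ℕ) : List ℕ → List ℕ :=
  List.rec (fun acc => acc) (fun x l ih acc =>
    ih (List.rec acc (fun y _ r => Bool.casesOn (Nat.ble thr y) r (Nat.sub y x :: r)) l)) l

lemma difs_cons (thr x : ℕ) (l acc : List ℕ) : difs thr (x :: l) acc =
    difs thr l (l.foldr (fun y r => if thr ≤ y then (y - x) :: r else r) acc) := by
  have : ∀ l : List ℕ, (List.rec acc (fun y _ r => Bool.casesOn (Nat.ble thr y) r (Nat.sub y x :: r)) l : List ℕ) =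
      l.foldr (fun y r => if thr ≤ y then (y - x) :: r else r) acc := by
    intro l
    induction l with
    | nil => rfl
    | cons y l ih =>
      rw [List.foldr_cons, ← ih]
      by_cases h : thr ≤ y
      · rw [if_pos h]; simp only [Nat.ble_eq_true_of_le h]; rfl
      · rw [if_neg h]
        have : Nat.ble thr y = false := by
          rcases hb : Nat.ble thr y with _ | _
          · rfl
          · exact absurd (Nat.le_of_ble_eq_true hb) h
        simp only [this]
  exact congrArg (difs thr l) (this l)

lemma foldr_mem (thr x : ℕ) (l acc : List ℕ) :
    (∀ z ∈ acc, z ∈ l.foldr (fun y r => if thr ≤ y then (y - x) :: r else r) acc) ∧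
    ∀ y ∈ l, thr ≤ y → y - x ∈ l.foldr (fun y r => if thr ≤ y then (y - x) :: r else r) acc := by
  induction l with
  | nil => simp
  | cons y l ih =>
    rw [List.foldr_cons]
    constructor
    · intro z hz
      split_ifs
      · exact List.mem_cons_of_mem _ (ih.1 z hz)
      · exact ih.1 z hz
    · intro w hw ht
      rcases List.mem_cons.1 hw with rfl | hw
      · rw [if_pos ht]; exact List.mem_cons_self ..
      · split_ifs
        · exact List.mem_cons_of_mem _ (ih.2 w hw ht)
        · exact ih.2 w hw ht

lemma difs_mem (thr : ℕ) (l : List ℕ) : ∀ acc : List ℕ, (∀ z ∈ acc, z ∈ difs thr l acc) ∧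
    ∀ (i j x y : ℕ), i < j → l[i]? = some x → l[j]? = some y → thr ≤ y → y - x ∈ difs thr l acc := by
  induction l with
  | nil => intro acc; exact ⟨fun z hz => hz, fun i j x y _ h => by simp at h⟩
  | cons a l ih =>
    intro acc
    rw [difs_cons]
    refine ⟨fun z hz => (ih _).1 z ((foldr_mem thr a l acc).1 z hz), ?_⟩
    intro i j x y hij hx hy ht
    obtain ⟨j, rfl⟩ : ∃ j', j = j' + 1 := ⟨j - 1, by omega⟩
    rw [List.getElem?_cons_succ] at hy
    rcases i with _ | i
    · rw [List.getElem?_cons_zero] at hx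
      obtain rfl := Option.some.inj hx
      exact (ih _).1 _ ((foldr_mem thr a l acc).2 y (List.mem_of_getElem? hy) ht)
    · rw [List.getElem?_cons_succ] at hx
      exact (ih _).2 i j x y (by omega) hx hy ht

def sols : List ℤ := [-226, -82, -52, -30, -27, -18, -9, -6, -5, -4, -3, -1, 0, 1, 2, 3, 4, 6, 7, 8, 10, 11, 13, 15, 16, 20, 25, 31, 32, 36, 44, 52, 62, 111, 262]

def padTab : List ℕ := [2, 3, 4, 5, 7, 9, 12, 16, 21, 28, 37, 49, 65, 86, 114, 151, 200, 265, 351, 465, 616, 816, 1081, 1432, 1897,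
  2513, 3329, 4410, 5842, 7739, 10252, 13581, 17991, 23833, 31572, 41824, 55405, 73396, 97229, 128801, 170625,
  226030, 299426, 396655, 525456, 696081, 922111, 1221537, 1618192, 2143648, 2839729, 3761840, 4983377,
  6601569, 8745217, 11584946, 15346786, 20330163, 26931732, 35676949, 47261895, 62608681, 82938844, 109870576,
  145547525, 192809420, 255418101, 338356945, 448227521, 593775046, 786584466, 1042002567, 1380359512,
  1828587033, 2422362079, 3208946545, 4250949112, 5631308624, 7459895657, 9882257736, 13091204281, 17342153393,
  22973462017, 30433357674, 40315615410, 53406819691, 70748973084, 93722435101, 124155792775, 164471408185,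
  217878227876, 288627200960, 382349636061, 506505428836, 670976837021, 888855064897, 1177482265857,
  1559831901918, 2066337330754, 2737314167775, 3626169232672, 4803651498529, 6363483400447, 8429820731201,
  11167134898976, 14793304131648, 19596955630177, 25960439030624, 34390259761825, 45557394660801,
  60350698792449, 79947654422626, 105908093453250, 140298353215075, 185855747875876, 246206446668325,
  326154101090951, 432062194544201, 572360547759276, 758216295635152, 1004422742303477, 1330576843394428,
  1762639037938629, 2334999585697905, 3093215881333057, 4097638623636534, 5428215467030962, 7190854504969591,
  9525854090667496, 12619069972000553, 16716708595637087, 22144924062668049, 29335778567637640,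
  38861632658305136, 51480702630305689, 68197411225942776, 90342335288610825, 119678113856248465,
  158539746514553601, 210020449144859290, 278217860370802066, 368560195659412891, 488238309515661356,
  646778056030214957, 856798505175074247, 1135016365545876313, 1503576561205289204, 1991814870720950560,
  2638592926751165517, 3495391431926239764, 4630407797472116077, 6133984358677405281, 8125799229398355841,
  10764392156149521358, 14259783588075761122, 18890191385547877199, 25024175744225282480, 33149974973623638321,
  43914367129773159679, 58174150717848920801, 77064342103396798000, 102088517847622080480]
def fibTab : List ℕ := [1, 2, 3, 5, 8, 13, 21, 34, 55, 89, 144, 233, 377, 610, 987, 1597, 2584, 4181, 6765, 10946, 17711, 28657,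
  46368, 75025, 121393, 196418, 317811, 514229, 832040, 1346269, 2178309, 3524578, 5702887, 9227465, 14930352,
  24157817, 39088169, 63245986, 102334155, 165580141, 267914296, 433494437, 701408733, 1134903170, 1836311903,
  2971215073, 4807526976, 7778742049, 12586269025, 20365011074, 32951280099, 53316291173, 86267571272,
  139583862445, 225851433717, 365435296162, 591286729879, 956722026041, 1548008755920, 2504730781961,
  4052739537881, 6557470319842, 10610209857723, 17167680177565, 27777890035288, 44945570212853, 72723460248141,
  117669030460994, 190392490709135, 308061521170129, 498454011879264, 806515533049393, 1304969544928657,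
  2111485077978050, 3416454622906707, 5527939700884757, 8944394323791464, 14472334024676221, 23416728348467685,
  37889062373143906, 61305790721611591, 99194853094755497, 160500643816367088, 259695496911122585,
  420196140727489673, 679891637638612258, 1100087778366101931, 1779979416004714189, 2880067194370816120,
  4660046610375530309, 7540113804746346429, 12200160415121876738, 19740274219868223167, 31940434634990099905,
  51680708854858323072, 83621143489848422977, 135301852344706746049, 218922995834555169026,
  354224848179261915075, 573147844013817084101, 927372692193078999176, 1500520536206896083277,
  2427893228399975082453, 3928413764606871165730]

lemma padTab_spec : ∀ m < 162, padTab[m]? = some (padovan (m + 4)) := by decide +kernel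
lemma fibTab_spec : ∀ m < 104, fibTab[m]? = some (Nat.fib (m + 2)) := by decide +kernel

lemma tab_disj : disj 80 (difs 816 padTab []) (difs 0 fibTab []) = true := by decide +kernel

lemma large_none (m n m1 n1 : ℕ) (h1 : 3 < m1) (h2 : m1 < m) (h3 : 25 ≤ m) (h4 : m < 166) (h5 : 1 < n1) (h6 : n1 < n)
    (h7 : n < 106) (h : padovan m + Nat.fib n1 = padovan m1 + Nat.fib n) : False := by
  have a := padTab_spec (m - 4) (by omega)
  have a1 := padTab_spec (m1 - 4) (by omega)
  have b := fibTab_spec (n - 2) (by omega)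
  have b1 := fibTab_spec (n1 - 2) (by omega)
  rw [Nat.sub_add_cancel (by omega)] at a a1 b b1
  have hthr : 816 ≤ padovan m := by
    have : padovan 25 = 816 := by decide +kernel
    rw [← this]; exact pad_mono h3
  have c := (difs_mem 816 padTab []).2 _ _ _ _ (by omega) a1 a hthr
  have d := (difs_mem 0 fibTab []).2 _ _ _ _ (by omega) b1 b (Nat.zero_le _)
  have e1 : padovan m1 ≤ padovan m := pad_mono h2.le
  have e2 : Nat.fib n1 ≤ Nat.fib n := Nat.fib_mono h6.le
  have e : padovan m - padovan m1 = Nat.fib n - Nat.fib n1 := by omega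
  exact disj_spec _ _ _ tab_disj _ c (e ▸ d)

def smallOK (m m1 n n1 : ℕ) : Bool :=
  decide (m1 ≤ 3) || decide (n1 ≤ 1) || !(decide (padovan m + Nat.fib n1 = padovan m1 + Nat.fib n)) ||
    sols.contains ((padovan m : ℤ) - (Nat.fib n : ℤ))

lemma small_chk : ∀ m < 25, ∀ m1 < m, ∀ n < 18, ∀ n1 < n, smallOK m m1 n n1 = true := by decide +kernel

lemma small_all (m : ℕ) (hm : m < 25) (m1 : ℕ) (hm1 : m1 < m) (h3 : 3 < m1) (n : ℕ) (hn : n < 18) (n1 : ℕ) (hn1 : n1 < n)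
    (h1 : 1 < n1) (h : padovan m + Nat.fib n1 = padovan m1 + Nat.fib n) :
    (padovan m : ℤ) - (Nat.fib n : ℤ) ∈ sols := by
  have := small_chk m hm m1 hm1 n hn n1 hn1
  simp only [smallOK, Bool.or_eq_true, decide_eq_true_eq, Bool.not_eq_true', decide_eq_false_iff_not, List.contains_iff_mem] at this
  rcases this with ((h' | h') | h') | h'
  · omega
  · omega
  · exact absurd h h'
  · exact h'

lemma n_bound (m n m1 n1 N : ℕ) (h6 : n1 < n) (h : padovan m + Nat.fib n1 = padovan m1 + Nat.fib n) (hN : padovan m < Nat.fib N) :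
    n < N + 2 := by
  by_contra hn
  push Not at hn
  have h1 : Nat.fib n1 ≤ Nat.fib (n - 1) := Nat.fib_mono (by omega)
  have h2 : Nat.fib n = Nat.fib (n - 2) + Nat.fib (n - 1) := by
    obtain ⟨j, rfl⟩ : ∃ j, n = j + 2 := ⟨n - 2, by omega⟩
    exact Nat.fib_add_two
  have h3 : Nat.fib N ≤ Nat.fib (n - 2) := Nat.fib_mono (by omega)
  omega

lemma main_lt (m n m1 n1 : ℕ) (h1 : 3 < m1) (h2 : m1 < m) (h5 : 1 < n1) (h5' : 1 < n)
    (h : padovan m + Nat.fib n1 = padovan m1 + Nat.fib n) :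
    (padovan m : ℤ) - (Nat.fib n : ℤ) ∈ sols := by
  have hlt : padovan m1 < padovan m := by
    by_cases hm : 20 ≤ m
    · have := pad_diff m m1 h2 hm; omega
    · have key : ∀ m < 20, ∀ m1 < m, 3 < m1 → padovan m1 < padovan m := by decide +kernel
      exact key m (by omega) m1 h2 h1
  have h6 : n1 < n := by
    by_contra hn
    have := Nat.fib_mono (show n ≤ n1 by omega)
    omega
  by_cases hm : m < 25
  · have : padovan m < Nat.fib 16 := by
      have a : padovan 24 < Nat.fib 16 := by decide +kernel
      exact lt_of_le_of_lt (pad_mono (show m ≤ 24 by omega)) a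
    exact small_all m hm m1 h2 h1 n (n_bound m n m1 n1 16 h6 h this) n1 h6 h5 h
  · exfalso
    obtain ⟨s1, s2⟩ := setup' m n m1 n1 h2 h6 (by omega) h
    have hb := final_bound (m + 4) n (m - m1) (n - n1) (by omega) (by exact_mod_cast s2) (by exact_mod_cast s1)
    have : padovan m < Nat.fib 103 := by
      have a : padovan 165 < Nat.fib 103 := by decide +kernel
      exact lt_of_le_of_lt (pad_mono (show m ≤ 165 by omega)) a
    have hn := n_bound m n m1 n1 103 h6 h this
    exact large_none m n m1 n1 h1 h2 (by omega) (by omega) h5 h6 (by omega) h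

end PartQ8

/-- If an integer `c` admits at least two representations of the form `c = P m - F n`
with `m > 3` and `n > 1`, then `c` belongs to the given set. -/
theorem pillai_classification (c : ℤ)
    (hc : ∃ m n m₁ n₁ : ℕ, 3 < m ∧ 3 < m₁ ∧ 1 < n ∧ 1 < n₁ ∧ (m, n) ≠ (m₁, n₁) ∧
      (padovan m : ℤ) - (Nat.fib n : ℤ) = c ∧
      (padovan m₁ : ℤ) - (Nat.fib n₁ : ℤ) = c) :
    c ∈ ({-226, -82, -52, -30, -27, -18, -9, -6, -5, -4, -3, -1, 0, 1, 2, 3, 4,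
      6, 7, 8, 10, 11, 13, 15, 16, 20, 25, 31, 32, 36, 44, 52, 62, 111, 262} : Set ℤ) := by
  suffices hs : c ∈ sols by
    simpa only [sols, List.mem_cons, List.not_mem_nil, or_false, Set.mem_insert_iff, Set.mem_singleton_iff] using hs
  obtain ⟨m, n, m₁, n₁, hm, hm1, hn, hn1, hne, h1, h2⟩ := hc
  rcases lt_trichotomy m m₁ with hlt | heq | hlt
  · rw [← h2]
    exact main_lt m₁ n₁ m n hm hlt hn hn1 (by omega)
  · exfalso
    subst heq
    have he : Nat.fib n = Nat.fib n₁ := by omega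
    have hnn : n = n₁ := by
      rcases lt_trichotomy n n₁ with h | h | h
      · exact absurd he (Nat.fib_lt_fib (by omega) |>.2 h).ne
      · exact h
      · exact absurd he (Nat.fib_lt_fib (by omega) |>.2 h).ne'
    exact hne (by rw [hnn])
  · rw [← h1]
    exact main_lt m n m₁ n₁ hm1 hlt hn1 hn (by omega)
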